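/- arXiv:math/0412466 — 4 statements merged into one kernel-verified Lean document; each statement's English description precedes it below -/
import Mathlib

section
/- Let R = K[w,x,y,z]. (a) If V = span{wx, wy, h} where h ∈ R_2 is a nonzerodivisor on R/(wx,wy) (equivalently h ∉ (w) and h ∉ (x,y)), then dim_K (R/(V))_i = 2i+3 for all i ≥ 2, and the values in degrees 0, 1 are 1 and 4. (b) The same conclusion holds for V = span{w², wx, h} with h ∈ R_2 a nonzerodivisor on R/(w²,wx). -/
open MvPolynomial

noncomputable section

/-- The Hilbert function of the graded quotient `R/I`, where
`R = K[x_1,...,x_n]`: the dimension of the image in `R/I` of the space of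
degree-`i` homogeneous forms. -/
def hilb (n : ℕ) (K : Type*) [Field K] (I : Ideal (MvPolynomial (Fin n) K)) (i : ℕ) : ℕ :=
  Module.finrank K
    ((homogeneousSubmodule (Fin n) K i).map (Ideal.Quotient.mkₐ K I).toLinearMap)

/-- The socle `(0 : A_+)` of `A = R/I`: the elements killed by (the images of)
all the variables, equivalently by the irrelevant maximal ideal. -/
def socleSub (n : ℕ) (K : Type*) [Field K] (I : Ideal (MvPolynomial (Fin n) K)) :
    Submodule K (MvPolynomial (Fin n) K ⧸ I) :=
  ⨅ k : Fin n, LinearMap.ker (LinearMap.mulLeft K (Ideal.Quotient.mk I (X k)))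

/-- A homogeneous (graded) ideal: one containing each homogeneous component of
each of its elements. -/
def IdealHomog {n : ℕ} {K : Type*} [Field K] (I : Ideal (MvPolynomial (Fin n) K)) : Prop :=
  ∀ f ∈ I, ∀ d : ℕ, homogeneousComponent d f ∈ I

/-- `R/I` is a graded Artinian Gorenstein quotient of `R = K[x_1,...,x_n]`
of socle degree `j`: `I` is homogeneous, `R/I` is finite dimensional over `K`
with 1-dimensional socle, and `j` is the top nonzero degree. -/
def IsAG (n : ℕ) (K : Type*) [Field K] (I : Ideal (MvPolynomial (Fin n) K)) (j : ℕ) : Prop :=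
  IdealHomog I ∧ FiniteDimensional K (MvPolynomial (Fin n) K ⧸ I) ∧
    Module.finrank K (socleSub n K I) = 1 ∧
    hilb n K I j ≠ 0 ∧ ∀ i, j < i → hilb n K I i = 0

/-- Macaulay's bound `c^{(d)}`: writing `c = C(k_d,d) + ... + C(k_1,1)` with
`k_d > k_d-1 > ... > k_1 ≥ 0` (the `d`-th Macaulay expansion, computed greedily),
`c^{(d)} = C(k_d+1,d+1) + ... + C(k_1+1,2)`; by convention `0^{(d)} = 0`. -/
def macB : ℕ → ℕ → ℕ
  | _, 0 => 0
  | c, (d+1) =>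
    if c = 0 then 0 else
      let k := Nat.findGreatest (fun k => Nat.choose k (d+1) ≤ c) (c + d + 1)
      Nat.choose (k+1) (d+2) + macB (c - Nat.choose k (d+1)) d

/-- `(t_0, ..., t_m)` is an O-sequence: `t_0 = 1` and `t_{i+1} ≤ t_i^{(i)}`
for `1 ≤ i ≤ m-1`. -/
def IsOSeq (t : ℕ → ℕ) (m : ℕ) : Prop :=
  t 0 = 1 ∧ ∀ i, 1 ≤ i → i + 1 ≤ m → t (i + 1) ≤ macB (t i) i

/-- `ΔH_{≤ m}` is an O-sequence: the first differences `ΔH_i = h_i - h_{i-1}`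
(with `ΔH_0 = 1`) are nonnegative for `i ≤ m`, and `(ΔH_0, ..., ΔH_m)` is an
O-sequence. -/
def DeltaOSeq (h : ℕ → ℕ) (m : ℕ) : Prop :=
  (∀ i, 1 ≤ i → i ≤ m → h (i - 1) ≤ h i) ∧
    IsOSeq (fun i => if i = 0 then 1 else h i - h (i - 1)) m

section helpers

variable {K : Type*} [Field K]

/-- The degree `i` piece of an ideal. -/
def idealPiece (I : Ideal (MvPolynomial (Fin 4) K)) (i : ℕ) :
    Submodule K (MvPolynomial (Fin 4) K) :=
  I.restrictScalars K ⊓ homogeneousSubmodule (Fin 4) K i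

theorem mem_idealPiece {I : Ideal (MvPolynomial (Fin 4) K)} {i : ℕ}
    {f : MvPolynomial (Fin 4) K} :
    f ∈ idealPiece I i ↔ f ∈ I ∧ f.IsHomogeneous i := by
  simp [idealPiece]

instance homog_fd (i : ℕ) : FiniteDimensional K (homogeneousSubmodule (Fin 4) K i) :=
  Module.Finite.iff_fg.mpr (homogeneousSubmodule_fg _ _ i)

instance piece_fd (I : Ideal (MvPolynomial (Fin 4) K)) (i : ℕ) :
    FiniteDimensional K (idealPiece I i) :=
  Submodule.finiteDimensional_of_le inf_le_right

theorem hilb_add (I : Ideal (MvPolynomial (Fin 4) K)) (i : ℕ) :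
    hilb 4 K I i + Module.finrank K (idealPiece I i) =
      Module.finrank K (homogeneousSubmodule (Fin 4) K i) := by
  have h1 := LinearMap.finrank_range_add_finrank_ker
    ((Ideal.Quotient.mkₐ K I).toLinearMap.domRestrict (homogeneousSubmodule (Fin 4) K i))
  rw [LinearMap.range_domRestrict] at h1
  rw [← h1, hilb]
  congr 1
  rw [← Submodule.finrank_map_subtype_eq]
  suffices hs : idealPiece I i = Submodule.map (homogeneousSubmodule (Fin 4) K i).subtype
      (LinearMap.ker ((Ideal.Quotient.mkₐ K I).toLinearMap.domRestrict
        (homogeneousSubmodule (Fin 4) K i))) by rw [hs]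
  ext f
  simp only [mem_idealPiece, Submodule.mem_map, LinearMap.mem_ker]
  constructor
  · rintro ⟨h1, h2⟩
    exact ⟨⟨f, h2⟩, Ideal.Quotient.eq_zero_iff_mem.mpr h1, rfl⟩
  · rintro ⟨⟨g, h2⟩, h1, rfl⟩
    exact ⟨Ideal.Quotient.eq_zero_iff_mem.mp h1, h2⟩

theorem finrank_restrictSupport (s : Set (Fin 4 →₀ ℕ)) :
    Module.finrank K (restrictSupport K s) = s.ncard := by
  rw [Module.finrank_eq_nat_card_basis (basisRestrictSupport K s)]
  rfl

theorem degree_finite (i : ℕ) : {d : Fin 4 →₀ ℕ | d.degree = i}.Finite := by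
  have := (Finsupp.finite_of_degree_le (σ := Fin 4) i)
  exact this.subset fun d hd => le_of_eq hd

theorem hilb_mono (J : Ideal (MvPolynomial (Fin 4) K)) (P : Set (Fin 4 →₀ ℕ))
    (hJ : ∀ f, f ∈ J ↔ ∀ d ∈ f.support, d ∈ P) (i : ℕ) :
    hilb 4 K J i = {d : Fin 4 →₀ ℕ | d.degree = i ∧ d ∉ P}.ncard := by
  have h1 := hilb_add J i
  have e1 : homogeneousSubmodule (Fin 4) K i = restrictSupport K {d | d.degree = i} :=
    homogeneousSubmodule_eq_finsupp_supported ..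
  have e2 : idealPiece J i = restrictSupport K {d | d.degree = i ∧ d ∈ P} := by
    ext f
    rw [idealPiece, e1, Submodule.mem_inf, Submodule.restrictScalars_mem, hJ,
      mem_restrictSupport_iff, mem_restrictSupport_iff]
    simp only [Set.subset_def, Finset.mem_coe, Set.mem_ofPred_eq]
    exact ⟨fun h d hd => ⟨h.2 d hd, h.1 d hd⟩, fun h => ⟨fun d hd => (h d hd).2,
      fun d hd => (h d hd).1⟩⟩
  rw [e1, e2, finrank_restrictSupport, finrank_restrictSupport] at h1
  have h2 := Set.ncard_inter_add_ncard_sdiff_eq_ncard {d : Fin 4 →₀ ℕ | d.degree = i} P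
    (degree_finite i)
  have e3 : {d : Fin 4 →₀ ℕ | d.degree = i} ∩ P = {d | d.degree = i ∧ d ∈ P} := rfl
  have e4 : {d : Fin 4 →₀ ℕ | d.degree = i} \ P = {d | d.degree = i ∧ d ∉ P} := rfl
  rw [e3, e4] at h2
  omega

attribute [local instance] MvPolynomial.gradedAlgebra

theorem comp_mul_add {h : MvPolynomial (Fin 4) K} (hh : h.IsHomogeneous 2)
    (r : MvPolynomial (Fin 4) K) (i : ℕ) :
    homogeneousComponent (i + 2) (h * r) = h * homogeneousComponent i r := by
  have := DirectSum.coe_decompose_mul_add_of_left_mem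
    (homogeneousSubmodule (Fin 4) K) (i := 2) (j := i) (b := r) hh
  rw [add_comm i 2]
  rw [← decomposition.decompose'_apply, ← decomposition.decompose'_apply]
  exact this

theorem comp_mul_lt {h : MvPolynomial (Fin 4) K} (hh : h.IsHomogeneous 2)
    (r : MvPolynomial (Fin 4) K) (i : ℕ) (hi : i < 2) :
    homogeneousComponent i (h * r) = 0 := by
  have := DirectSum.coe_decompose_mul_of_left_mem_of_not_le
    (homogeneousSubmodule (Fin 4) K) (i := 2) (n := i) (b := r) hh (by omega)
  rw [← decomposition.decompose'_apply]
  exact this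

theorem comp_mem (J : Ideal (MvPolynomial (Fin 4) K)) (P : Set (Fin 4 →₀ ℕ))
    (hJ : ∀ f, f ∈ J ↔ ∀ d ∈ f.support, d ∈ P) (i : ℕ) (f) (hf : f ∈ J) :
    homogeneousComponent i f ∈ J := by
  rw [hJ] at hf ⊢
  intro d hd
  apply hf
  rw [mem_support_iff, coeff_homogeneousComponent] at hd
  rw [mem_support_iff]
  intro h0
  simp [h0] at hd

theorem hilb_low (J : Ideal (MvPolynomial (Fin 4) K)) (P : Set (Fin 4 →₀ ℕ))
    (hJ : ∀ f, f ∈ J ↔ ∀ d ∈ f.support, d ∈ P)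
    (h : MvPolynomial (Fin 4) K) (hh : h.IsHomogeneous 2) (i : ℕ) (hi : i < 2) :
    hilb 4 K (J ⊔ Ideal.span {h}) i = hilb 4 K J i := by
  have e : idealPiece (J ⊔ Ideal.span {h}) i = idealPiece J i := by
    ext f
    rw [mem_idealPiece, mem_idealPiece]
    constructor
    · rintro ⟨hf, hfi⟩
      refine ⟨?_, hfi⟩
      obtain ⟨j, hj, y, hy, rfl⟩ := Submodule.mem_sup.mp hf
      obtain ⟨r, rfl⟩ := Ideal.mem_span_singleton.mp hy
      rw [← homogeneousComponent_eq_self hfi, map_add, comp_mul_lt hh r i hi, add_zero]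
      exact comp_mem J P hJ i j hj
    · exact fun hf => ⟨Ideal.mem_sup_left hf.1, hf.2⟩
  have h1 := hilb_add (J ⊔ Ideal.span {h}) i
  have h2 := hilb_add J i
  rw [e] at h1
  omega

theorem hilb_high (J : Ideal (MvPolynomial (Fin 4) K)) (P : Set (Fin 4 →₀ ℕ))
    (hJ : ∀ f, f ∈ J ↔ ∀ d ∈ f.support, d ∈ P) (hJ1 : 1 ∉ J)
    (h : MvPolynomial (Fin 4) K) (hh : h.IsHomogeneous 2)
    (hnzd : ∀ f, h * f ∈ J → f ∈ J) (i : ℕ) :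
    hilb 4 K (J ⊔ Ideal.span {h}) (i + 2) + hilb 4 K J i = hilb 4 K J (i + 2) := by
  have h0 : h ≠ 0 := by
    rintro rfl
    exact hJ1 (hnzd 1 (by simp))
  have hinj : Function.Injective (LinearMap.mulLeft K h) := fun a b hab =>
    mul_left_cancel₀ h0 hab
  have e1 : idealPiece (J ⊔ Ideal.span {h}) (i + 2) = idealPiece J (i + 2) ⊔
      (homogeneousSubmodule (Fin 4) K i).map (LinearMap.mulLeft K h) := by
    apply le_antisymm
    · intro f hf
      obtain ⟨hf, hfi⟩ := mem_idealPiece.mp hf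
      obtain ⟨j, hj, y, hy, rfl⟩ := Submodule.mem_sup.mp hf
      obtain ⟨r, rfl⟩ := Ideal.mem_span_singleton.mp hy
      rw [← homogeneousComponent_eq_self hfi, map_add, comp_mul_add hh r i]
      refine Submodule.add_mem_sup ?_ ?_
      · exact mem_idealPiece.mpr ⟨comp_mem J P hJ _ j hj, homogeneousComponent_isHomogeneous _ _⟩
      · exact ⟨_, homogeneousComponent_isHomogeneous _ _, rfl⟩
    · refine sup_le ?_ ?_
      · intro f hf
        rw [mem_idealPiece] at hf ⊢
        exact ⟨Ideal.mem_sup_left hf.1, hf.2⟩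
      · rintro _ ⟨r, hr, rfl⟩
        refine mem_idealPiece.mpr ⟨Ideal.mem_sup_right ?_, ?_⟩
        · exact Ideal.mem_span_singleton.mpr ⟨r, rfl⟩
        · rw [add_comm]
          exact hh.mul hr
  have e2 : idealPiece J (i + 2) ⊓
      (homogeneousSubmodule (Fin 4) K i).map (LinearMap.mulLeft K h) =
      (idealPiece J i).map (LinearMap.mulLeft K h) := by
    ext f
    constructor
    · rintro ⟨hf, r, hr, rfl⟩
      exact ⟨r, mem_idealPiece.mpr ⟨hnzd r (mem_idealPiece.mp hf).1, hr⟩, rfl⟩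
    · rintro ⟨r, hr, rfl⟩
      have hr' := mem_idealPiece.mp hr
      refine ⟨mem_idealPiece.mpr ⟨J.mul_mem_left h hr'.1, ?_⟩, r, hr'.2, rfl⟩
      rw [add_comm]
      exact hh.mul hr'.2
  have h1 := hilb_add (J ⊔ Ideal.span {h}) (i + 2)
  have h2 := hilb_add J (i + 2)
  have h3 := hilb_add J i
  have h4 := Submodule.finrank_sup_add_finrank_inf_eq (idealPiece J (i + 2))
    ((homogeneousSubmodule (Fin 4) K i).map (LinearMap.mulLeft K h))
  rw [← e1, e2, ← (Submodule.equivMapOfInjective _ hinj (idealPiece J i)).finrank_eq,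
    ← (Submodule.equivMapOfInjective _ hinj (homogeneousSubmodule (Fin 4) K i)).finrank_eq] at h4
  omega

/-- Combination of the previous facts with the count of standard monomials. -/
theorem hilb_all (J : Ideal (MvPolynomial (Fin 4) K)) (P : Set (Fin 4 →₀ ℕ))
    (hJ : ∀ f, f ∈ J ↔ ∀ d ∈ f.support, d ∈ P) (hP : 0 ∉ P)
    (hc : ∀ i, {d : Fin 4 →₀ ℕ | d.degree = i ∧ d ∉ P}.ncard =
      (∑ a ∈ Finset.range (i + 1), (a + 1)) + i)
    (h : MvPolynomial (Fin 4) K) (hh : h.IsHomogeneous 2)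
    (hnzd : ∀ f, h * f ∈ J → f ∈ J) :
    hilb 4 K (J ⊔ Ideal.span {h}) 0 = 1 ∧ hilb 4 K (J ⊔ Ideal.span {h}) 1 = 4 ∧
      ∀ i, 2 ≤ i → hilb 4 K (J ⊔ Ideal.span {h}) i = 2 * i + 3 := by
  have hm := fun i => (hilb_mono J P hJ i).trans (hc i)
  have hJ1 : (1 : MvPolynomial (Fin 4) K) ∉ J := by
    intro h1
    exact hP ((hJ 1).mp h1 0 (by simp))
  refine ⟨?_, ?_, ?_⟩
  · rw [hilb_low J P hJ h hh 0 (by norm_num), hm]; rfl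
  · rw [hilb_low J P hJ h hh 1 (by norm_num), hm]; rfl
  · intro i hi
    obtain ⟨k, rfl⟩ := Nat.exists_eq_add_of_le' hi
    have h1 := hilb_high J P hJ hJ1 h hh hnzd k
    rw [hm, hm, Finset.sum_range_succ _ (k + 2), Finset.sum_range_succ _ (k + 1)] at h1
    omega

/-- The exponent vector with given entries. -/
def vec4 (a b c d : ℕ) : Fin 4 →₀ ℕ := Finsupp.equivFunOnFinite.symm ![a, b, c, d]

theorem vec4_eq (a b c d : ℕ) (e : Fin 4 →₀ ℕ) :
    vec4 a b c d = e ↔ a = e 0 ∧ b = e 1 ∧ c = e 2 ∧ d = e 3 := by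
  rw [Finsupp.ext_iff]
  simp [Fin.forall_fin_succ, vec4]

theorem degree4 (d : Fin 4 →₀ ℕ) : d.degree = d 0 + d 1 + d 2 + d 3 := by
  rw [Finsupp.degree_eq_sum, Fin.sum_univ_four]

/-- Generic count: standard monomials split in two families. -/
theorem count (i : ℕ) (S : Set (Fin 4 →₀ ℕ)) (g : ℕ → Fin 4 →₀ ℕ)
    (hg : ∀ a < i, ∀ b < i, g a = g b → a = b) (hg0 : ∀ a < i, g a 0 ≠ 0)
    (hS : ∀ d, d ∈ S ↔ (d.degree = i ∧ d 0 = 0) ∨ ∃ a < i, g a = d) :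
    S.ncard = (∑ a ∈ Finset.range (i + 1), (a + 1)) + i := by
  classical
  let F : (Σ _ : ℕ, ℕ) → Fin 4 →₀ ℕ := fun p => vec4 0 (i - p.1) p.2 (p.1 - p.2)
  let A := (Finset.range (i + 1)).sigma (fun a => Finset.range (a + 1))
  have e : S = ↑(A.image F ∪ (Finset.range i).image g) := by
    ext d
    rw [hS, Finset.mem_coe, Finset.mem_union, Finset.mem_image, Finset.mem_image]
    apply or_congr
    · rw [degree4]
      constructor
      · rintro ⟨h1, h2⟩
        refine ⟨⟨i - d 1, d 2⟩, ?_, ?_⟩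
        · simp only [A, Finset.mem_sigma, Finset.mem_range]; omega
        · refine (vec4_eq _ _ _ _ _).mpr ⟨?_, ?_, ?_, ?_⟩ <;> (try dsimp only) <;> omega
      · rintro ⟨⟨a, b⟩, h1, h2⟩
        simp only [A, Finset.mem_sigma, Finset.mem_range] at h1
        simp only [F, vec4_eq] at h2
        omega
    · simp
  rw [e, Set.ncard_coe_finset, Finset.card_union_of_disjoint, Finset.card_image_of_injOn,
    Finset.card_image_of_injOn]
  · simp [A]
  · intro a ha b hb
    exact hg a (by simpa using ha) b (by simpa using hb)
  · rintro ⟨a, b⟩ h1 ⟨a', b'⟩ h2 h3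
    simp only [A, Finset.coe_sigma, Set.mem_sigma_iff, Finset.mem_coe, Finset.mem_range] at h1 h2
    have h4 := (vec4_eq _ _ _ _ _).mp h3
    simp [F, vec4] at h4
    obtain rfl : a = a' := by omega
    obtain rfl : b = b' := by omega
    rfl
  · rw [Finset.disjoint_left]
    intro d h1 h2
    obtain ⟨p, -, rfl⟩ := Finset.mem_image.mp h1
    obtain ⟨a, ha, h3⟩ := Finset.mem_image.mp h2
    apply hg0 a (by simpa using ha)
    rw [h3]
    simp [F, vec4]

theorem memA (f : MvPolynomial (Fin 4) K) :
    f ∈ Ideal.span {(X 0 : MvPolynomial (Fin 4) K) * X 1, X 0 * X 2} ↔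
      ∀ d ∈ f.support, d ∈ {d : Fin 4 →₀ ℕ | 1 ≤ d 0 ∧ (1 ≤ d 1 ∨ 1 ≤ d 2)} := by
  have e : ({(X 0 : MvPolynomial (Fin 4) K) * X 1, X 0 * X 2} : Set _) =
      (fun s => monomial s (1 : K)) '' {vec4 1 1 0 0, vec4 1 0 1 0} := by
    rw [Set.image_pair]
    congr 2
    · rw [X, X, monomial_mul, one_mul]
      refine congrArg (fun s => monomial s (1 : K)) ?_
      symm
      simp [vec4_eq]
    · rw [X, X, monomial_mul, one_mul]
      refine congrArg (fun s => monomial s (1 : K)) ?_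
      symm
      simp [vec4_eq]
  rw [e, mem_ideal_span_monomial_image]
  refine forall₂_congr fun d _ => ?_
  simp [Finsupp.le_def, Fin.forall_fin_succ, vec4]
  omega

theorem memB (f : MvPolynomial (Fin 4) K) :
    f ∈ Ideal.span {(X 0 : MvPolynomial (Fin 4) K) ^ 2, X 0 * X 1} ↔
      ∀ d ∈ f.support, d ∈ {d : Fin 4 →₀ ℕ | 2 ≤ d 0 ∨ (1 ≤ d 0 ∧ 1 ≤ d 1)} := by
  have e : ({(X 0 : MvPolynomial (Fin 4) K) ^ 2, X 0 * X 1} : Set _) =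
      (fun s => monomial s (1 : K)) '' {vec4 2 0 0 0, vec4 1 1 0 0} := by
    rw [Set.image_pair]
    congr 2
    · rw [X_pow_eq_monomial]
      refine congrArg (fun s => monomial s (1 : K)) ?_
      symm
      simp [vec4_eq]
    · rw [X, X, monomial_mul, one_mul]
      refine congrArg (fun s => monomial s (1 : K)) ?_
      symm
      simp [vec4_eq]
  rw [e, mem_ideal_span_monomial_image]
  refine forall₂_congr fun d _ => ?_
  simp [Finsupp.le_def, Fin.forall_fin_succ, vec4]

theorem span3 (a b h : MvPolynomial (Fin 4) K) :
    Ideal.span {a, b, h} = Ideal.span {a, b} ⊔ Ideal.span {h} := by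
  rw [← Ideal.span_union]
  congr 1
  ext; simp; tauto

end helpers

/-- In `R = K[w,x,y,z]` (with `w = X 0`, `x = X 1`, `y = X 2`,
`z = X 3`): (a) if `V = ⟨wx, wy, h⟩` with `h` a quadric that is a
nonzerodivisor on `R/(wx,wy)`, then `dim_K (R/(V))_i = 2i+3` for `i ≥ 2`, and
the values in degrees `0,1` are `1` and `4`; (b) the same holds for
`V = ⟨w², wx, h'⟩` with `h'` a quadric that is a nonzerodivisor on
`R/(w²,wx)`. -/
theorem statement_5 {K : Type*} [Field K] [IsAlgClosed K] [CharZero K]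
    (h h' : MvPolynomial (Fin 4) K)
    (hh : h.IsHomogeneous 2)
    (hh' : h'.IsHomogeneous 2)
    (hnzd : ∀ f : MvPolynomial (Fin 4) K,
      h * f ∈ Ideal.span {X 0 * X 1, X 0 * X 2} →
        f ∈ Ideal.span {(X 0 : MvPolynomial (Fin 4) K) * X 1, X 0 * X 2})
    (hnzd' : ∀ f : MvPolynomial (Fin 4) K,
      h' * f ∈ Ideal.span {X 0 ^ 2, X 0 * X 1} →
        f ∈ Ideal.span {(X 0 : MvPolynomial (Fin 4) K) ^ 2, X 0 * X 1}) :
    (hilb 4 K (Ideal.span {X 0 * X 1, X 0 * X 2, h}) 0 = 1 ∧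
      hilb 4 K (Ideal.span {X 0 * X 1, X 0 * X 2, h}) 1 = 4 ∧
      ∀ i, 2 ≤ i → hilb 4 K (Ideal.span {X 0 * X 1, X 0 * X 2, h}) i = 2 * i + 3) ∧
    (hilb 4 K (Ideal.span {X 0 ^ 2, X 0 * X 1, h'}) 0 = 1 ∧
      hilb 4 K (Ideal.span {X 0 ^ 2, X 0 * X 1, h'}) 1 = 4 ∧
      ∀ i, 2 ≤ i → hilb 4 K (Ideal.span {X 0 ^ 2, X 0 * X 1, h'}) i = 2 * i + 3) := by
  constructor
  · rw [span3]
    refine hilb_all _ _ memA (by simp) ?_ h hh hnzd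
    intro i
    refine count i _ (fun a => vec4 (a + 1) 0 0 (i - 1 - a)) ?_ ?_ ?_
    · intro a _ b _ hab
      have := ((vec4_eq _ _ _ _ _).mp hab).1
      simpa [vec4] using this
    · intro a _
      simp [vec4]
    · intro d
      simp only [Set.mem_ofPred_eq, vec4_eq, degree4]
      constructor
      · rintro ⟨h1, h2⟩
        by_cases h0 : d 0 = 0
        · left; omega
        · right; exact ⟨d 0 - 1, by omega⟩
      · rintro (h1 | ⟨a, h1⟩) <;> omega
  · rw [span3]
    refine hilb_all _ _ memB (by simp) ?_ h' hh' hnzd'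
    intro i
    refine count i _ (fun a => vec4 1 0 a (i - 1 - a)) ?_ ?_ ?_
    · intro a _ b _ hab
      have := ((vec4_eq _ _ _ _ _).mp hab).2.2.1
      simpa [vec4] using this
    · intro a _
      simp [vec4]
    · intro d
      simp only [Set.mem_ofPred_eq, vec4_eq, degree4]
      constructor
      · rintro ⟨h1, h2⟩
        by_cases h0 : d 0 = 0
        · left; omega
        · right; exact ⟨d 2, by omega⟩
      · rintro (h1 | ⟨a, h1⟩) <;> omega

end
end

section
/- Let A = R/I be a graded Artinian Gorenstein quotient of R = K[w,x,y,z] of socle degree j ≥ 5, and let (I_2) denote the ideal generated by the degree-2 graded piece of I. Then the Hilbert function H = H(R/(I_2)) cannot satisfy (H_0, …, H_4) = (1,4,7,8,10), nor (H_0, …, H_5) = (1,4,7,b,9,11) for any integer b, nor (H_0, …, H_4) = (1,4,7,9,12). -/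
open MvPolynomial

noncomputable section

/-! ### Growth of Hilbert functions in small cases -/

lemma s8_exists_smul {K B : Type*} [Field K] [AddCommGroup B] [Module K B] (S : Submodule K B)
    [FiniteDimensional K S] (h : Module.finrank K S ≤ 1) {x y : B} (hx : x ∈ S) (hy : y ∈ S)
    (hx0 : x ≠ 0) : ∃ c : K, c • x = y := by
  have hle : Submodule.span K {x} ≤ S := by
    rw [Submodule.span_le]; simpa using hx
  have heq := Submodule.eq_of_le_of_finrank_le hle (by rw [finrank_span_singleton hx0]; exact h)
  rw [← heq] at hy
  exact Submodule.mem_span_singleton.mp hy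

lemma s8_finrank_mul_le {K B : Type*} [Field K] [CommRing B] [Algebra K B] (h : B)
    (S : Submodule K B) [FiniteDimensional K S] :
    Module.finrank K (Submodule.span K {h} * S : Submodule K B) ≤ Module.finrank K S := by
  have : (Submodule.span K {h} * S : Submodule K B) = S.map (LinearMap.mulLeft K h) := by
    ext x
    rw [Submodule.mem_span_singleton_mul]
    simp
  rw [this]
  exact Submodule.finrank_map_le _ _

lemma s8_key {K B : Type*} [Field K] [CommRing B] [Algebra K B] (V : Submodule K B)
    (hV : V.FG) (n : ℕ) (h : B) (hh : V ^ (n + 1) ≤ Submodule.span K {h} * V ^ n) :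
    Module.finrank K (V ^ (n + 2) : Submodule K B) ≤
      Module.finrank K (V ^ (n + 1) : Submodule K B) := by
  have h1 : V ^ (n + 2) ≤ Submodule.span K {h} * V ^ (n + 1) := by
    calc V ^ (n + 2) = V * V ^ (n + 1) := by rw [pow_succ' V (n + 1)]
      _ ≤ V * (Submodule.span K {h} * V ^ n) := mul_le_mul_right hh V
      _ = Submodule.span K {h} * V ^ (n + 1) := by rw [pow_succ' V n]; ring
  have : FiniteDimensional K (V ^ (n + 1) : Submodule K B) :=
    Module.Finite.iff_fg.mpr (hV.pow (n + 1))
  have : FiniteDimensional K (Submodule.span K {h} * V ^ (n + 1) : Submodule K B) :=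
    Module.Finite.iff_fg.mpr ((Submodule.fg_span_singleton h).mul (hV.pow (n + 1)))
  exact (Submodule.finrank_mono h1).trans (s8_finrank_mul_le h _)

lemma s8_growth_one {K B : Type*} [Field K] [CommRing B] [Algebra K B] (V : Submodule K B)
    (hV : V.FG) (n : ℕ) (h1 : Module.finrank K (V ^ (n + 1) : Submodule K B) ≤ 1) :
    Module.finrank K (V ^ (n + 2) : Submodule K B) ≤ 1 := by
  have : FiniteDimensional K (V ^ (n + 1) : Submodule K B) :=
    Module.Finite.iff_fg.mpr (hV.pow (n + 1))
  by_cases hex : ∃ h ∈ V, ∃ g ∈ V ^ n, h * g ≠ 0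
  · obtain ⟨h, hh, g, hg, hne⟩ := hex
    refine (s8_key V hV n h ?_).trans h1
    intro y hy
    obtain ⟨c, rfl⟩ := s8_exists_smul _ h1
      (by rw [pow_succ']; exact Submodule.mul_mem_mul hh hg) hy hne
    exact Submodule.smul_mem _ _
      (Submodule.mul_mem_mul (Submodule.mem_span_singleton_self h) hg)
  · push Not at hex
    refine (s8_key V hV n 0 ?_).trans h1
    rw [pow_succ', Submodule.mul_le]
    intro h hh g hg
    rw [hex h hh g hg]
    exact Submodule.zero_mem _

lemma s8_growth_two {K B : Type*} [Field K] [CommRing B] [Algebra K B] (V : Submodule K B)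
    (hV : V.FG) (n : ℕ) (h2 : Module.finrank K (V ^ (n + 2) : Submodule K B) ≤ 2) :
    Module.finrank K (V ^ (n + 3) : Submodule K B) ≤ 2 := by
  by_contra hcon
  have hno : ∀ h : B, ¬ V ^ (n + 2) ≤ Submodule.span K {h} * V ^ (n + 1) := by
    intro h hh
    exact hcon ((s8_key V hV (n + 1) h hh).trans h2)
  have hfin : ∀ m, FiniteDimensional K (V ^ m : Submodule K B) := fun m =>
    Module.Finite.iff_fg.mpr (hV.pow m)
  have hge : ¬ Module.finrank K (V ^ (n + 2) : Submodule K B) ≤ 1 := fun h =>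
    hcon ((s8_growth_one V hV (n + 1) h).trans (by norm_num))
  have hmemU : ∀ h ∈ V, ∀ u ∈ V ^ (n + 1), h * u ∈ V ^ (n + 2) := by
    intro h hh u hu
    rw [pow_succ' V (n + 1)]
    exact Submodule.mul_mem_mul hh hu
  -- every multiplication map has rank at most one
  have R1 : ∀ h ∈ V, ∀ a ∈ V ^ (n + 1), ∀ b ∈ V ^ (n + 1), h * a ≠ 0 →
      ∃ c : K, c • (h * a) = h * b := by
    intro h hh a ha b hb hne
    have hle : Submodule.span K {h} * V ^ (n + 1) ≤ V ^ (n + 2) := by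
      intro x hx
      obtain ⟨z, hz, rfl⟩ := Submodule.mem_span_singleton_mul.mp hx
      exact hmemU h hh z hz
    have := hfin (n + 2)
    have : FiniteDimensional K (Submodule.span K {h} * V ^ (n + 1) : Submodule K B) :=
      Submodule.finiteDimensional_of_le hle
    have hlt : Module.finrank K (Submodule.span K {h} * V ^ (n + 1) : Submodule K B) <
        Module.finrank K (V ^ (n + 2) : Submodule K B) := by
      apply Submodule.finrank_lt_finrank_of_lt
      exact lt_of_le_not_ge hle (hno h)
    exact s8_exists_smul (Submodule.span K {h} * V ^ (n + 1)) (by omega)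
      (Submodule.mul_mem_mul (Submodule.mem_span_singleton_self h) ha)
      (Submodule.mul_mem_mul (Submodule.mem_span_singleton_self h) hb) hne
  have C : ∀ h ∈ V, ∀ h' ∈ V, ∀ a ∈ V ^ (n + 1), ∀ b ∈ V ^ (n + 1), h * a ≠ 0 →
      h' * b ∉ Submodule.span K {h * a} → ∀ u ∈ V ^ (n + 1), h * u = 0 → h' * u = 0 := by
    intro h hh h' hh' a ha b hb hne hnot u hu hu0
    by_contra hu'
    obtain ⟨c, hc⟩ := R1 h' hh' u hu b hb hu'
    obtain ⟨f, hf⟩ := R1 h' hh' u hu a ha hu'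
    obtain ⟨e, he⟩ := R1 (h + h') (V.add_mem hh hh') u hu a ha (by
      rw [add_mul, hu0, zero_add]; exact hu')
    rw [add_mul, hu0, zero_add, add_mul, ← hf] at he
    have hha : h * a = (e - f) • (h' * u) := by
      rw [sub_smul, he]; ring
    have hef : e - f ≠ 0 := by
      intro h0
      rw [h0, zero_smul] at hha
      exact hne hha
    apply hnot
    rw [← hc, Submodule.mem_span_singleton]
    refine ⟨c * (e - f)⁻¹, ?_⟩
    rw [hha, smul_smul]
    congr 1
    field_simp
  -- two independent images
  obtain ⟨h1, hh1, u1, hu1, hw1⟩ : ∃ h1 ∈ V, ∃ u1 ∈ V ^ (n + 1), h1 * u1 ≠ 0 := by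
    by_contra hh
    push Not at hh
    apply hno 0
    rw [pow_succ' V (n + 1), Submodule.mul_le]
    intro h hh' g hg
    rw [hh h hh' g hg]
    exact Submodule.zero_mem _
  obtain ⟨k2, hk2, u2, hu2, hw2⟩ : ∃ k2 ∈ V, ∃ u2 ∈ V ^ (n + 1),
      k2 * u2 ∉ Submodule.span K {h1 * u1} := by
    by_contra hh
    push Not at hh
    apply hge
    have hle : V ^ (n + 2) ≤ Submodule.span K {h1 * u1} := by
      rw [pow_succ' V (n + 1), Submodule.mul_le]
      exact hh
    exact (Submodule.finrank_mono hle).trans (finrank_span_singleton hw1).le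
  have hw2' : k2 * u2 ≠ 0 := by
    intro h0; rw [h0] at hw2; exact hw2 (Submodule.zero_mem _)
  have hkill : ∀ h3 ∈ V, ∀ u ∈ V ^ (n + 1), h1 * u = 0 → h3 * u = 0 := by
    intro h3 hh3 u hu hu0
    by_contra hne
    have hk : k2 * u = 0 := C h1 hh1 k2 hk2 u1 hu1 u2 hu2 hw1 hw2 u hu hu0
    by_cases hin : h3 * u ∈ Submodule.span K {h1 * u1}
    · refine hne (C k2 hk2 h3 hh3 u2 hu2 u hu hw2' ?_ u hu hk)
      intro hin2
      obtain ⟨c, hc⟩ := Submodule.mem_span_singleton.mp hin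
      obtain ⟨d, hd⟩ := Submodule.mem_span_singleton.mp hin2
      have hd0 : d ≠ 0 := by
        rintro rfl
        rw [zero_smul] at hd
        exact hne hd.symm
      apply hw2
      rw [Submodule.mem_span_singleton]
      refine ⟨d⁻¹ * c, ?_⟩
      rw [mul_smul, hc, ← hd, smul_smul, inv_mul_cancel₀ hd0, one_smul]
    · exact hne (C h1 hh1 h3 hh3 u1 hu1 u hu hw1 hin u hu hu0)
  -- choose a product outside the common kernel
  obtain ⟨h, hh, g, hg, hne⟩ : ∃ h ∈ V, ∃ g ∈ V ^ n, h1 * (h * g) ≠ 0 := by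
    by_contra hcc
    push Not at hcc
    have hle : V ^ (n + 1) ≤ LinearMap.ker (LinearMap.mulLeft K h1) := by
      rw [pow_succ' V n, Submodule.mul_le]
      intro h hh g hg
      simpa using hcc h hh g hg
    exact hw1 (by simpa using hle hu1)
  have hhg : h * g ∈ V ^ (n + 1) := by
    rw [pow_succ' V n]; exact Submodule.mul_mem_mul hh hg
  apply hno h
  rw [pow_succ' V (n + 1), Submodule.mul_le]
  intro v hv u' hu'
  obtain ⟨c, hc⟩ := R1 h1 hh1 (h * g) hhg u' hu' hne
  have hz : h1 * (u' - c • (h * g)) = 0 := by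
    rw [mul_sub, ← hc, mul_smul_comm, sub_self]
  have hz' := hkill v hv _ (Submodule.sub_mem _ hu' (Submodule.smul_mem _ c hhg)) hz
  have : v * u' = c • (h * (v * g)) := by
    rw [mul_sub, sub_eq_zero] at hz'
    rw [hz', mul_smul_comm]
    congr 1
    ring
  rw [this]
  refine Submodule.smul_mem _ _
    (Submodule.mul_mem_mul (Submodule.mem_span_singleton_self h) ?_)
  rw [pow_succ' V n]
  exact Submodule.mul_mem_mul hv hg

/-! ### Kernels in families of linear maps of maximal rank -/

lemma s8_perturb {K W ι : Type*} [Field K] [Infinite K] [AddCommGroup W] [Module K W]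
    [Fintype ι] [DecidableEq ι] (a0 a1 a2 a3 : ι → W) (hli : LinearIndependent K a0) :
    ∃ t : K, t ≠ 0 ∧
      LinearIndependent K (fun i => a0 i + t • a1 i + t ^ 2 • a2 i + t ^ 3 • a3 i) := by
  obtain ⟨p, hp⟩ := LinearMap.exists_leftInverse_of_injective
    (Fintype.linearCombination K a0)
    (by rw [LinearMap.ker_eq_bot]; exact hli.fintypeLinearCombination_injective)
  have hp' : ∀ i, p (a0 i) = Pi.single i 1 := by
    intro i
    have := LinearMap.congr_fun hp (Pi.single i 1)
    simpa [Fintype.linearCombination_apply_single] using this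
  let M : Matrix ι ι (Polynomial K) := fun i j =>
    Polynomial.C (p (a0 i) j) + Polynomial.X * Polynomial.C (p (a1 i) j) +
      Polynomial.X ^ 2 * Polynomial.C (p (a2 i) j) + Polynomial.X ^ 3 * Polynomial.C (p (a3 i) j)
  have hMev : ∀ t : K, M.det.eval t =
      (Matrix.of fun i j => p (a0 i + t • a1 i + t ^ 2 • a2 i + t ^ 3 • a3 i) j).det := by
    intro t
    have := RingHom.map_det (Polynomial.evalRingHom t) M
    rw [Polynomial.coe_evalRingHom] at this
    rw [this]
    congr 1
    ext i j
    change Polynomial.eval t (M i j) = _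
    simp only [M, Polynomial.eval_add, Polynomial.eval_mul, Polynomial.eval_pow,
      Polynomial.eval_X, Polynomial.eval_C, Matrix.of_apply, map_add, map_smul, Pi.add_apply,
      Pi.smul_apply, smul_eq_mul]
  have hM0 : M.det.eval 0 = 1 := by
    rw [hMev]
    have : (Matrix.of fun i j => p (a0 i + (0 : K) • a1 i + (0 : K) ^ 2 • a2 i
        + (0 : K) ^ 3 • a3 i) j) = (1 : Matrix ι ι K) := by
      ext i j
      simp only [Matrix.of_apply, zero_smul, ne_eq, OfNat.ofNat_ne_zero, not_false_eq_true,
        zero_pow, add_zero, hp', Matrix.one_apply, Pi.single_apply]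
      simp only [eq_comm]
    rw [this, Matrix.det_one]
  have hMne : M.det * Polynomial.X ≠ 0 := by
    apply mul_ne_zero _ Polynomial.X_ne_zero
    intro h0
    rw [h0] at hM0
    simp at hM0
  obtain ⟨t, ht⟩ : ∃ t, (M.det * Polynomial.X).eval t ≠ 0 := by
    by_contra hall
    push Not at hall
    exact hMne (Polynomial.funext (fun t => by rw [hall t, Polynomial.eval_zero]))
  rw [Polynomial.eval_mul, Polynomial.eval_X] at ht
  have hdet := left_ne_zero_of_mul ht
  rw [hMev] at hdet
  refine ⟨t, right_ne_zero_of_mul ht, ?_⟩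
  apply LinearIndependent.of_comp p
  exact Matrix.linearIndependent_rows_of_det_ne_zero hdet

lemma s8_pencil {K V W : Type*} [Field K] [Infinite K] [AddCommGroup V] [Module K V]
    [FiniteDimensional K V] [AddCommGroup W] [Module K W]
    (f0 f1 f2 f3 : V →ₗ[K] W)
    (hmax : ∀ t : K, Module.finrank K (LinearMap.range (f0 + t • f1 + t ^ 2 • f2 + t ^ 3 • f3)) ≤
      Module.finrank K (LinearMap.range f0)) (v : V) (hv : f0 v = 0) :
    f1 v ∈ LinearMap.range f0 := by
  by_contra hnot
  obtain ⟨r, hr⟩ : ∃ r, Module.finrank K (LinearMap.range f0) = r := ⟨_, rfl⟩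
  rw [hr] at hmax
  let bs := Module.finBasisOfFinrankEq K (LinearMap.range f0) hr
  have hex : ∀ i, ∃ x, f0 x = (bs i : W) := fun i => (bs i).2
  choose x hx using hex
  have hli : LinearIndependent K
      (fun o : Option (Fin r) => o.elim (f1 v) (fun i => f0 (x i))) := by
    rw [linearIndependent_option]
    change LinearIndependent K (fun i => f0 (x i)) ∧
      f1 v ∉ Submodule.span K (Set.range fun i => f0 (x i))
    have h1 : (fun i => f0 (x i)) = (LinearMap.range f0).subtype ∘ bs := by
      funext i
      rw [hx]; rfl
    refine ⟨?_, ?_⟩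
    · rw [h1]
      exact bs.linearIndependent.map' _ (Submodule.ker_subtype _)
    · intro hmem
      apply hnot
      have hle : Submodule.span K (Set.range (fun i => f0 (x i))) ≤ LinearMap.range f0 := by
        rw [Submodule.span_le]
        rintro _ ⟨i, rfl⟩
        exact ⟨x i, rfl⟩
      exact hle hmem
  obtain ⟨t, ht0, hli2⟩ := s8_perturb _
    (fun o : Option (Fin r) => o.elim (f2 v) (fun i => f1 (x i)))
    (fun o : Option (Fin r) => o.elim (f3 v) (fun i => f2 (x i)))
    (fun o : Option (Fin r) => o.elim 0 (fun i => f3 (x i))) hli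
  have hle : Submodule.span K (Set.range fun o : Option (Fin r) =>
      o.elim (f1 v) (fun i => f0 (x i)) + t • o.elim (f2 v) (fun i => f1 (x i)) +
      t ^ 2 • o.elim (f3 v) (fun i => f2 (x i)) + t ^ 3 • o.elim 0 (fun i => f3 (x i))) ≤
      LinearMap.range (f0 + t • f1 + t ^ 2 • f2 + t ^ 3 • f3) := by
    rw [Submodule.span_le]
    rintro _ ⟨i, rfl⟩
    rcases i with _ | i
    · refine ⟨t⁻¹ • v, ?_⟩
      have e1 : t⁻¹ * t = 1 := inv_mul_cancel₀ ht0
      have e2 : t⁻¹ * t ^ 2 = t := by field_simp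
      have e3 : t⁻¹ * t ^ 3 = t ^ 2 := by field_simp
      simp only [map_smul, LinearMap.add_apply, LinearMap.smul_apply, hv,
        Option.elim_none, zero_add, smul_add, smul_smul, e1, e2, e3, one_smul, smul_zero, add_zero]
    · exact ⟨x i, by simp⟩
  have h1 := Submodule.finrank_mono hle
  rw [finrank_span_eq_card hli2] at h1
  have h2 := hmax t
  simp at h1
  omega

/-! ### Graded pieces of the polynomial ring and of ideals -/

/-- The space of forms of degree `d` in four variables. -/
abbrev s8R (K : Type*) [Field K] (d : ℕ) : Submodule K (MvPolynomial (Fin 4) K) :=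
  homogeneousSubmodule (Fin 4) K d

lemma s8R_mul (K : Type*) [Field K] (a b : ℕ) : s8R K a * s8R K b = s8R K (a + b) := by
  rw [s8R, s8R, s8R, ← homogeneousSubmodule_one_pow (σ := Fin 4) (R := K) (n := a),
    ← homogeneousSubmodule_one_pow (σ := Fin 4) (R := K) (n := b), ← pow_add, homogeneousSubmodule_one_pow]

instance s8R_fin (K : Type*) [Field K] (d : ℕ) : FiniteDimensional K (s8R K d) :=
  Module.Finite.iff_fg.mpr (homogeneousSubmodule_fg (Fin 4) K d)

lemma s8_fin {K : Type*} [Field K] {d : ℕ} {W : Submodule K (MvPolynomial (Fin 4) K)}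
    (h : W ≤ s8R K d) : FiniteDimensional K W :=
  Submodule.finiteDimensional_of_le h

lemma s8R_finrank (K : Type*) [Field K] (d : ℕ) :
    Module.finrank K (s8R K d) = (d + 3).choose d := by
  have h1 : {e : Fin 4 →₀ ℕ | e.degree = d} =
      ((Finset.univ : Finset (Fin 4)).finsuppAntidiag d : Set (Fin 4 →₀ ℕ)) := by
    ext e
    simp [Finsupp.degree_eq_sum]
  rw [s8R, homogeneousSubmodule_eq_finsupp_supported, h1,
    LinearEquiv.finrank_eq (AddMonoidAlgebra.supportedEquivFinsupp _),
    Module.finrank_finsupp_self]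
  simp only [Finset.coe_sort_coe, Fintype.card_coe]
  rw [Finset.card_finsuppAntidiag_nat_eq_choose]
  simp
  congr 1
  omega

lemma s8_hilb {K : Type*} [Field K] (I : Ideal (MvPolynomial (Fin 4) K)) (d : ℕ) :
    hilb 4 K I d + Module.finrank K (I.restrictScalars K ⊓ s8R K d : Submodule K _) =
      Module.finrank K (s8R K d) := by
  have h := LinearMap.finrank_range_add_finrank_ker
    ((Ideal.Quotient.mkₐ K I).toLinearMap.domRestrict (s8R K d))
  rw [LinearMap.range_domRestrict] at h
  rw [← h, hilb]
  congr 1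
  have h2 : (I.restrictScalars K ⊓ s8R K d : Submodule K _) =
      (LinearMap.ker ((Ideal.Quotient.mkₐ K I).toLinearMap.domRestrict (s8R K d))).map
        (s8R K d).subtype := by
    ext x
    simp only [Submodule.mem_inf, Submodule.restrictScalars_mem, Submodule.mem_map,
      LinearMap.mem_ker, LinearMap.domRestrict_apply, Submodule.subtype_apply, Subtype.exists,
      AlgHom.toLinearMap_apply, Ideal.Quotient.mkₐ_eq_mk, Ideal.Quotient.eq_zero_iff_mem]
    constructor
    · rintro ⟨h1, h2⟩
      exact ⟨x, h2, h1, rfl⟩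
    · rintro ⟨a, h2, h1, rfl⟩
      exact ⟨h1, h2⟩
  rw [h2, Submodule.finrank_map_subtype_eq]

lemma s8_comp_mul {K : Type*} [Field K] (a w : MvPolynomial (Fin 4) K) (e d : ℕ)
    (hw : w ∈ s8R K e) :
    homogeneousComponent (d + e) (a * w) = homogeneousComponent d a * w := by
  have ha := sum_homogeneousComponent a
  have h1 : ∀ i, homogeneousComponent (d + e) (homogeneousComponent i a * w) =
      if i = d then homogeneousComponent d a * w else 0 := by
    intro i
    have hm : homogeneousComponent i a * w ∈ homogeneousSubmodule (Fin 4) K (i + e) :=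
      (homogeneousComponent_isHomogeneous i a).mul hw
    rw [homogeneousComponent_of_mem hm]
    by_cases hid : i = d
    · subst hid; simp
    · rw [if_neg hid, if_neg (by omega)]
  conv_lhs => rw [← ha, Finset.sum_mul, map_sum]
  simp only [h1]
  rw [Finset.sum_ite_eq']
  split_ifs with hd
  · rfl
  · rw [homogeneousComponent_eq_zero]
    · simp
    · simpa using hd

/-- The ideal generated by two spaces of forms of degrees two and one. -/
def s8I {K : Type*} [Field K] (W2 W1 : Submodule K (MvPolynomial (Fin 4) K)) :
    Ideal (MvPolynomial (Fin 4) K) :=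
  Ideal.span ((W2 : Set (MvPolynomial (Fin 4) K)) ∪ W1)

lemma s8I_piece {K : Type*} [Field K] (W2 W1 : Submodule K (MvPolynomial (Fin 4) K))
    (h2 : W2 ≤ s8R K 2) (h1 : W1 ≤ s8R K 1) (d : ℕ) :
    ((s8I W2 W1).restrictScalars K ⊓ s8R K (d + 2) : Submodule K _) =
      s8R K d * W2 ⊔ s8R K (d + 1) * W1 := by
  apply le_antisymm
  · rintro f ⟨hf, hfd⟩
    have key : ∀ f ∈ s8I W2 W1, homogeneousComponent (d + 2) f ∈
        (s8R K d * W2 ⊔ s8R K (d + 1) * W1 : Submodule K _) := by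
      intro f hf
      refine Submodule.closure_induction (p := fun f _ => homogeneousComponent (d + 2) f ∈
        (s8R K d * W2 ⊔ s8R K (d + 1) * W1 : Submodule K _)) ?_ ?_ ?_ hf
      · simp
      · intro x y _ _ hx hy
        rw [map_add]
        exact Submodule.add_mem _ hx hy
      · rintro a w (hw | hw)
        · rw [smul_eq_mul, s8_comp_mul a w 2 d (h2 hw)]
          exact Submodule.mem_sup_left (Submodule.mul_mem_mul
            (homogeneousComponent_isHomogeneous d a) hw)
        · rw [smul_eq_mul, s8_comp_mul a w 1 (d + 1) (h1 hw)]
          exact Submodule.mem_sup_right (Submodule.mul_mem_mul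
            (homogeneousComponent_isHomogeneous (d + 1) a) hw)
    have := key f hf
    rw [homogeneousComponent_of_mem hfd, if_pos rfl] at this
    exact this
  · apply sup_le
    · rw [Submodule.mul_le]
      intro a ha w hw
      exact ⟨Ideal.mul_mem_left _ a (Ideal.subset_span (Or.inl hw)), IsHomogeneous.mul ha (h2 hw)⟩
    · rw [Submodule.mul_le]
      intro a ha w hw
      exact ⟨Ideal.mul_mem_left _ a (Ideal.subset_span (Or.inr hw)),
        IsHomogeneous.mul (m := d + 1) (n := 1) ha (h1 hw)⟩

lemma s8_hilb_pow {K : Type*} [Field K] (I : Ideal (MvPolynomial (Fin 4) K)) (d : ℕ) :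
    hilb 4 K I d = Module.finrank K
      ((((s8R K 1).map (Ideal.Quotient.mkₐ K I).toLinearMap) ^ d : Submodule K _)) := by
  rw [hilb, ← homogeneousSubmodule_one_pow, Submodule.map_pow]

lemma s8_hilb_one {K : Type*} [Field K] (I : Ideal (MvPolynomial (Fin 4) K)) (n : ℕ)
    (h : hilb 4 K I (n + 1) ≤ 1) : hilb 4 K I (n + 2) ≤ 1 := by
  rw [s8_hilb_pow] at h ⊢
  exact s8_growth_one _ ((homogeneousSubmodule_fg (Fin 4) K 1).map _) n h

lemma s8_hilb_two {K : Type*} [Field K] (I : Ideal (MvPolynomial (Fin 4) K)) (n : ℕ)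
    (h : hilb 4 K I (n + 2) ≤ 2) : hilb 4 K I (n + 3) ≤ 2 := by
  rw [s8_hilb_pow] at h ⊢
  exact s8_growth_two _ ((homogeneousSubmodule_fg (Fin 4) K 1).map _) n h

/-! ### Multiplication by a linear form -/

/-- The product of a space of polynomials with a fixed polynomial. -/
abbrev s8M {K : Type*} [Field K] (l : MvPolynomial (Fin 4) K)
    (W : Submodule K (MvPolynomial (Fin 4) K)) : Submodule K (MvPolynomial (Fin 4) K) :=
  W.map (LinearMap.mulLeft K l)

lemma s8M_finrank {K : Type*} [Field K] {l : MvPolynomial (Fin 4) K} (hl : l ≠ 0)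
    (W : Submodule K (MvPolynomial (Fin 4) K)) :
    Module.finrank K (s8M l W) = Module.finrank K W := by
  have hinj : Function.Injective (LinearMap.mulLeft K l) := by
    intro a b h
    exact mul_left_cancel₀ hl h
  exact (LinearEquiv.finrank_eq (Submodule.equivMapOfInjective _ hinj W)).symm

lemma s8M_mem {K : Type*} [Field K] {l f : MvPolynomial (Fin 4) K}
    {W : Submodule K (MvPolynomial (Fin 4) K)} :
    f ∈ s8M l W ↔ ∃ a ∈ W, l * a = f := by
  simp [s8M, Submodule.mem_map]

lemma s8M_mul_mem {K : Type*} [Field K] {l a : MvPolynomial (Fin 4) K}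
    {W : Submodule K (MvPolynomial (Fin 4) K)} (ha : a ∈ W) : l * a ∈ s8M l W :=
  s8M_mem.mpr ⟨a, ha, rfl⟩

lemma s8_mul_mem {K : Type*} [Field K] {a b : MvPolynomial (Fin 4) K} {m n d : ℕ}
    (ha : a ∈ s8R K m) (hb : b ∈ s8R K n) (h : m + n = d) : a * b ∈ s8R K d := by
  subst h
  exact IsHomogeneous.mul ha hb

lemma s8M_le {K : Type*} [Field K] {l : MvPolynomial (Fin 4) K}
    (hl : l ∈ s8R K 1) {W : Submodule K (MvPolynomial (Fin 4) K)} {d : ℕ} (hW : W ≤ s8R K d) :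
    s8M l W ≤ s8R K (d + 1) := by
  intro f hf
  obtain ⟨a, ha, rfl⟩ := s8M_mem.mp hf
  exact s8_mul_mem hl (hW ha) (by omega)

lemma s8M_eq {K : Type*} [Field K] (l : MvPolynomial (Fin 4) K)
    (W : Submodule K (MvPolynomial (Fin 4) K)) :
    W * Submodule.span K {l} = s8M l W := by
  ext f
  rw [Submodule.mem_mul_span_singleton, s8M_mem]
  constructor
  · rintro ⟨z, hz, rfl⟩
    exact ⟨z, hz, mul_comm _ _⟩
  · rintro ⟨z, hz, rfl⟩
    exact ⟨z, hz, mul_comm _ _⟩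

/-- The five-fold multiplication map used to choose a general linear form. -/
def s8G {K : Type*} [Field K] (J : Ideal (MvPolynomial (Fin 4) K))
    (p1 p2 p3 p4 p5 : MvPolynomial (Fin 4) K) :
    (s8R K 1 × s8R K 2 × s8R K 1 × K × K) →ₗ[K]
      ((MvPolynomial (Fin 4) K ⧸ J) × (MvPolynomial (Fin 4) K ⧸ J) ×
        (MvPolynomial (Fin 4) K ⧸ J) × (MvPolynomial (Fin 4) K ⧸ J) ×
        (MvPolynomial (Fin 4) K ⧸ J)) :=
  let q := (Ideal.Quotient.mkₐ K J).toLinearMap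
  (q ∘ₗ LinearMap.mulLeft K p1 ∘ₗ (s8R K 1).subtype).prodMap
    ((q ∘ₗ LinearMap.mulLeft K p2 ∘ₗ (s8R K 2).subtype).prodMap
      ((q ∘ₗ LinearMap.mulLeft K p3 ∘ₗ (s8R K 1).subtype).prodMap
        ((LinearMap.toSpanSingleton K _ (q p4)).prodMap
          (LinearMap.toSpanSingleton K _ (q p5)))))

lemma s8G_apply {K : Type*} [Field K] (J : Ideal (MvPolynomial (Fin 4) K))
    (p1 p2 p3 p4 p5 : MvPolynomial (Fin 4) K) (a : s8R K 1) (b : s8R K 2) (c : s8R K 1)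
    (d e : K) :
    s8G J p1 p2 p3 p4 p5 (a, b, c, d, e) =
      (Ideal.Quotient.mk J (p1 * a), Ideal.Quotient.mk J (p2 * b),
        Ideal.Quotient.mk J (p3 * c), Ideal.Quotient.mk J (C d * p4),
        Ideal.Quotient.mk J (C e * p5)) := by
  have h : ∀ (d : K) (p : MvPolynomial (Fin 4) K),
      d • (Ideal.Quotient.mk J p) = Ideal.Quotient.mk J (C d * p) := by
    intro d p
    rw [← smul_eq_C_mul]
    rfl
  simp only [s8G, ← h]
  rfl

lemma s8_max {K : Type*} [Field K] [CharZero K] (J : Ideal (MvPolynomial (Fin 4) K)) :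
    ∃ l ∈ s8R K 1, ∀ l' ∈ s8R K 1,
      (∀ a ∈ s8R K 1, l * a ∈ J → ∃ a' ∈ s8R K 1, l' * a - l * a' ∈ J) ∧
      (∀ b ∈ s8R K 2, l * b ∈ J → ∃ b' ∈ s8R K 2, l' * b - l * b' ∈ J) ∧
      (∀ c ∈ s8R K 1, l ^ 2 * c ∈ J → ∃ c' ∈ s8R K 1, 2 * (l * l') * c - l ^ 2 * c' ∈ J) ∧
      (l ^ 2 ∈ J → l * l' ∈ J) ∧ (l ^ 3 ∈ J → l ^ 2 * l' ∈ J) := by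
  set F : MvPolynomial (Fin 4) K → ((s8R K 1 × s8R K 2 × s8R K 1 × K × K) →ₗ[K]
      ((MvPolynomial (Fin 4) K ⧸ J) × (MvPolynomial (Fin 4) K ⧸ J) ×
        (MvPolynomial (Fin 4) K ⧸ J) × (MvPolynomial (Fin 4) K ⧸ J) ×
        (MvPolynomial (Fin 4) K ⧸ J))) :=
    fun l => s8G J l l (l ^ 2) (l ^ 2) (l ^ 3) with hF
  set S : Set ℕ := {n | ∃ l ∈ s8R K 1, Module.finrank K (LinearMap.range (F l)) = n} with hS
  have hne : S.Nonempty := ⟨_, 0, Submodule.zero_mem _, rfl⟩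
  have hbd : BddAbove S := by
    refine ⟨Module.finrank K (s8R K 1 × s8R K 2 × s8R K 1 × K × K), ?_⟩
    rintro n ⟨l, _, rfl⟩
    exact LinearMap.finrank_range_le _
  obtain ⟨l, hl, hlS⟩ := Nat.sSup_mem hne hbd
  have hmax : ∀ m ∈ s8R K 1, Module.finrank K (LinearMap.range (F m)) ≤
      Module.finrank K (LinearMap.range (F l)) := by
    intro m hm
    rw [hlS]
    exact le_csSup hbd ⟨m, hm, rfl⟩
  refine ⟨l, hl, fun l' hl' => ?_⟩
  have hpen := s8_pencil (F l)
    (s8G J l' l' (2 * (l * l')) (2 * (l * l')) (3 * (l ^ 2 * l')))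
    (s8G J 0 0 (l' ^ 2) (l' ^ 2) (3 * (l * l' ^ 2))) (s8G J 0 0 0 0 (l' ^ 3)) (by
      intro t
      have h2 : F l + t • (s8G J l' l' (2 * (l * l')) (2 * (l * l')) (3 * (l ^ 2 * l')))
          + t ^ 2 • (s8G J 0 0 (l' ^ 2) (l' ^ 2) (3 * (l * l' ^ 2)))
          + t ^ 3 • (s8G J 0 0 0 0 (l' ^ 3)) = F (l + t • l') := by
        have hs : ∀ (d : K) (p : MvPolynomial (Fin 4) K),
            d • (Ideal.Quotient.mk J p) = Ideal.Quotient.mk J (C d * p) := by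
          intro d p
          rw [← smul_eq_C_mul]
          rfl
        apply LinearMap.ext
        rintro ⟨a, b, c, d, e⟩
        simp only [hF, LinearMap.add_apply, LinearMap.smul_apply, s8G_apply, Prod.smul_mk,
          Prod.mk_add_mk, hs, ← map_add, smul_eq_C_mul, map_pow]
        refine Prod.ext ?_ (Prod.ext ?_ (Prod.ext ?_ (Prod.ext ?_ ?_))) <;>
        · simp only
          congr 1
          ring
      rw [h2]
      exact hmax _ (Submodule.add_mem _ hl (Submodule.smul_mem _ _ hl')))
  have hz : ∀ {p : MvPolynomial (Fin 4) K}, p ∈ J → Ideal.Quotient.mk J p = 0 :=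
    fun hp => Ideal.Quotient.eq_zero_iff_mem.mpr hp
  have h2 : (C (2⁻¹ : K) : MvPolynomial (Fin 4) K) * 2 = 1 := by
    rw [show (2 : MvPolynomial (Fin 4) K) = C 2 from (map_ofNat C 2).symm, ← C_mul]
    norm_num
  have h3 : (C (3⁻¹ : K) : MvPolynomial (Fin 4) K) * 3 = 1 := by
    rw [show (3 : MvPolynomial (Fin 4) K) = C 3 from (map_ofNat C 3).symm, ← C_mul]
    norm_num
  refine ⟨?_, ?_, ?_, ?_, ?_⟩
  · intro a ha haJ
    obtain ⟨⟨a', b', c', d', e'⟩, h⟩ := hpen (⟨a, ha⟩, 0, 0, 0, 0) (by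
      simp only [hF, s8G_apply]
      simp [hz haJ, -map_mul])
    simp only [hF, s8G_apply, Prod.mk.injEq, Ideal.Quotient.eq] at h
    refine ⟨a', a'.2, ?_⟩
    rw [← neg_mem_iff, neg_sub]
    exact h.1
  · intro b hb hbJ
    obtain ⟨⟨a', b', c', d', e'⟩, h⟩ := hpen (0, ⟨b, hb⟩, 0, 0, 0) (by
      simp only [hF, s8G_apply]
      simp [hz hbJ, -map_mul])
    simp only [hF, s8G_apply, Prod.mk.injEq, Ideal.Quotient.eq] at h
    refine ⟨b', b'.2, ?_⟩
    rw [← neg_mem_iff, neg_sub]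
    exact h.2.1
  · intro c hc hcJ
    obtain ⟨⟨a', b', c', d', e'⟩, h⟩ := hpen (0, 0, ⟨c, hc⟩, 0, 0) (by
      simp only [hF, s8G_apply]
      simp [hz hcJ, -map_mul])
    simp only [hF, s8G_apply, Prod.mk.injEq, Ideal.Quotient.eq] at h
    refine ⟨c', c'.2, ?_⟩
    rw [← neg_mem_iff, neg_sub]
    exact h.2.2.1
  · intro hJ
    obtain ⟨⟨a', b', c', d', e'⟩, h⟩ := hpen (0, 0, 0, 1, 0) (by
      simp only [hF, s8G_apply]
      simp [hz hJ, -map_mul, -map_pow])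
    simp only [hF, s8G_apply, Prod.mk.injEq, Ideal.Quotient.eq] at h
    have h4 := Ideal.mul_mem_left J (C 2⁻¹) (Ideal.sub_mem J (Ideal.mul_mem_left J (C d') hJ)
      h.2.2.2.1)
    rw [sub_sub_cancel, C_1, one_mul, ← mul_assoc, h2, one_mul] at h4
    exact h4
  · intro hJ
    obtain ⟨⟨a', b', c', d', e'⟩, h⟩ := hpen (0, 0, 0, 0, 1) (by
      simp only [hF, s8G_apply]
      simp [hz hJ, -map_mul, -map_pow])
    simp only [hF, s8G_apply, Prod.mk.injEq, Ideal.Quotient.eq] at h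
    have h4 := Ideal.mul_mem_left J (C 3⁻¹) (Ideal.sub_mem J (Ideal.mul_mem_left J (C e') hJ)
      h.2.2.2.2)
    rw [sub_sub_cancel, C_1, one_mul, ← mul_assoc, h3, one_mul] at h4
    exact h4

/-! ### Dimension bookkeeping -/

lemma s8_sup_inf {K : Type*} [Field K] {S T : Submodule K (MvPolynomial (Fin 4) K)} {d e : ℕ}
    (hS : S ≤ s8R K d) (hT : T ≤ s8R K e) :
    Module.finrank K (S ⊔ T : Submodule K _) + Module.finrank K (S ⊓ T : Submodule K _) =
      Module.finrank K S + Module.finrank K T := by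
  have := s8_fin hS
  have := s8_fin hT
  exact Submodule.finrank_sup_add_finrank_inf_eq S T

lemma s8_mono {K : Type*} [Field K] {S T : Submodule K (MvPolynomial (Fin 4) K)} {d : ℕ}
    (h : S ≤ T) (hT : T ≤ s8R K d) : Module.finrank K S ≤ Module.finrank K T := by
  have := s8_fin hT
  exact Submodule.finrank_mono h

lemma s8_eq_of_le {K : Type*} [Field K] {S T : Submodule K (MvPolynomial (Fin 4) K)} {d : ℕ}
    (h : S ≤ T) (hT : T ≤ s8R K d) (hd : Module.finrank K T ≤ Module.finrank K S) : S = T := by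
  have := s8_fin hT
  exact Submodule.eq_of_le_of_finrank_le h hd

lemma s8_span_le {K : Type*} [Field K] {b : MvPolynomial (Fin 4) K} {d : ℕ} (hb : b ∈ s8R K d) :
    Submodule.span K {b} ≤ s8R K d := by
  rw [Submodule.span_le]
  simpa using hb

lemma s8R_one (K : Type*) [Field K] : Module.finrank K (s8R K 1) = 4 := by
  rw [s8R_finrank]; rfl
lemma s8R_two (K : Type*) [Field K] : Module.finrank K (s8R K 2) = 10 := by
  rw [s8R_finrank]; rfl
lemma s8R_three (K : Type*) [Field K] : Module.finrank K (s8R K 3) = 20 := by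
  rw [s8R_finrank]; rfl
lemma s8R_four (K : Type*) [Field K] : Module.finrank K (s8R K 4) = 35 := by
  rw [s8R_finrank]; rfl
lemma s8R_five (K : Type*) [Field K] : Module.finrank K (s8R K 5) = 56 := by
  rw [s8R_finrank]; rfl

/-- The degree `d` piece of an ideal. -/
abbrev s8T {K : Type*} [Field K] (J : Ideal (MvPolynomial (Fin 4) K)) (d : ℕ) :
    Submodule K (MvPolynomial (Fin 4) K) := J.restrictScalars K ⊓ s8R K d

/-- The forms of degree `d` multiplied into `J` by `l`. -/
abbrev s8K {K : Type*} [Field K] (J : Ideal (MvPolynomial (Fin 4) K))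
    (l : MvPolynomial (Fin 4) K) (d : ℕ) :
    Submodule K (MvPolynomial (Fin 4) K) :=
  (J.restrictScalars K).comap (LinearMap.mulLeft K l) ⊓ s8R K d

lemma s8K_mem {K : Type*} [Field K] {J : Ideal (MvPolynomial (Fin 4) K)}
    {l b : MvPolynomial (Fin 4) K} {d : ℕ} : b ∈ s8K J l d ↔ l * b ∈ J ∧ b ∈ s8R K d := by
  simp [s8K]

lemma s8T_le_K {K : Type*} [Field K] (J : Ideal (MvPolynomial (Fin 4) K))
    (l : MvPolynomial (Fin 4) K) (d : ℕ) : s8T J d ≤ s8K J l d := by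
  rintro b ⟨h1, h2⟩
  exact s8K_mem.mpr ⟨J.mul_mem_left l h1, h2⟩

lemma s8K_dim {K : Type*} [Field K] (J : Ideal (MvPolynomial (Fin 4) K))
    {l : MvPolynomial (Fin 4) K} (hl : l ∈ s8R K 1) (h0 : l ≠ 0) (d : ℕ) :
    Module.finrank K (s8T J (d + 1) ⊔ s8M l (s8R K d) : Submodule K _) +
      Module.finrank K (s8K J l d) =
      Module.finrank K (s8T J (d + 1)) + Module.finrank K (s8R K d) := by
  rw [← s8M_finrank h0 (s8R K d), ← s8M_finrank h0 (s8K J l d),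
    ← s8_sup_inf (d := d + 1) (e := d + 1) inf_le_right (s8M_le hl le_rfl)]
  suffices hs : s8M l (s8K J l d) = s8T J (d + 1) ⊓ s8M l (s8R K d) by rw [hs]
  ext f
  constructor
  · intro hf
    obtain ⟨b, hb, rfl⟩ := s8M_mem.mp hf
    obtain ⟨h1, h2⟩ := s8K_mem.mp hb
    exact ⟨⟨h1, s8_mul_mem hl h2 (by omega)⟩, s8M_mul_mem h2⟩
  · rintro ⟨⟨h1, h2⟩, h3⟩
    obtain ⟨b, hb, rfl⟩ := s8M_mem.mp h3
    exact s8M_mul_mem (s8K_mem.mpr ⟨h1, hb⟩)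

lemma s8T_eq {K : Type*} [Field K] {W2 : Submodule K (MvPolynomial (Fin 4) K)}
    (h2 : W2 ≤ s8R K 2) (d : ℕ) : s8T (s8I W2 ⊥) (d + 2) = s8R K d * W2 := by
  rw [s8T, s8I_piece W2 ⊥ h2 bot_le d, Submodule.mul_bot, sup_bot_eq]

lemma s8R_zero_mul {K : Type*} [Field K] (W2 : Submodule K (MvPolynomial (Fin 4) K)) :
    s8R K 0 * W2 = W2 := by
  rw [s8R, ← homogeneousSubmodule_one_pow, pow_zero, one_mul]

lemma s8T_two {K : Type*} [Field K] {W2 : Submodule K (MvPolynomial (Fin 4) K)}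
    (h2 : W2 ≤ s8R K 2) : s8T (s8I W2 ⊥) 2 = W2 := by
  rw [s8T_eq h2 0, s8R_zero_mul]

lemma s8_hbar {K : Type*} [Field K] {W2 : Submodule K (MvPolynomial (Fin 4) K)}
    (h2 : W2 ≤ s8R K 2) {l : MvPolynomial (Fin 4) K} (hl : l ∈ s8R K 1) (d : ℕ) :
    hilb 4 K (s8I W2 (Submodule.span K {l})) (d + 2) +
      Module.finrank K (s8T (s8I W2 ⊥) (d + 2) ⊔ s8M l (s8R K (d + 1)) : Submodule K _) =
      Module.finrank K (s8R K (d + 2)) := by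
  rw [s8T_eq h2, ← s8M_eq, ← s8I_piece W2 _ h2 (s8_span_le hl) d]
  exact s8_hilb _ _

/-! ### Linear forms -/

lemma s8_dvd {K : Type*} [Field K] {l a : MvPolynomial (Fin 4) K} (hl : l ∈ s8R K 1)
    (h0 : l ≠ 0) (ha : a ∈ s8R K 1) (h : l ∣ a) : a ∈ Submodule.span K {l} := by
  obtain ⟨c, rfl⟩ := h
  by_cases hc : c = 0
  · simp [hc]
  have h1 := IsHomogeneous.totalDegree ha (mul_ne_zero h0 hc)
  rw [totalDegree_mul_of_isDomain h0 hc, IsHomogeneous.totalDegree hl h0] at h1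
  have h2 : c = C (c.coeff 0) := totalDegree_eq_zero_iff_eq_C.mp (by omega)
  rw [Submodule.mem_span_singleton]
  refine ⟨c.coeff 0, ?_⟩
  rw [smul_eq_C_mul, ← h2, mul_comm]

lemma s8_prime {K : Type*} [Field K] {l : MvPolynomial (Fin 4) K} (hl : l ∈ s8R K 1)
    (h0 : l ≠ 0) : Prime l := by
  apply Irreducible.prime
  have h1 := IsHomogeneous.totalDegree hl h0
  refine ⟨?_, ?_⟩
  · intro hu
    rw [isUnit_iff_totalDegree_of_isReduced] at hu
    omega
  · rintro a b rfl
    have ha : a ≠ 0 := left_ne_zero_of_mul h0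
    have hb : b ≠ 0 := right_ne_zero_of_mul h0
    have hu : ∀ c : MvPolynomial (Fin 4) K, c ≠ 0 → c.totalDegree = 0 → IsUnit c := by
      intro c hc h
      rw [totalDegree_eq_zero_iff_eq_C] at h
      rw [h] at hc ⊢
      exact (IsUnit.mk0 _ (by simpa using hc)).map C
    rw [totalDegree_mul_of_isDomain ha hb] at h1
    rcases Nat.eq_zero_or_pos a.totalDegree with h | h
    · exact Or.inl (hu a ha h)
    · exact Or.inr (hu b hb (by omega))

lemma s8_seven {K : Type*} [Field K] {l a : MvPolynomial (Fin 4) K} (hl : l ∈ s8R K 1)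
    (h0 : l ≠ 0) (ha : a ∈ s8R K 1) (h : a ∉ Submodule.span K {l}) :
    7 ≤ Module.finrank K (s8M l (s8R K 1) ⊔ s8M a (s8R K 1) : Submodule K _) := by
  have ha0 : a ≠ 0 := by
    rintro rfl
    exact h (Submodule.zero_mem _)
  have h1 := s8_sup_inf (s8M_le hl (le_refl (s8R K 1))) (s8M_le ha (le_refl (s8R K 1)))
  rw [s8M_finrank h0, s8M_finrank ha0, s8R_one] at h1
  have h2 : s8M l (s8R K 1) ⊓ s8M a (s8R K 1) ≤ Submodule.span K {l * a} := by
    rintro f ⟨hf1, hf2⟩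
    obtain ⟨u, hu, rfl⟩ := s8M_mem.mp hf1
    obtain ⟨v, hv, hv2⟩ := s8M_mem.mp hf2
    have h3 : l ∣ a * v := ⟨u, hv2⟩
    rcases (s8_prime hl h0).dvd_or_dvd h3 with h4 | h4
    · exact absurd (s8_dvd hl h0 ha h4) h
    · obtain ⟨c, rfl⟩ := Submodule.mem_span_singleton.mp (s8_dvd hl h0 hv h4)
      refine Submodule.mem_span_singleton.mpr ⟨c, ?_⟩
      rw [← hv2, mul_smul_comm, mul_comm]
  have h3 := Submodule.finrank_mono h2
  have h4 := finrank_span_singleton (K := K) (mul_ne_zero h0 ha0)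
  omega

lemma s8_sq {K : Type*} [Field K] {l m m' : MvPolynomial (Fin 4) K} (hl : l ∈ s8R K 1)
    (hm : m ∈ s8R K 1) (hm' : m' ∈ s8R K 1)
    (h : m' * m' ∈ s8M l (s8R K 1) ⊔ s8M m (s8R K 1)) : m' ∈ Submodule.span K {l, m} := by
  by_contra hn
  obtain ⟨g, hg, hker⟩ := Submodule.exists_le_ker_of_notMem hn
  have hgl : g l = 0 := hker (Submodule.subset_span (by simp))
  have hgm : g m = 0 := hker (Submodule.subset_span (by simp))
  have hev : ∀ a ∈ s8R K 1, aeval (fun i => g (X i)) a = g a := by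
    intro a ha
    rw [s8R, homogeneousSubmodule_one_eq_span_X] at ha
    refine LinearMap.eqOn_span (f := (aeval (fun i => g (X i))).toLinearMap) (g := g) ?_ ha
    rintro _ ⟨i, rfl⟩
    simp
  obtain ⟨_, hx, _, hy, hxy⟩ := Submodule.mem_sup.mp h
  obtain ⟨u, hu, rfl⟩ := s8M_mem.mp hx
  obtain ⟨v, hv, rfl⟩ := s8M_mem.mp hy
  have := congrArg (aeval (fun i => g (X i))) hxy
  rw [map_add, map_mul, map_mul, map_mul, hev l hl, hev m hm, hev m' hm', hgl, hgm] at this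
  simp at this
  exact hg this

/-! ### The generic linear form -/

/-- The first-order consequences of maximality of multiplication ranks at `l`. -/
def s8Max {K : Type*} [Field K] (J : Ideal (MvPolynomial (Fin 4) K))
    (l : MvPolynomial (Fin 4) K) : Prop :=
  ∀ l' ∈ s8R K 1,
    (∀ a ∈ s8R K 1, l * a ∈ J → ∃ a' ∈ s8R K 1, l' * a - l * a' ∈ J) ∧
    (∀ b ∈ s8R K 2, l * b ∈ J → ∃ b' ∈ s8R K 2, l' * b - l * b' ∈ J) ∧
    (∀ c ∈ s8R K 1, l ^ 2 * c ∈ J → ∃ c' ∈ s8R K 1, 2 * (l * l') * c - l ^ 2 * c' ∈ J) ∧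
    (l ^ 2 ∈ J → l * l' ∈ J) ∧ (l ^ 3 ∈ J → l ^ 2 * l' ∈ J)

lemma s8_step_zero {K : Type*} [Field K] {W2 : Submodule K (MvPolynomial (Fin 4) K)}
    (h2 : W2 ≤ s8R K 2) (h3 : Module.finrank K W2 = 3) {l : MvPolynomial (Fin 4) K}
    (hmax : s8Max (s8I W2 ⊥) l) : l ≠ 0 := by
  rintro rfl
  have hle : s8R K 2 ≤ W2 := by
    rw [← s8R_mul K 1 1, Submodule.mul_le]
    intro x hx y hy
    obtain ⟨a', _, h⟩ := (hmax x hx).1 y hy (by simp)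
    rw [zero_mul, sub_zero] at h
    rw [← s8T_two h2]
    exact ⟨h, s8_mul_mem hx hy rfl⟩
  have := s8_mono hle h2
  rw [s8R_two] at this
  omega

lemma s8_step_one {K : Type*} [Field K] {W2 : Submodule K (MvPolynomial (Fin 4) K)}
    (h2 : W2 ≤ s8R K 2) (h3 : Module.finrank K W2 = 3) {l : MvPolynomial (Fin 4) K}
    (hl : l ∈ s8R K 1) (hmax : s8Max (s8I W2 ⊥) l) (a : MvPolynomial (Fin 4) K)
    (ha : a ∈ s8R K 1) (haJ : l * a ∈ s8I W2 ⊥) : a = 0 := by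
  have h0 := s8_step_zero h2 h3 hmax
  by_contra ha0
  by_cases hal : a ∈ Submodule.span K {l}
  · obtain ⟨c, rfl⟩ := Submodule.mem_span_singleton.mp hal
    have hc : c ≠ 0 := by
      rintro rfl
      simp at ha0
    have hsq : l ^ 2 ∈ s8I W2 ⊥ := by
      have := Ideal.mul_mem_left _ (C c⁻¹) haJ
      rw [smul_eq_C_mul, mul_left_comm l, ← mul_assoc, ← C_mul, inv_mul_cancel₀ hc, C_1,
        one_mul, ← sq] at this
      exact this
    have hle : s8M l (s8R K 1) ≤ W2 := by
      intro f hf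
      obtain ⟨x, hx, rfl⟩ := s8M_mem.mp hf
      rw [← s8T_two h2]
      exact ⟨(hmax x hx).2.2.2.1 hsq, s8_mul_mem hl hx rfl⟩
    have := s8_mono hle h2
    rw [s8M_finrank h0, s8R_one] at this
    omega
  · have h7 := s8_seven hl h0 ha hal
    have hle : s8M l (s8R K 1) ⊔ s8M a (s8R K 1) ≤ W2 ⊔ s8M l (s8R K 1) := by
      refine sup_le le_sup_right ?_
      intro f hf
      obtain ⟨x, hx, rfl⟩ := s8M_mem.mp hf
      obtain ⟨a', ha', h⟩ := (hmax x hx).1 a ha haJ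
      have hin : x * a - l * a' ∈ W2 := by
        rw [← s8T_two h2]
        exact ⟨h, Submodule.sub_mem _ (s8_mul_mem hx ha rfl) (s8_mul_mem hl ha' rfl)⟩
      rw [mul_comm a x, ← sub_add_cancel (x * a) (l * a')]
      exact Submodule.add_mem _ (Submodule.mem_sup_left hin)
        (Submodule.mem_sup_right (s8M_mul_mem ha'))
    have hd := s8_sup_inf h2 (s8M_le hl (le_refl (s8R K 1)))
    have h8 := s8_mono hle (sup_le h2 (s8M_le hl le_rfl))
    have h9 : Submodule.span K {l * a} ≤ W2 ⊓ s8M l (s8R K 1) := by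
      rw [Submodule.span_le, Set.singleton_subset_iff]
      refine ⟨?_, s8M_mul_mem ha⟩
      have : l * a ∈ s8T (s8I W2 ⊥) 2 := ⟨haJ, s8_mul_mem hl ha rfl⟩
      rwa [s8T_two h2] at this
    have h10 := s8_mono h9 (inf_le_left.trans h2)
    rw [finrank_span_singleton (mul_ne_zero h0 ha0)] at h10
    rw [s8M_finrank h0, s8R_one] at hd
    omega

lemma s8_step_two {K : Type*} [Field K] {W2 : Submodule K (MvPolynomial (Fin 4) K)}
    (h2 : W2 ≤ s8R K 2) (h3 : Module.finrank K W2 = 3) {l : MvPolynomial (Fin 4) K}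
    (hl : l ∈ s8R K 1) (hmax : s8Max (s8I W2 ⊥) l) :
    Module.finrank K (W2 ⊔ s8M l (s8R K 1) : Submodule K _) = 7 := by
  have h0 := s8_step_zero h2 h3 hmax
  have h := s8K_dim (s8I W2 ⊥) hl h0 1
  have hK : s8K (s8I W2 ⊥) l 1 = ⊥ := by
    rw [eq_bot_iff]
    intro a ha
    obtain ⟨h4, h5⟩ := s8K_mem.mp ha
    rw [Submodule.mem_bot]
    exact s8_step_one h2 h3 hl hmax a h5 h4
  rw [hK, finrank_bot, s8R_one, s8T_two h2, h3] at h
  exact h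

/-- If some quadric outside `W2` is multiplied into the ideal by `l`, then the cubic piece
modulo `l` is small. -/
lemma s8_claim {K : Type*} [Field K] [CharZero K] {W2 : Submodule K (MvPolynomial (Fin 4) K)}
    (h2 : W2 ≤ s8R K 2) (h3 : Module.finrank K W2 = 3) {l : MvPolynomial (Fin 4) K}
    (hl : l ∈ s8R K 1) (hmax : s8Max (s8I W2 ⊥) l)
    (h11 : 11 ≤ Module.finrank K (s8T (s8I W2 ⊥) 3))
    {b : MvPolynomial (Fin 4) K} (hb : b ∈ s8K (s8I W2 ⊥) l 2) (hbW : b ∉ W2) :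
    18 ≤ Module.finrank K (s8T (s8I W2 ⊥) 3 ⊔ s8M l (s8R K 2) : Submodule K _) := by
  have h0 := s8_step_zero h2 h3 hmax
  have h7 := s8_step_two h2 h3 hl hmax
  have hE2 : W2 ⊔ s8M l (s8R K 1) ≤ s8R K 2 := sup_le h2 (s8M_le hl le_rfl)
  by_cases hcase : ∃ b ∈ s8K (s8I W2 ⊥) l 2, b ∉ W2 ⊔ s8M l (s8R K 1)
  · obtain ⟨b, hb, hbE⟩ := hcase
    obtain ⟨hb1, hb2⟩ := s8K_mem.mp hb
    have hW2' : W2 ⊔ Submodule.span K {b} ≤ s8R K 2 := sup_le h2 (s8_span_le hb2)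
    have hp2 := s8_hilb (s8I (W2 ⊔ Submodule.span K {b}) (Submodule.span K {l})) 2
    have hp3 := s8_hilb (s8I (W2 ⊔ Submodule.span K {b}) (Submodule.span K {l})) 3
    rw [s8I_piece _ _ hW2' (s8_span_le hl) 0, s8R_two, s8R_zero_mul, s8M_eq] at hp2
    rw [s8I_piece _ _ hW2' (s8_span_le hl) 1, s8R_three, s8M_eq, Submodule.mul_sup,
      s8M_eq] at hp3
    have h8 : 8 ≤ Module.finrank K
        (W2 ⊔ Submodule.span K {b} ⊔ s8M l (s8R K (0 + 1)) : Submodule K _) := by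
      have hfin := s8_fin (sup_le hW2' (s8M_le hl (le_refl (s8R K (0 + 1)))))
      have hlt : W2 ⊔ s8M l (s8R K 1) <
          W2 ⊔ Submodule.span K {b} ⊔ s8M l (s8R K (0 + 1)) := by
        refine lt_of_le_of_ne (sup_le (le_sup_left.trans le_sup_left) le_sup_right) ?_
        intro heq
        apply hbE
        rw [heq]
        exact Submodule.mem_sup_left (Submodule.mem_sup_right (Submodule.mem_span_singleton_self b))
      have := Submodule.finrank_lt_finrank_of_lt hlt
      omega
    have h9 := s8_hilb_two (s8I (W2 ⊔ Submodule.span K {b}) (Submodule.span K {l})) 0 (by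
      simp only [zero_add] at hp2 h8 ⊢
      omega)
    have hle : (s8R K 1 * W2 ⊔ s8M b (s8R K 1)) ⊔ s8M l (s8R K (1 + 1)) ≤
        s8T (s8I W2 ⊥) 3 ⊔ s8M l (s8R K 2) := by
      refine sup_le (sup_le ?_ ?_) le_sup_right
      · rw [← s8T_eq h2 1]
        exact le_sup_left
      · intro f hf
        obtain ⟨x, hx, rfl⟩ := s8M_mem.mp hf
        obtain ⟨b', hb', h⟩ := (hmax x hx).2.1 b hb2 hb1
        rw [mul_comm b x, ← sub_add_cancel (x * b) (l * b')]
        refine Submodule.add_mem _ (Submodule.mem_sup_left ⟨h, ?_⟩)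
          (Submodule.mem_sup_right (s8M_mul_mem hb'))
        exact Submodule.sub_mem _ (s8_mul_mem hx hb2 rfl) (s8_mul_mem hl hb' rfl)
    have h10 := s8_mono hle (sup_le inf_le_right (s8M_le hl le_rfl))
    simp only [zero_add] at h9
    omega
  · exfalso
    push Not at hcase
    -- multiples of elements of the second colon lie in `W2 + l R_1`
    have hN : ∀ m ∈ s8R K 1, l ^ 2 * m ∈ s8I W2 ⊥ → ∀ x ∈ s8R K 1,
        x * m ∈ W2 ⊔ s8M l (s8R K 1) := by
      intro m hm hmJ x hx
      obtain ⟨c, hc, h⟩ := (hmax x hx).2.2.1 m hm hmJ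
      have hin : (2 : K) • (x * m) - l * c ∈ s8K (s8I W2 ⊥) l 2 := by
        refine s8K_mem.mpr ⟨?_, Submodule.sub_mem _ (Submodule.smul_mem _ _
          (s8_mul_mem hx hm rfl)) (s8_mul_mem hl hc rfl)⟩
        convert h using 1
        rw [smul_eq_C_mul, map_ofNat]
        ring
      have h4 := Submodule.smul_mem _ (2⁻¹ : K) (Submodule.add_mem _ (hcase _ hin)
        (Submodule.mem_sup_right (s8M_mul_mem hc)))
      rwa [sub_add_cancel, smul_smul, inv_mul_cancel₀ two_ne_zero, one_smul] at h4
    have hl3 : l ^ 3 ∉ s8I W2 ⊥ := by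
      intro h
      have hle : s8R K 2 ≤ W2 ⊔ s8M l (s8R K 1) := by
        rw [← s8R_mul K 1 1, Submodule.mul_le]
        intro x hx y hy
        exact hN y hy ((hmax y hy).2.2.2.2 h) x hx
      have := s8_mono hle hE2
      rw [h7, s8R_two] at this
      omega
    have hscal : ∀ (c : K) (r : MvPolynomial (Fin 4) K), c ≠ 0 →
        l ^ 2 * (c • l) + r ∈ s8I W2 ⊥ → r ∈ s8I W2 ⊥ → False := by
      intro c r hc h hr
      apply hl3
      have h4 := Ideal.mul_mem_left _ (C c⁻¹) (Ideal.sub_mem _ h hr)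
      rw [add_sub_cancel_right, smul_eq_C_mul, mul_left_comm (l ^ 2), ← mul_assoc, ← C_mul,
        inv_mul_cancel₀ hc, C_1, one_mul, ← pow_succ] at h4
      exact h4
    have hdec : ∀ b ∈ s8K (s8I W2 ⊥) l 2, ∃ w ∈ W2, ∃ m ∈ s8R K 1, w + l * m = b ∧
        l ^ 2 * m ∈ s8I W2 ⊥ := by
      intro b hb
      obtain ⟨w, hw, _, hy, hwy⟩ := Submodule.mem_sup.mp (hcase b hb)
      obtain ⟨m, hm, rfl⟩ := s8M_mem.mp hy
      refine ⟨w, hw, m, hm, hwy, ?_⟩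
      have h4 := (s8K_mem.mp hb).1
      have hwJ : w ∈ s8I W2 ⊥ := Ideal.subset_span (Or.inl hw)
      have h5 := Ideal.sub_mem _ h4 (Ideal.mul_mem_left _ l hwJ)
      rw [← hwy] at h5
      convert h5 using 1
      ring
    obtain ⟨w, hw, m, hm, hwm, hmJ⟩ := hdec b hb
    have hml : m ∉ Submodule.span K {l} := by
      intro h
      obtain ⟨c, rfl⟩ := Submodule.mem_span_singleton.mp h
      refine hscal c 0 ?_ (by simpa using hmJ) (Ideal.zero_mem _)
      rintro rfl
      apply hbW
      rw [← hwm]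
      simpa using hw
    have hm0 : m ≠ 0 := by
      rintro rfl
      exact hml (Submodule.zero_mem _)
    have hE : s8M l (s8R K 1) ⊔ s8M m (s8R K 1) = W2 ⊔ s8M l (s8R K 1) := by
      refine s8_eq_of_le (sup_le le_sup_right ?_) hE2 ?_
      · intro f hf
        obtain ⟨x, hx, rfl⟩ := s8M_mem.mp hf
        rw [mul_comm]
        exact hN m hm hmJ x hx
      · rw [h7]
        exact s8_seven hl h0 hm hml
    have hD : s8T (s8I W2 ⊥) 3 ⊔ s8M l (s8R K 2) ≤ s8M l (s8R K 2) ⊔ s8M m (s8R K 2) := by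
      refine sup_le ?_ le_sup_left
      rw [s8T_eq h2 1, Submodule.mul_le]
      intro x hx v hv
      have hv' : v ∈ s8M l (s8R K 1) ⊔ s8M m (s8R K 1) := by
        rw [hE]
        exact Submodule.mem_sup_left hv
      obtain ⟨_, hp, _, hq, rfl⟩ := Submodule.mem_sup.mp hv'
      obtain ⟨p, hp1, rfl⟩ := s8M_mem.mp hp
      obtain ⟨q, hq1, rfl⟩ := s8M_mem.mp hq
      rw [mul_add, mul_left_comm x l, mul_left_comm x m]
      exact Submodule.add_mem _
        (Submodule.mem_sup_left (s8M_mul_mem (s8_mul_mem hx hp1 rfl)))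
        (Submodule.mem_sup_right (s8M_mul_mem (s8_mul_mem hx hq1 rfl)))
    have hd1 := s8_mono hD (sup_le (s8M_le hl le_rfl) (s8M_le hm le_rfl))
    have hd2 := s8_sup_inf (s8M_le hl (le_refl (s8R K 2))) (s8M_le hm (le_refl (s8R K 2)))
    have hd3 : s8M (l * m) (s8R K 1) ≤ s8M l (s8R K 2) ⊓ s8M m (s8R K 2) := by
      intro f hf
      obtain ⟨x, hx, rfl⟩ := s8M_mem.mp hf
      refine ⟨?_, ?_⟩
      · rw [mul_assoc]
        exact s8M_mul_mem (s8_mul_mem hm hx rfl)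
      · rw [mul_comm l m, mul_assoc]
        exact s8M_mul_mem (s8_mul_mem hl hx rfl)
    have hd4 := s8_mono hd3 (inf_le_left.trans (s8M_le hl (le_refl (s8R K 2))))
    rw [s8M_finrank (mul_ne_zero h0 hm0), s8R_one] at hd4
    rw [s8M_finrank h0, s8M_finrank hm0, s8R_two] at hd2
    have hd5 := s8K_dim (s8I W2 ⊥) hl h0 2
    rw [s8R_two, show 2 + 1 = 3 from rfl] at hd5
    have hd6 : 5 ≤ Module.finrank K (s8K (s8I W2 ⊥) l 2) := by omega
    obtain ⟨b', hb', hb'n⟩ : ∃ b' ∈ s8K (s8I W2 ⊥) l 2, b' ∉ W2 ⊔ Submodule.span K {b} := by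
      by_contra hcon
      push Not at hcon
      have hs := s8_span_le (s8K_mem.mp hb).2
      have h4 := s8_mono (show s8K (s8I W2 ⊥) l 2 ≤ W2 ⊔ Submodule.span K {b} from hcon)
        (sup_le h2 hs)
      have h5 := s8_sup_inf h2 hs
      rw [finrank_span_singleton (by
        rintro rfl
        exact hbW (Submodule.zero_mem _))] at h5
      omega
    obtain ⟨w', hw', m', hm', hwm', hmJ'⟩ := hdec b' hb'
    have hsq := s8_sq hl hm hm' (by
      rw [hE]
      exact hN m' hm' hmJ' m' hm')
    obtain ⟨α, β, hαβ⟩ := Submodule.mem_span_pair.mp hsq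
    by_cases hα : α = 0
    · apply hb'n
      rw [hα, zero_smul, zero_add] at hαβ
      have : b' = (w' - β • w) + β • b := by
        rw [← hwm, ← hwm', ← hαβ, smul_add, mul_smul_comm]
        abel
      rw [this]
      exact Submodule.add_mem _
        (Submodule.mem_sup_left (Submodule.sub_mem _ hw' (Submodule.smul_mem _ _ hw)))
        (Submodule.mem_sup_right (Submodule.smul_mem _ _ (Submodule.mem_span_singleton_self b)))
    · refine hscal α (C β * (l ^ 2 * m)) hα ?_ (Ideal.mul_mem_left _ _ hmJ)
      rw [← hαβ] at hmJ'
      convert hmJ' using 1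
      rw [smul_eq_C_mul, smul_eq_C_mul]
      ring

/-! ### Gorenstein duality, in the weak form needed -/

lemma s8_gor {K : Type*} [Field K] {I : Ideal (MvPolynomial (Fin 4) K)} {j : ℕ}
    (hI : IsAG 4 K I j) {e : ℕ} (he : e < j) {f : MvPolynomial (Fin 4) K}
    (hf : f ∈ s8R K e) (h : ∀ k, X k * f ∈ I) : f ∈ I := by
  obtain ⟨hhom, hfin, hsoc, hj, htop⟩ := hI
  obtain ⟨g, hg, hgI⟩ : ∃ g ∈ s8R K j, g ∉ I := by
    by_contra hcon
    push Not at hcon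
    apply hj
    have h1 := s8_hilb I j
    have h2 : (I.restrictScalars K ⊓ s8R K j : Submodule K _) = s8R K j :=
      inf_eq_right.mpr hcon
    rw [h2] at h1
    omega
  have hnext : s8R K (j + 1) ≤ I.restrictScalars K := by
    have h1 := s8_hilb I (j + 1)
    rw [htop (j + 1) (by omega), zero_add] at h1
    have h2 := s8_eq_of_le (S := I.restrictScalars K ⊓ s8R K (j + 1)) inf_le_right le_rfl h1.ge
    exact inf_eq_right.mp h2
  have hmem : ∀ p : MvPolynomial (Fin 4) K, (∀ k, X k * p ∈ I) →
      Ideal.Quotient.mk I p ∈ socleSub 4 K I := by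
    intro p hp
    rw [socleSub, Submodule.mem_iInf]
    intro k
    rw [LinearMap.mem_ker, LinearMap.mulLeft_apply, ← map_mul]
    exact Ideal.Quotient.eq_zero_iff_mem.mpr (hp k)
  have hgs := hmem g (fun k => hnext (s8_mul_mem (isHomogeneous_X K k) hg (by omega)))
  have hfs := hmem f h
  have hne : (⟨Ideal.Quotient.mk I g, hgs⟩ : socleSub 4 K I) ≠ 0 := by
    intro h0
    apply hgI
    have := congrArg Subtype.val h0
    exact Ideal.Quotient.eq_zero_iff_mem.mp this
  obtain ⟨c, hc⟩ := (finrank_eq_one_iff_of_nonzero' _ hne).mp hsoc ⟨Ideal.Quotient.mk I f, hfs⟩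
  have hc2 : Ideal.Quotient.mk I (c • g) = Ideal.Quotient.mk I f := congrArg Subtype.val hc
  have hc3 := hhom _ (Ideal.Quotient.eq.mp hc2) e
  rw [map_sub, map_smul, homogeneousComponent_of_mem hg, homogeneousComponent_of_mem hf,
    if_neg (by omega), if_pos rfl, smul_zero, zero_sub, neg_mem_iff] at hc3
  exact hc3

/-! ### Linear syzygies of three quadrics -/

/-- Multiplication by a linear form, from linear forms to quadrics. -/
def s8mu {K : Type*} [Field K] (a : s8R K 1) : s8R K 1 →ₗ[K] s8R K 2 :=
  ((LinearMap.mulLeft K (a : MvPolynomial (Fin 4) K)).comp (s8R K 1).subtype).codRestrict _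
    (fun x => s8_mul_mem a.2 x.2 rfl)

lemma s8mu_apply {K : Type*} [Field K] (a x : s8R K 1) :
    (s8mu a x : MvPolynomial (Fin 4) K) = a * x := rfl

/-- The map from triples of forms of degree `d` to combinations of three polynomials. -/
def s8phi {K : Type*} [Field K] (q0 q1 q2 : MvPolynomial (Fin 4) K) (d : ℕ) :
    (s8R K d × s8R K d × s8R K d) →ₗ[K] MvPolynomial (Fin 4) K :=
  ((LinearMap.mulLeft K q0).comp (s8R K d).subtype).coprod
    (((LinearMap.mulLeft K q1).comp (s8R K d).subtype).coprod
      ((LinearMap.mulLeft K q2).comp (s8R K d).subtype))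

lemma s8phi_apply {K : Type*} [Field K] (q0 q1 q2 : MvPolynomial (Fin 4) K) (d : ℕ)
    (a b c : s8R K d) : s8phi q0 q1 q2 d (a, b, c) = q0 * a + (q1 * b + q2 * c) := rfl

lemma s8phi_range {K : Type*} [Field K] (q0 q1 q2 : MvPolynomial (Fin 4) K) (d : ℕ) :
    LinearMap.range (s8phi q0 q1 q2 d) = s8R K d *
      (Submodule.span K {q0} ⊔ (Submodule.span K {q1} ⊔ Submodule.span K {q2})) := by
  rw [s8phi, LinearMap.range_coprod, LinearMap.range_coprod, LinearMap.range_comp,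
    LinearMap.range_comp, LinearMap.range_comp, Submodule.range_subtype, Submodule.mul_sup,
    Submodule.mul_sup, s8M_eq, s8M_eq, s8M_eq]

lemma s8phi_dim {K : Type*} [Field K] (q0 q1 q2 : MvPolynomial (Fin 4) K) (d : ℕ) :
    Module.finrank K (LinearMap.range (s8phi q0 q1 q2 d)) +
      Module.finrank K (LinearMap.ker (s8phi q0 q1 q2 d)) =
      3 * Module.finrank K (s8R K d) := by
  rw [LinearMap.finrank_range_add_finrank_ker, Module.finrank_prod, Module.finrank_prod]
  ring

lemma s8_koszul {K : Type*} [Field K] {W2 : Submodule K (MvPolynomial (Fin 4) K)}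
    (h2 : W2 ≤ s8R K 2) (h3 : Module.finrank K W2 = 3)
    (h26 : Module.finrank K (s8T (s8I W2 ⊥) 4) = 26) :
    Module.finrank K (s8T (s8I W2 ⊥) 3) = 12 := by
  have hfin := s8_fin h2
  let B := Module.finBasisOfFinrankEq K W2 h3
  obtain ⟨q, hq⟩ : ∃ q : Fin 3 → MvPolynomial (Fin 4) K, ∀ i, q i = B i := ⟨_, fun _ => rfl⟩
  have hq0 : ∀ i, q i ≠ 0 := by
    intro i h
    rw [hq] at h
    exact B.ne_zero i (Subtype.ext h)
  have hqR : ∀ i, q i ∈ s8R K 2 := by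
    intro i
    rw [hq]
    exact h2 (B i).2
  have hW : W2 = Submodule.span K {q 0} ⊔ (Submodule.span K {q 1} ⊔ Submodule.span K {q 2}) := by
    have h4 := congrArg (Submodule.map W2.subtype) B.span_eq
    rw [Submodule.map_top, Submodule.range_subtype, Submodule.map_span] at h4
    rw [← h4, ← Submodule.span_union, ← Submodule.span_union]
    congr 1
    ext f
    simp only [Set.mem_image, Set.mem_range, Set.mem_union, Set.mem_singleton_iff, hq]
    constructor
    · rintro ⟨_, ⟨i, rfl⟩, rfl⟩
      fin_cases i <;> simp
    · rintro (rfl | rfl | rfl)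
      exacts [⟨_, ⟨0, rfl⟩, rfl⟩, ⟨_, ⟨1, rfl⟩, rfl⟩, ⟨_, ⟨2, rfl⟩, rfl⟩]
  have hT1 : s8T (s8I W2 ⊥) 3 = LinearMap.range (s8phi (q 0) (q 1) (q 2) 1) := by
    rw [s8phi_range, ← hW, s8T_eq h2 1]
  have hT2 : s8T (s8I W2 ⊥) 4 = LinearMap.range (s8phi (q 0) (q 1) (q 2) 2) := by
    rw [s8phi_range, ← hW, s8T_eq h2 2]
  have hd1 := s8phi_dim (q 0) (q 1) (q 2) 1
  have hd2 := s8phi_dim (q 0) (q 1) (q 2) 2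
  rw [← hT1, s8R_one] at hd1
  rw [← hT2, s8R_two, h26] at hd2
  suffices hker : LinearMap.ker (s8phi (q 0) (q 1) (q 2) 1) = ⊥ by
    rw [hker, finrank_bot] at hd1
    omega
  rw [eq_bot_iff]
  rintro ⟨a, b, c⟩ habc
  rw [Submodule.mem_bot]
  by_contra hne
  rw [LinearMap.mem_ker, s8phi_apply] at habc
  let M : s8R K 1 →ₗ[K] (s8R K 2 × s8R K 2 × s8R K 2) :=
    (s8mu a).prod ((s8mu b).prod (s8mu c))
  have hMinj : Function.Injective M := by
    rw [← LinearMap.ker_eq_bot, eq_bot_iff]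
    intro x hx
    rw [Submodule.mem_bot]
    by_contra hx0
    have hx0' : (x : MvPolynomial (Fin 4) K) ≠ 0 := fun h => hx0 (Subtype.ext h)
    apply hne
    have hx1 : (s8mu a x, s8mu b x, s8mu c x) = (0, 0, 0) := hx
    simp only [Prod.mk.injEq] at hx1
    have hz : ∀ y : s8R K 1, s8mu y x = 0 → y = 0 := by
      intro y hy
      have h5 : (y : MvPolynomial (Fin 4) K) * x = 0 := congrArg Subtype.val hy
      exact Subtype.ext ((mul_eq_zero.mp h5).resolve_right hx0')
    rw [hz a hx1.1, hz b hx1.2.1, hz c hx1.2.2]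
    rfl
  have hMle : LinearMap.range M ≤ LinearMap.ker (s8phi (q 0) (q 1) (q 2) 2) := by
    rintro _ ⟨x, rfl⟩
    rw [LinearMap.mem_ker]
    show q 0 * (a * x) + (q 1 * (b * x) + q 2 * (c * x)) = 0
    linear_combination (x : MvPolynomial (Fin 4) K) * habc
  have hMr : Module.finrank K (LinearMap.range M) = 4 := by
    rw [LinearMap.finrank_range_of_inj hMinj, s8R_one]
  have hMeq := Submodule.eq_of_le_of_finrank_le hMle (by omega)
  have hsyz : ∀ u v w : s8R K 2,
      q 0 * u + (q 1 * v + q 2 * (w : MvPolynomial (Fin 4) K)) = 0 →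
      ∃ x : s8R K 1, (a * x : MvPolynomial (Fin 4) K) = u ∧
        (b * x : MvPolynomial (Fin 4) K) = v ∧ (c * x : MvPolynomial (Fin 4) K) = w := by
    intro u v w h
    have h5 : (u, v, w) ∈ LinearMap.range M := by
      rw [hMeq, LinearMap.mem_ker, s8phi_apply]
      exact h
    obtain ⟨x, hx⟩ := h5
    have hx1 : (s8mu a x, s8mu b x, s8mu c x) = (u, v, w) := hx
    simp only [Prod.mk.injEq] at hx1
    exact ⟨x, congrArg Subtype.val hx1.1, congrArg Subtype.val hx1.2.1,
      congrArg Subtype.val hx1.2.2⟩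
  have hc : c = 0 := by
    obtain ⟨x, h5, h6, h7⟩ := hsyz ⟨q 1, hqR 1⟩ ⟨-q 0, Submodule.neg_mem _ (hqR 0)⟩ 0 (by
      simp only [Submodule.coe_zero]
      ring)
    have hx : (x : MvPolynomial (Fin 4) K) ≠ 0 := by
      intro h
      rw [h, mul_zero] at h5
      exact hq0 1 h5.symm
    exact Subtype.ext ((mul_eq_zero.mp h7).resolve_right hx)
  have hb : b = 0 := by
    obtain ⟨x, h5, h6, h7⟩ := hsyz ⟨q 2, hqR 2⟩ 0 ⟨-q 0, Submodule.neg_mem _ (hqR 0)⟩ (by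
      simp only [Submodule.coe_zero]
      ring)
    have hx : (x : MvPolynomial (Fin 4) K) ≠ 0 := by
      intro h
      rw [h, mul_zero] at h5
      exact hq0 2 h5.symm
    exact Subtype.ext ((mul_eq_zero.mp h6).resolve_right hx)
  have ha : a = 0 := by
    obtain ⟨x, h5, h6, h7⟩ := hsyz 0 ⟨q 2, hqR 2⟩ ⟨-q 1, Submodule.neg_mem _ (hqR 1)⟩ (by
      simp only [Submodule.coe_zero]
      ring)
    have hx : (x : MvPolynomial (Fin 4) K) ≠ 0 := by
      intro h
      rw [h, mul_zero] at h6
      exact hq0 2 h6.symm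
    exact Subtype.ext ((mul_eq_zero.mp h5).resolve_right hx)
  apply hne
  rw [ha, hb, hc]
  rfl

/-! ### The three cases -/

lemma s8_exists_b {K : Type*} [Field K] {W2 : Submodule K (MvPolynomial (Fin 4) K)}
    (h2 : W2 ≤ s8R K 2) (h3 : Module.finrank K W2 = 3) {l : MvPolynomial (Fin 4) K}
    (h : 4 ≤ Module.finrank K (s8K (s8I W2 ⊥) l 2)) :
    ∃ b ∈ s8K (s8I W2 ⊥) l 2, b ∉ W2 := by
  by_contra hcon
  push Not at hcon
  have := s8_mono (show s8K (s8I W2 ⊥) l 2 ≤ W2 from hcon) h2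
  omega

lemma s8_case_three {K : Type*} [Field K] [CharZero K]
    {W2 : Submodule K (MvPolynomial (Fin 4) K)}
    (h2 : W2 ≤ s8R K 2) (h3 : Module.finrank K W2 = 3)
    (hT3 : Module.finrank K (s8T (s8I W2 ⊥) 3) = 11)
    (hT4 : Module.finrank K (s8T (s8I W2 ⊥) 4) = 23) : False := by
  obtain ⟨l, hl, hmax'⟩ := s8_max (s8I W2 ⊥)
  have hmax : s8Max (s8I W2 ⊥) l := hmax'
  have h0 := s8_step_zero h2 h3 hmax
  have e3 := s8K_dim (s8I W2 ⊥) hl h0 2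
  have e4 := s8K_dim (s8I W2 ⊥) hl h0 3
  have g3 := s8_hbar h2 hl 1
  have g4 := s8_hbar h2 hl 2
  simp only [Nat.reduceAdd, hT3, hT4, s8R_two, s8R_three, s8R_four] at e3 e4 g3 g4
  have k3 := s8_mono (s8T_le_K (s8I W2 ⊥) l 3) inf_le_right
  have m4 := s8_hilb_two (s8I W2 (Submodule.span K {l})) 1
  simp only [Nat.reduceAdd] at m4
  obtain ⟨b, hb, hbW⟩ := s8_exists_b (l := l) h2 h3 (by omega)
  have := s8_claim h2 h3 hl hmax (by omega) hb hbW
  omega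

lemma s8_case_one {K : Type*} [Field K] [CharZero K]
    {W2 : Submodule K (MvPolynomial (Fin 4) K)}
    (h2 : W2 ≤ s8R K 2) (h3 : Module.finrank K W2 = 3)
    (hT3 : Module.finrank K (s8T (s8I W2 ⊥) 3) = 12)
    (hT4 : Module.finrank K (s8T (s8I W2 ⊥) 4) = 25) :
    ∃ b ∈ s8R K 2, b ∉ W2 ∧ ∀ x ∈ s8R K 1, x * b ∈ s8I W2 ⊥ := by
  obtain ⟨l, hl, hmax'⟩ := s8_max (s8I W2 ⊥)
  have hmax : s8Max (s8I W2 ⊥) l := hmax'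
  have h0 := s8_step_zero h2 h3 hmax
  have e3 := s8K_dim (s8I W2 ⊥) hl h0 2
  have e4 := s8K_dim (s8I W2 ⊥) hl h0 3
  have g3 := s8_hbar h2 hl 1
  have g4 := s8_hbar h2 hl 2
  simp only [Nat.reduceAdd, hT3, hT4, s8R_two, s8R_three, s8R_four] at e3 e4 g3 g4
  have k3 := s8_mono (s8T_le_K (s8I W2 ⊥) l 3) inf_le_right
  have m4 := s8_hilb_two (s8I W2 (Submodule.span K {l})) 1
  have n4 := s8_hilb_one (s8I W2 (Submodule.span K {l})) 2
  simp only [Nat.reduceAdd] at m4 n4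
  obtain ⟨b, hb, hbW⟩ := s8_exists_b (l := l) h2 h3 (by omega)
  have hcl := s8_claim h2 h3 hl hmax (by omega) hb hbW
  obtain ⟨hb1, hb2⟩ := s8K_mem.mp hb
  have heq := s8_eq_of_le (s8T_le_K (s8I W2 ⊥) l 3) inf_le_right (by omega)
  refine ⟨b, hb2, hbW, fun x hx => ?_⟩
  have hin : x * b ∈ s8K (s8I W2 ⊥) l 3 := by
    refine s8K_mem.mpr ⟨?_, s8_mul_mem hx hb2 rfl⟩
    rw [mul_left_comm]
    exact Ideal.mul_mem_left _ _ hb1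
  rw [← heq] at hin
  exact hin.1

lemma s8_case_two {K : Type*} [Field K] [CharZero K]
    {W2 : Submodule K (MvPolynomial (Fin 4) K)}
    (h2 : W2 ≤ s8R K 2) (h3 : Module.finrank K W2 = 3)
    (hT4 : Module.finrank K (s8T (s8I W2 ⊥) 4) = 26)
    (hT5 : Module.finrank K (s8T (s8I W2 ⊥) 5) = 45) :
    ∃ b ∈ s8R K 2, b ∉ W2 ∧ ∀ x ∈ s8R K 2, x * b ∈ s8I W2 ⊥ := by
  have hT3 := s8_koszul h2 h3 hT4
  obtain ⟨l, hl, hmax'⟩ := s8_max (s8I W2 ⊥)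
  have hmax : s8Max (s8I W2 ⊥) l := hmax'
  have h0 := s8_step_zero h2 h3 hmax
  have e3 := s8K_dim (s8I W2 ⊥) hl h0 2
  have e5 := s8K_dim (s8I W2 ⊥) hl h0 4
  have g3 := s8_hbar h2 hl 1
  have g5 := s8_hbar h2 hl 3
  simp only [Nat.reduceAdd, hT3, hT5, s8R_two, s8R_three, s8R_four, s8R_five] at e3 e5 g3 g5
  have k4 := s8_mono (s8T_le_K (s8I W2 ⊥) l 4) inf_le_right
  have m4 := s8_hilb_two (s8I W2 (Submodule.span K {l})) 1
  have m5 := s8_hilb_two (s8I W2 (Submodule.span K {l})) 2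
  have n4 := s8_hilb_one (s8I W2 (Submodule.span K {l})) 2
  have n5 := s8_hilb_one (s8I W2 (Submodule.span K {l})) 3
  simp only [Nat.reduceAdd] at m4 m5 n4 n5
  obtain ⟨b, hb, hbW⟩ := s8_exists_b (l := l) h2 h3 (by omega)
  have hcl := s8_claim h2 h3 hl hmax (by omega) hb hbW
  obtain ⟨hb1, hb2⟩ := s8K_mem.mp hb
  have heq := s8_eq_of_le (s8T_le_K (s8I W2 ⊥) l 4) inf_le_right (by omega)
  refine ⟨b, hb2, hbW, fun x hx => ?_⟩
  have hin : x * b ∈ s8K (s8I W2 ⊥) l 4 := by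
    refine s8K_mem.mpr ⟨?_, s8_mul_mem hx hb2 rfl⟩
    rw [mul_left_comm]
    exact Ideal.mul_mem_left _ _ hb1
  rw [← heq] at hin
  exact hin.1


/-- If `A = R/I` is a graded Artinian Gorenstein quotient of
`R = K[w,x,y,z]` of socle degree `j ≥ 5`, then the Hilbert function of
`R/(I_2)`, where `(I_2)` is the ideal generated by the degree-2 part of `I`,
cannot begin `(1,4,7,8,10)`, nor `(1,4,7,b,9,11)` for any `b`, nor
`(1,4,7,9,12)`. -/
theorem statement_8 {K : Type*} [Field K] [IsAlgClosed K] [CharZero K]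
    (j : ℕ) (hj : 5 ≤ j) (I : Ideal (MvPolynomial (Fin 4) K))
    (hI : IsAG 4 K I j)
    (I₂ : Ideal (MvPolynomial (Fin 4) K))
    (hI₂ : I₂ = Ideal.span {f | f ∈ I ∧ f.IsHomogeneous 2}) :
    (¬ (hilb 4 K I₂ 0 = 1 ∧ hilb 4 K I₂ 1 = 4 ∧ hilb 4 K I₂ 2 = 7 ∧
        hilb 4 K I₂ 3 = 8 ∧ hilb 4 K I₂ 4 = 10)) ∧
    (∀ b : ℕ, ¬ (hilb 4 K I₂ 0 = 1 ∧ hilb 4 K I₂ 1 = 4 ∧ hilb 4 K I₂ 2 = 7 ∧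
        hilb 4 K I₂ 3 = b ∧ hilb 4 K I₂ 4 = 9 ∧ hilb 4 K I₂ 5 = 11)) ∧
    (¬ (hilb 4 K I₂ 0 = 1 ∧ hilb 4 K I₂ 1 = 4 ∧ hilb 4 K I₂ 2 = 7 ∧
        hilb 4 K I₂ 3 = 9 ∧ hilb 4 K I₂ 4 = 12)) := by
  set W2 : Submodule K (MvPolynomial (Fin 4) K) := I.restrictScalars K ⊓ s8R K 2 with hW2
  have h2 : W2 ≤ s8R K 2 := inf_le_right
  have hJ : I₂ = s8I W2 ⊥ := by
    rw [hI₂, s8I]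
    congr 1
    ext f
    simp only [Set.mem_ofPred_eq, Set.mem_union, SetLike.mem_coe, Submodule.mem_bot]
    constructor
    · rintro ⟨hf1, hf2⟩
      exact Or.inl ⟨hf1, hf2⟩
    · rintro (⟨hf1, hf2⟩ | rfl)
      · exact ⟨hf1, hf2⟩
      · exact ⟨Ideal.zero_mem _, isHomogeneous_zero _ _ _⟩
  have hle : s8I W2 ⊥ ≤ I := by
    rw [s8I, Ideal.span_le]
    rintro f (hf | hf)
    · exact hf.1
    · rw [SetLike.mem_coe, Submodule.mem_bot] at hf
      rw [hf]
      exact Ideal.zero_mem _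
  rw [hJ]
  have d2 : hilb 4 K (s8I W2 ⊥) 2 + Module.finrank K W2 = 10 := by
    have := s8_hilb (s8I W2 ⊥) 2
    rwa [s8R_two, show (s8I W2 ⊥).restrictScalars K ⊓ s8R K 2 = W2 from s8T_two h2] at this
  have d3 : _ + Module.finrank K (s8T (s8I W2 ⊥) 3) = _ := s8_hilb (s8I W2 ⊥) 3
  have d4 : _ + Module.finrank K (s8T (s8I W2 ⊥) 4) = _ := s8_hilb (s8I W2 ⊥) 4
  have d5 : _ + Module.finrank K (s8T (s8I W2 ⊥) 5) = _ := s8_hilb (s8I W2 ⊥) 5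
  rw [s8R_three] at d3
  rw [s8R_four] at d4
  rw [s8R_five] at d5
  refine ⟨?_, ?_, ?_⟩
  · rintro ⟨-, -, a2, a3, a4⟩
    obtain ⟨b, hb, hbW, hx⟩ := s8_case_one h2 (by omega) (by omega) (by omega)
    apply hbW
    exact ⟨s8_gor hI (by omega) hb (fun k => hle (hx _ (isHomogeneous_X K k))), hb⟩
  · rintro b ⟨-, -, a2, -, a4, a5⟩
    obtain ⟨b, hb, hbW, hx⟩ := s8_case_two h2 (by omega) (by omega) (by omega)
    apply hbW
    refine ⟨s8_gor hI (by omega) hb (fun k => ?_), hb⟩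
    refine s8_gor hI (e := 3) (by omega) (s8_mul_mem (isHomogeneous_X K k) hb rfl) (fun i => ?_)
    rw [← mul_assoc]
    exact hle (hx _ (s8_mul_mem (isHomogeneous_X K i) (isHomogeneous_X K k) rfl))
  · rintro ⟨-, -, a2, a3, a4⟩
    exact s8_case_three h2 (by omega) (by omega) (by omega)

end
end

section
/- Let A = R/I be a graded Artinian Gorenstein quotient of R = K[w,x,y,z] of socle degree j ≥ 4 with I_1 = 0 and I_2 = span{wx, wy, wz}. Set R' = K[x,y,z] and J = I ∩ R'. Then: (1) R'/J is a graded Artinian Gorenstein quotient of R' of socle degree j; (2) H(R/I)_i = H(R'/J)_i + 1 for all 1 ≤ i ≤ j−1 (and H(R/I)_0 = H(R'/J)_0 = 1, H(R/I)_j = H(R'/J)_j = 1); (3) there exists a nonzero g ∈ R'_j such that I is generated by J together with wx, wy, wz, and w^j − g. -/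
open MvPolynomial

noncomputable section

/-- The ideal `J = I ∩ K[x,y,z]` of `R' = K[x,y,z]`, for an ideal `I` of
`R = K[w,x,y,z]` (where `w = X 0`, and `R' ↪ R` sends the variables of `R'`
to `x = X 1`, `y = X 2`, `z = X 3`). -/
def interR' {K : Type*} [Field K] (I : Ideal (MvPolynomial (Fin 4) K)) :
    Ideal (MvPolynomial (Fin 3) K) :=
  Ideal.comap (rename (Fin.succ : Fin 3 → Fin 4)).toRingHom I


section helpers

variable {K : Type*} [Field K]

lemma hh_mem_of_hilb_zero {n : ℕ} {I : Ideal (MvPolynomial (Fin n) K)}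
    [FiniteDimensional K (MvPolynomial (Fin n) K ⧸ I)] {i : ℕ} (h : hilb n K I i = 0)
    {p : MvPolynomial (Fin n) K} (hp : p.IsHomogeneous i) : p ∈ I := by
  unfold hilb at h
  rw [Submodule.finrank_eq_zero] at h
  have h1 : (Ideal.Quotient.mkₐ K I).toLinearMap p ∈
      ((homogeneousSubmodule (Fin n) K i).map (Ideal.Quotient.mkₐ K I).toLinearMap) :=
    Submodule.mem_map_of_mem hp
  rw [h, Submodule.mem_bot] at h1
  exact Ideal.Quotient.eq_zero_iff_mem.1 h1

lemma hh_hilb_zero_of {n : ℕ} {I : Ideal (MvPolynomial (Fin n) K)} {i : ℕ}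
    (h : ∀ p : MvPolynomial (Fin n) K, p.IsHomogeneous i → p ∈ I) : hilb n K I i = 0 := by
  unfold hilb
  have : (homogeneousSubmodule (Fin n) K i).map (Ideal.Quotient.mkₐ K I).toLinearMap = ⊥ := by
    rw [eq_bot_iff]
    rintro _ ⟨p, hp, rfl⟩
    exact Ideal.Quotient.eq_zero_iff_mem.2 (h p hp)
  rw [this, finrank_bot]

/-- if all forms of degree `i` are multiples of `m ∉ I` modulo `I` then `hilb = 1`. -/
lemma hh_hilb_one_of {n : ℕ} {I : Ideal (MvPolynomial (Fin n) K)} {i : ℕ}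
    {m : MvPolynomial (Fin n) K} (hm : m.IsHomogeneous i) (hmI : m ∉ I)
    (h : ∀ p : MvPolynomial (Fin n) K, p.IsHomogeneous i → ∃ c : K, p - C c * m ∈ I) :
    hilb n K I i = 1 := by
  unfold hilb
  have : (homogeneousSubmodule (Fin n) K i).map (Ideal.Quotient.mkₐ K I).toLinearMap =
      Submodule.span K {Ideal.Quotient.mk I m} := by
    apply le_antisymm
    · rintro _ ⟨p, hp, rfl⟩
      obtain ⟨c, hc⟩ := h p hp
      rw [Submodule.mem_span_singleton]
      refine ⟨c, ?_⟩
      have := Ideal.Quotient.eq.2 hc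
      change c • Ideal.Quotient.mk I m = Ideal.Quotient.mk I p
      rw [this, ← smul_eq_C_mul]
      rfl
    · rw [Submodule.span_singleton_le_iff_mem]
      exact ⟨m, hm, rfl⟩
  rw [this]
  exact finrank_span_singleton (fun h0 => hmI (Ideal.Quotient.eq_zero_iff_mem.1 h0))

lemma hh_mem_socle {n : ℕ} {I : Ideal (MvPolynomial (Fin n) K)} {p : MvPolynomial (Fin n) K} :
    Ideal.Quotient.mk I p ∈ socleSub n K I ↔ ∀ k, X k * p ∈ I := by
  unfold socleSub
  simp only [Submodule.mem_iInf, LinearMap.mem_ker, LinearMap.mulLeft_apply, ← map_mul,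
    Ideal.Quotient.eq_zero_iff_mem]

/-- one-dimensional socle, elementwise -/
lemma hh_socle_one {n : ℕ} {I : Ideal (MvPolynomial (Fin n) K)}
    (h : Module.finrank K (socleSub n K I) = 1)
    {m : MvPolynomial (Fin n) K} (hm : ∀ k, X k * m ∈ I) (hmI : m ∉ I)
    {p : MvPolynomial (Fin n) K} (hp : ∀ k, X k * p ∈ I) : ∃ c : K, p - C c * m ∈ I := by
  have hne : (⟨Ideal.Quotient.mk I m, hh_mem_socle.2 hm⟩ : socleSub n K I) ≠ 0 := by
    intro h0
    exact hmI (Ideal.Quotient.eq_zero_iff_mem.1 (congrArg Subtype.val h0))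
  obtain ⟨c, hc⟩ := (finrank_eq_one_iff_of_nonzero' _ hne).1 h
    ⟨Ideal.Quotient.mk I p, hh_mem_socle.2 hp⟩
  refine ⟨c, Ideal.Quotient.eq.1 ?_⟩
  have := congrArg Subtype.val hc
  change c • Ideal.Quotient.mk I m = Ideal.Quotient.mk I p at this
  rw [← this, ← smul_eq_C_mul]
  rfl

lemma hh_socle_one_of {n : ℕ} {I : Ideal (MvPolynomial (Fin n) K)}
    {m : MvPolynomial (Fin n) K} (hm : ∀ k, X k * m ∈ I) (hmI : m ∉ I)
    (h : ∀ p : MvPolynomial (Fin n) K, (∀ k, X k * p ∈ I) → ∃ c : K, p - C c * m ∈ I) :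
    Module.finrank K (socleSub n K I) = 1 := by
  have hne : (⟨Ideal.Quotient.mk I m, hh_mem_socle.2 hm⟩ : socleSub n K I) ≠ 0 := by
    intro h0
    exact hmI (Ideal.Quotient.eq_zero_iff_mem.1 (congrArg Subtype.val h0))
  rw [finrank_eq_one_iff_of_nonzero' _ hne]
  rintro ⟨q, hq⟩
  obtain ⟨p, rfl⟩ := Ideal.Quotient.mk_surjective q
  obtain ⟨c, hc⟩ := h p (hh_mem_socle.1 hq)
  refine ⟨c, Subtype.ext ?_⟩
  have := Ideal.Quotient.eq.2 hc
  change c • Ideal.Quotient.mk I m = Ideal.Quotient.mk I p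
  rw [this, ← smul_eq_C_mul]
  rfl

lemma hh_mem_inter {I : Ideal (MvPolynomial (Fin 4) K)} {f : MvPolynomial (Fin 3) K} :
    f ∈ interR' I ↔ rename (Fin.succ : Fin 3 → Fin 4) f ∈ I := Iff.rfl

lemma hh_key {L : Ideal (MvPolynomial (Fin 4) K)}
    (hL : ∀ k : Fin 3, (X 0 * X k.succ : MvPolynomial (Fin 4) K) ∈ L)
    (f : MvPolynomial (Fin 3) K) : X 0 * rename (Fin.succ : Fin 3 → Fin 4) f - C (coeff 0 f) * X 0 ∈ L := by
  induction f using MvPolynomial.induction_on with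
  | C a => simp [mul_comm]
  | add p q hp hq =>
    have := L.add_mem hp hq
    convert this using 1
    simp only [map_add, coeff_add]
    ring
  | mul_X p k hp =>
    have := L.mul_mem_left (rename (Fin.succ : Fin 3 → Fin 4) p) (hL k)
    convert this using 1
    have h0 : coeff 0 (p * X k) = 0 := by
      rw [← constantCoeff_eq]; simp
    simp only [map_mul, rename_X, h0, map_zero]
    ring

lemma hh_key0 {L : Ideal (MvPolynomial (Fin 4) K)}
    (hL : ∀ k : Fin 3, (X 0 * X k.succ : MvPolynomial (Fin 4) K) ∈ L)
    {f : MvPolynomial (Fin 3) K} (hf : coeff 0 f = 0) : X 0 * rename (Fin.succ : Fin 3 → Fin 4) f ∈ L := by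
  simpa [hf] using hh_key hL f

lemma hh_coeff0 {f : MvPolynomial (Fin 3) K} {i : ℕ} (hf : f.IsHomogeneous i) (hi : 1 ≤ i) :
    coeff 0 f = 0 :=
  hf.coeff_eq_zero (by simp; omega)

lemma hh_decomp {L : Ideal (MvPolynomial (Fin 4) K)}
    (hL : ∀ k : Fin 3, (X 0 * X k.succ : MvPolynomial (Fin 4) K) ∈ L)
    {i : ℕ} {p : MvPolynomial (Fin 4) K} (hp : p.IsHomogeneous i) :
    ∃ f : MvPolynomial (Fin 3) K, f.IsHomogeneous i ∧
      ∃ c : K, p - (rename (Fin.succ : Fin 3 → Fin 4) f + C c * X 0 ^ i) ∈ L := by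
  let P : MvPolynomial (Fin 4) K → Prop := fun p => ∃ f : MvPolynomial (Fin 3) K,
    f.IsHomogeneous i ∧ ∃ c : K, p - (rename (Fin.succ : Fin 3 → Fin 4) f + C c * X 0 ^ i) ∈ L
  change P p
  rw [p.as_sum]
  apply Finset.sum_induction _ P
  · rintro a b ⟨f, hf, c, h⟩ ⟨f', hf', c', h'⟩
    refine ⟨f + f', hf.add hf', c + c', ?_⟩
    convert L.add_mem h h' using 1
    simp only [map_add]
    ring
  · exact ⟨0, isHomogeneous_zero _ _ _, 0, by simp⟩
  · intro d hd
    have hdeg : d.degree = i := by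
      by_contra hne
      exact (mem_support_iff.1 hd) (hp.coeff_eq_zero hne)
    set a := coeff d p
    have hdd : d = Finsupp.single 0 (d 0) + Finsupp.mapDomain Fin.succ d.tail := by
      ext k
      refine Fin.cases ?_ (fun k => ?_) k
      · rw [Finsupp.add_apply, Finsupp.mapDomain_of_notMem_range]
        · simp
        · simp
      · rw [Finsupp.add_apply, Finsupp.mapDomain_apply (Fin.succ_injective 3)]
        simp [Finsupp.tail_apply]
    have hmon : monomial d a = X 0 ^ (d 0) * rename (Fin.succ : Fin 3 → Fin 4) (monomial d.tail a) := by
      rw [rename_monomial, X_pow_eq_monomial, monomial_mul, one_mul, ← hdd]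
    by_cases h0 : d 0 = 0
    · refine ⟨monomial d.tail a, ?_, 0, ?_⟩
      · apply isHomogeneous_monomial
        rw [← hdeg]
        conv_rhs => rw [hdd]
        simp [h0, Finsupp.degree_mapDomain]
      · rw [hmon, h0]; simp
    · by_cases ht : d.tail = 0
      · refine ⟨0, isHomogeneous_zero _ _ _, a, ?_⟩
        have : d 0 = i := by
          rw [← hdeg]
          conv_rhs => rw [hdd]
          simp [ht]
        rw [hmon, ht, this, ← C_apply, rename_C]
        simp [mul_comm]
      · refine ⟨0, isHomogeneous_zero _ _ _, 0, ?_⟩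
        have h1 : X 0 * rename (Fin.succ : Fin 3 → Fin 4) (monomial d.tail a) ∈ L := by
          apply hh_key0 hL
          rw [coeff_monomial, if_neg ht]
        obtain ⟨e, he⟩ := Nat.exists_eq_succ_of_ne_zero h0
        have := L.mul_mem_left (X 0 ^ e) h1
        rw [hmon, he, pow_succ]
        simpa [mul_assoc] using this

end helpers

/-- Let `A = R/I` be a graded Artinian Gorenstein quotient of
`R = K[w,x,y,z]` of socle degree `j ≥ 4` with `I_1 = 0` and
`I_2 = ⟨wx, wy, wz⟩`, and let `J = I ∩ K[x,y,z]`.  Then (1) `R'/J` is a graded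
Artinian Gorenstein quotient of `R' = K[x,y,z]` of socle degree `j`;
(2) `H(R/I)_i = H(R'/J)_i + 1` for `1 ≤ i ≤ j-1`, while the values in degrees
`0` and `j` are all `1`; and (3) there is a nonzero `g ∈ R'_j` such that `I`
is generated by `J` together with `wx, wy, wz` and `w^j - g`. -/
theorem statement_10 {K : Type*} [Field K] [IsAlgClosed K] [CharZero K]
    (j : ℕ) (hj : 4 ≤ j) (I : Ideal (MvPolynomial (Fin 4) K))
    (hI : IsAG 4 K I j)
    (hI1 : ∀ f ∈ I, f.IsHomogeneous 1 → f = 0)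
    (hI2 : Submodule.restrictScalars K I ⊓ homogeneousSubmodule (Fin 4) K 2 =
      Submodule.span K {X 0 * X 1, X 0 * X 2, X 0 * X 3}) :
    IsAG 3 K (interR' I) j ∧
    (hilb 4 K I 0 = 1 ∧ hilb 3 K (interR' I) 0 = 1 ∧
      hilb 4 K I j = 1 ∧ hilb 3 K (interR' I) j = 1 ∧
      ∀ i, 1 ≤ i → i ≤ j - 1 → hilb 4 K I i = hilb 3 K (interR' I) i + 1) ∧
    (∃ g : MvPolynomial (Fin 3) K, g.IsHomogeneous j ∧ g ≠ 0 ∧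
      I = Ideal.map (rename (Fin.succ : Fin 3 → Fin 4)).toRingHom (interR' I) ⊔
        Ideal.span {X 0 * X 1, X 0 * X 2, X 0 * X 3,
          X 0 ^ j - rename (Fin.succ : Fin 3 → Fin 4) g}) := by
  obtain ⟨hom, fd, soc, hj0, hgt⟩ := hI
  have hL : ∀ k : Fin 3, (X 0 * X k.succ : MvPolynomial (Fin 4) K) ∈ I := by
    have hsub : ∀ p ∈ ({X 0 * X 1, X 0 * X 2, X 0 * X 3} : Set (MvPolynomial (Fin 4) K)),
        p ∈ I := by
      intro p hp
      have : p ∈ Submodule.restrictScalars K I ⊓ homogeneousSubmodule (Fin 4) K 2 := by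
        rw [hI2]; exact Submodule.subset_span hp
      exact this.1
    intro k
    apply hsub
    fin_cases k <;> simp
  have hρ : ∀ {f : MvPolynomial (Fin 3) K} {i : ℕ}, f.IsHomogeneous i →
      (rename (Fin.succ : Fin 3 → Fin 4) f).IsHomogeneous i := fun h => h.rename_isHomogeneous
  have top : ∀ {i : ℕ} {p : MvPolynomial (Fin 4) K}, j < i → p.IsHomogeneous i → p ∈ I :=
    fun hi hp => hh_mem_of_hilb_zero (hgt _ hi) hp
  have hX : ∀ {i : ℕ} {p : MvPolynomial (Fin 4) K} (k), p.IsHomogeneous i →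
      (X k * p).IsHomogeneous (i + 1) := by
    intro i p k hp
    rw [add_comm]
    exact (isHomogeneous_X K k).mul hp
  have hconst : ∀ c : K, (C c : MvPolynomial (Fin 4) K) ∈ I → c = 0 := by
    intro c hc
    have h1 := hI1 _ (I.mul_mem_right (X 0) hc) (isHomogeneous_C_mul_X c 0)
    simpa using h1
  have hvar : ∀ k (c : K), (C c * X k : MvPolynomial (Fin 4) K) ∈ I → c = 0 := by
    intro k c hc
    have h1 := hI1 _ hc (isHomogeneous_C_mul_X c k)
    simpa using h1
  have hvar1 : ∀ k, (X k : MvPolynomial (Fin 4) K) ∉ I := by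
    intro k hk
    exact one_ne_zero (hvar k 1 (by simpa using hk))
  -- nonsocle elements in low degree
  have low : ∀ {i : ℕ} {p : MvPolynomial (Fin 4) K}, i < j → p.IsHomogeneous i →
      (∀ k, X k * p ∈ I) → p ∈ I := by
    intro i p hi hp hk
    obtain ⟨m, hm, hmI⟩ : ∃ m : MvPolynomial (Fin 4) K, m.IsHomogeneous j ∧ m ∉ I := by
      by_contra hcon
      push Not at hcon
      exact hj0 (hh_hilb_zero_of hcon)
    obtain ⟨c, hc⟩ := hh_socle_one soc
      (fun k => top (Nat.lt_succ_self j) (hX k hm)) hmI hk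
    have := hom _ hc i
    rw [map_sub, homogeneousComponent_C_mul, homogeneousComponent_of_mem hp,
      homogeneousComponent_of_mem hm, if_pos rfl, if_neg hi.ne, mul_zero, sub_zero] at this
    exact this
  -- powers of w
  have wpow : ∀ i, i ≤ j → (X 0 ^ i : MvPolynomial (Fin 4) K) ∉ I := by
    intro i
    induction i with
    | zero =>
      intro _ h
      exact one_ne_zero (hconst 1 (by simpa using h))
    | succ i ih =>
      intro hi h
      by_cases hi0 : i = 0
      · subst hi0
        exact hvar1 0 (by simpa using h)
      refine ih (by omega) (low (i := i) (by omega) (isHomogeneous_X_pow 0 i) ?_)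
      intro k
      refine Fin.cases ?_ (fun k => ?_) k
      · rw [← pow_succ']; exact h
      · obtain ⟨e, rfl⟩ := Nat.exists_eq_succ_of_ne_zero hi0
        have := I.mul_mem_left (X 0 ^ e) (hL k)
        convert this using 1
        rw [pow_succ]; ring
  -- independence
  have indep : ∀ {i : ℕ} {f : MvPolynomial (Fin 3) K} {c : K}, 1 ≤ i → i < j →
      f.IsHomogeneous i → rename (Fin.succ : Fin 3 → Fin 4) f + C c * X 0 ^ i ∈ I → c = 0 := by
    intro i f c hi hij hf h
    have hfI : rename (Fin.succ : Fin 3 → Fin 4) f ∈ I := by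
      refine low hij (hρ hf) ?_
      intro k
      refine Fin.cases ?_ (fun k => ?_) k
      · exact hh_key0 hL (hh_coeff0 hf hi)
      · obtain ⟨e, rfl⟩ := Nat.exists_eq_succ_of_ne_zero (by omega : i ≠ 0)
        have h1 := I.mul_mem_left (C c * X 0 ^ e) (hL k)
        have h2 := I.sub_mem (I.mul_mem_left (X k.succ) h) h1
        convert h2 using 1
        rw [pow_succ]; ring
    have h3 : C c * X 0 ^ i ∈ I := (I.add_mem_iff_right hfI).1 h
    by_contra hc
    apply wpow i hij.le
    have := I.mul_mem_left (C c⁻¹) h3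
    rwa [← mul_assoc, ← C_mul, inv_mul_cancel₀ hc, C_1, one_mul] at this
  -- element of R'_j not in I
  obtain ⟨m, hm, hmI⟩ : ∃ m : MvPolynomial (Fin 3) K, m.IsHomogeneous j ∧
      rename (Fin.succ : Fin 3 → Fin 4) m ∉ I := by
    have : ∀ d, d + 1 ≤ j → ∃ m : MvPolynomial (Fin 3) K, m.IsHomogeneous (d + 1) ∧
      rename (Fin.succ : Fin 3 → Fin 4) m ∉ I := by
      intro d
      induction d with
      | zero =>
        intro _
        exact ⟨X 0, isHomogeneous_X K 0, by rw [rename_X]; exact hvar1 _⟩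
      | succ d ih =>
        intro hd
        obtain ⟨m, hm, hmI⟩ := ih (by omega)
        by_contra hcon
        push Not at hcon
        refine hmI (low (i := d + 1) (by omega) (hρ hm) ?_)
        intro k
        refine Fin.cases ?_ (fun k => ?_) k
        · exact hh_key0 hL (hh_coeff0 hm (by omega))
        · have := hcon (X k * m) (by rw [add_comm]; exact (isHomogeneous_X K k).mul hm)
          rwa [map_mul, rename_X] at this
    obtain ⟨d, rfl⟩ := Nat.exists_eq_succ_of_ne_zero (by omega : j ≠ 0)
    exact this d le_rfl
  have hmS : ∀ k, X k * rename (Fin.succ : Fin 3 → Fin 4) m ∈ I :=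
    fun k => top (Nat.lt_succ_self j) (hX k (hρ hm))
  have hS : ∀ {p : MvPolynomial (Fin 4) K}, (∀ k, X k * p ∈ I) →
      ∃ c : K, p - C c * rename (Fin.succ : Fin 3 → Fin 4) m ∈ I :=
    fun hp => hh_socle_one soc hmS hmI hp
  have hSj : ∀ {p : MvPolynomial (Fin 4) K}, p.IsHomogeneous j →
      ∃ c : K, p - C c * rename (Fin.succ : Fin 3 → Fin 4) m ∈ I :=
    fun hp => hS (fun k => top (Nat.lt_succ_self j) (hX k hp))
  -- injection of quotients
  let ψ : (MvPolynomial (Fin 3) K ⧸ interR' I) →ₐ[K] (MvPolynomial (Fin 4) K ⧸ I) :=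
    Ideal.quotientMapₐ I (rename (Fin.succ : Fin 3 → Fin 4)) le_rfl
  have hψ : Function.Injective ψ := Ideal.quotientMap_injective
  have hψmk : ∀ f, ψ (Ideal.Quotient.mk _ f) =
      Ideal.Quotient.mk I (rename (Fin.succ : Fin 3 → Fin 4) f) := fun f => rfl
  have hJhilb : ∀ i, hilb 3 K (interR' I) i = Module.finrank K
      (((homogeneousSubmodule (Fin 3) K i).map
        (Ideal.Quotient.mkₐ K (interR' I)).toLinearMap).map ψ.toLinearMap) := by
    intro i
    exact (LinearEquiv.finrank_eq (Submodule.equivMapOfInjective ψ.toLinearMap hψ _))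
  have hJj : hilb 3 K (interR' I) j = 1 := by
    refine hh_hilb_one_of hm hmI ?_
    intro p hp
    obtain ⟨c, hc⟩ := hSj (hρ hp)
    refine ⟨c, ?_⟩
    rw [hh_mem_inter, map_sub, map_mul, rename_C]
    exact hc
  have h0 : ∀ {n : ℕ} {p : MvPolynomial (Fin n) K}, p.IsHomogeneous 0 → ∃ c, p = C c := by
    intro n p hp
    refine ⟨coeff 0 p, ?_⟩
    rw [← homogeneousComponent_zero, homogeneousComponent_of_mem hp, if_pos rfl]
  have h1I : (1 : MvPolynomial (Fin 4) K) ∉ I := fun h =>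
    one_ne_zero (hconst 1 (by simpa using h))
  refine ⟨⟨?_, ?_, ?_, ?_, ?_⟩, ⟨?_, ?_, ?_, hJj, ?_⟩, ?_⟩
  · intro f hf d
    have := hom _ hf d
    rw [hh_mem_inter, rename_homogeneousComponent]
    exact this
  · exact FiniteDimensional.of_injective ψ.toLinearMap hψ
  · refine hh_socle_one_of (m := m) ?_ hmI ?_
    · intro k
      rw [hh_mem_inter, map_mul, rename_X]
      exact hmS _
    · intro p hp
      have hp0 : coeff 0 p = 0 := by
        have h1 := hom _ (hp 0) 1
        have h2 : rename (Fin.succ : Fin 3 → Fin 4) (homogeneousComponent 1 (X 0 * p)) = 0 := by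
          refine hI1 _ ?_ (hρ (homogeneousComponent_isHomogeneous 1 _))
          rw [rename_homogeneousComponent]
          exact h1
        have h3 : homogeneousComponent 1 (X 0 * p) = 0 :=
          rename_injective _ (Fin.succ_injective 3) (by rw [h2, map_zero])
        have h4 := congrArg (coeff (Finsupp.single 0 1)) h3
        rw [coeff_homogeneousComponent, if_pos (by simp), coeff_zero] at h4
        simpa [coeff_X_mul'] using h4
      obtain ⟨c, hc⟩ := hS (p := rename (Fin.succ : Fin 3 → Fin 4) p) (by
        intro k
        refine Fin.cases ?_ (fun k => ?_) k
        · exact hh_key0 hL hp0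
        · have := hp k
          rwa [hh_mem_inter, map_mul, rename_X] at this)
      refine ⟨c, ?_⟩
      rw [hh_mem_inter, map_sub, map_mul, rename_C]
      exact hc
  · rw [hJj]; exact one_ne_zero
  · intro i hi
    exact hh_hilb_zero_of fun p hp => top hi (hρ hp)
  · refine hh_hilb_one_of (isHomogeneous_one _ _) h1I ?_
    intro p hp
    obtain ⟨c, rfl⟩ := h0 hp
    exact ⟨c, by simp⟩
  · refine hh_hilb_one_of (isHomogeneous_one _ _) ?_ ?_
    · rw [hh_mem_inter, map_one]; exact h1I
    · intro p hp
      obtain ⟨c, rfl⟩ := h0 hp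
      exact ⟨c, by simp⟩
  · exact hh_hilb_one_of (hρ hm) hmI fun p hp => hSj hp
  · intro i hi hij
    rw [hJhilb]
    unfold hilb
    set B := (((homogeneousSubmodule (Fin 3) K i).map
        (Ideal.Quotient.mkₐ K (interR' I)).toLinearMap).map ψ.toLinearMap) with hB
    have hsup : (homogeneousSubmodule (Fin 4) K i).map (Ideal.Quotient.mkₐ K I).toLinearMap =
        B ⊔ Submodule.span K {Ideal.Quotient.mk I (X 0 ^ i)} := by
      apply le_antisymm
      · rintro _ ⟨p, hp, rfl⟩
        obtain ⟨f, hf, c, h⟩ := hh_decomp hL hp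
        have h2 := Ideal.Quotient.eq.2 h
        change Ideal.Quotient.mk I p ∈ _
        rw [h2, map_add]
        refine Submodule.add_mem_sup ⟨_, ⟨f, hf, rfl⟩, rfl⟩ ?_
        rw [Submodule.mem_span_singleton]
        refine ⟨c, ?_⟩
        rw [← smul_eq_C_mul]
        rfl
      · refine sup_le ?_ ?_
        · rintro _ ⟨_, ⟨f, hf, rfl⟩, rfl⟩
          exact ⟨_, hρ hf, rfl⟩
        · rw [Submodule.span_singleton_le_iff_mem]
          exact ⟨_, isHomogeneous_X_pow 0 i, rfl⟩
    have hdis : Disjoint B (Submodule.span K {Ideal.Quotient.mk I (X 0 ^ i)}) := by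
      rw [Submodule.disjoint_def]
      rintro _ ⟨_, ⟨f, hf, rfl⟩, rfl⟩ h
      rw [Submodule.mem_span_singleton] at h
      obtain ⟨c, hc⟩ := h
      have hmem : rename (Fin.succ : Fin 3 → Fin 4) f + C (-c) * X 0 ^ i ∈ I := by
        have : Ideal.Quotient.mk I (rename (Fin.succ : Fin 3 → Fin 4) f) =
            Ideal.Quotient.mk I (C c * X 0 ^ i) := by
          rw [← smul_eq_C_mul]
          exact hc.symm
        have h4 := Ideal.Quotient.eq.1 this
        convert h4 using 1
        rw [C_neg]; ring
      have := indep hi (by omega) hf hmem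
      rw [neg_eq_zero.1 this, zero_smul] at hc
      exact hc.symm
    have hone : Module.finrank K (Submodule.span K {Ideal.Quotient.mk I (X 0 ^ i)}) = 1 :=
      finrank_span_singleton
        (fun hh => wpow i (by omega) (Ideal.Quotient.eq_zero_iff_mem.1 hh))
    have := Submodule.finrank_sup_add_finrank_inf_eq B
      (Submodule.span K {Ideal.Quotient.mk I (X 0 ^ i)})
    rw [hdis.eq_bot, finrank_bot, hone, add_zero] at this
    rw [hsup, this]
  · obtain ⟨c, hc⟩ := hSj (isHomogeneous_X_pow 0 j)
    have hgI : X 0 ^ j - rename (Fin.succ : Fin 3 → Fin 4) (C c * m) ∈ I := by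
      rw [map_mul, rename_C]; exact hc
    have hg : (C c * m).IsHomogeneous j := hm.C_mul c
    set g := C c * m
    refine ⟨g, hg, ?_, ?_⟩
    · intro hg0
      rw [hg0, map_zero, sub_zero] at hgI
      exact wpow j le_rfl hgI
    set L := Ideal.map (rename (Fin.succ : Fin 3 → Fin 4)).toRingHom (interR' I) ⊔
        Ideal.span {X 0 * X 1, X 0 * X 2, X 0 * X 3,
          X 0 ^ j - rename (Fin.succ : Fin 3 → Fin 4) g} with hLdef
    have hLL : ∀ k : Fin 3, (X 0 * X k.succ : MvPolynomial (Fin 4) K) ∈ L := by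
      intro k
      apply Ideal.mem_sup_right
      apply Ideal.subset_span
      fin_cases k <;> simp
    have hLg : X 0 ^ j - rename (Fin.succ : Fin 3 → Fin 4) g ∈ L := by
      apply Ideal.mem_sup_right
      apply Ideal.subset_span
      simp
    have hLJ : ∀ f, rename (Fin.succ : Fin 3 → Fin 4) f ∈ I →
        rename (Fin.succ : Fin 3 → Fin 4) f ∈ L := by
      intro f hf
      apply Ideal.mem_sup_left
      exact Ideal.mem_map_of_mem (rename (Fin.succ : Fin 3 → Fin 4)).toRingHom
        (hh_mem_inter.2 hf)
    have hLI : L ≤ I := by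
      refine sup_le (Ideal.map_le_iff_le_comap.2 le_rfl) (Ideal.span_le.2 ?_)
      rintro p (rfl | rfl | rfl | rfl)
      · exact hL 0
      · exact hL 1
      · exact hL 2
      · exact hgI
    refine le_antisymm ?_ hLI
    intro p hp
    rw [← sum_homogeneousComponent p]
    refine L.sum_mem fun i _ => ?_
    have hpi := hom p hp i
    have hpih := homogeneousComponent_isHomogeneous i p
    generalize homogeneousComponent i p = q at hpi hpih
    by_cases hi0 : i = 0
    · subst hi0
      obtain ⟨c, rfl⟩ := h0 hpih
      rw [hconst c hpi, C_0]; exact L.zero_mem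
    obtain ⟨f, hf, c, h⟩ := hh_decomp hLL hpih
    suffices hs : rename (Fin.succ : Fin 3 → Fin 4) f + C c * X 0 ^ i ∈ L by
      have := L.add_mem h hs
      rwa [sub_add_cancel] at this
    have hfI : rename (Fin.succ : Fin 3 → Fin 4) f + C c * X 0 ^ i ∈ I := by
      have := I.sub_mem hpi (hLI h)
      rwa [sub_sub_cancel] at this
    rcases lt_trichotomy i j with hij | rfl | hij
    · have hc0 := indep (by omega) hij hf hfI
      rw [hc0, C_0, zero_mul, add_zero] at hfI ⊢
      exact hLJ f hfI
    · have h1 : rename (Fin.succ : Fin 3 → Fin 4) (f + C c * g) ∈ L := by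
        apply hLJ
        have := I.sub_mem hfI (I.mul_mem_left (C c) hgI)
        convert this using 1
        rw [map_add, map_mul, rename_C]; ring
      have := L.add_mem h1 (L.mul_mem_left (C c) hLg)
      convert this using 1
      rw [map_add, map_mul, rename_C]; ring
    · obtain ⟨e, rfl⟩ := Nat.exists_eq_add_of_lt hij
      refine L.add_mem (hLJ f (top hij (hρ hf))) (L.mul_mem_left _ ?_)
      have h1 := L.mul_mem_left (X 0 ^ (e + 1)) hLg
      have h2 := L.mul_mem_left (X 0 ^ e) (hh_key0 hLL (hh_coeff0 hg (by omega)))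
      convert L.add_mem h1 h2 using 1
      ring

end
end

section
/- Let j ≥ 4 and let H = (h_0, …, h_j) be a sequence with h_0 = h_j = 1, h_1 = 4, h_2 = 7. There exists a graded Artinian Gorenstein quotient A = R/I of R = K[w,x,y,z] with Hilbert function H and with I_2 = span{wx, wy, wz} if and only if the sequence H' defined by h'_0 = 1, h'_i = h_i − 1 for 1 ≤ i ≤ j−1, and h'_j = 1 is the Hilbert function of some graded Artinian Gorenstein quotient of K[x,y,z] (a height three Gorenstein sequence). -/
open MvPolynomial

noncomputable section

/-! ### Generic lemmas -/

theorem hilb_eq_finrank_map {n : ℕ} {K : Type*} [Field K] (I : Ideal (MvPolynomial (Fin n) K))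
    {V : Type*} [AddCommGroup V] [Module K V] (L : MvPolynomial (Fin n) K →ₗ[K] V)
    (hL : ∀ F, L F = 0 ↔ F ∈ I) (i : ℕ) :
    hilb n K I i = Module.finrank K ((homogeneousSubmodule (Fin n) K i).map L) := by
  let L' : (MvPolynomial (Fin n) K ⧸ I) →ₗ[K] V :=
    { toFun := Quotient.lift (fun F => L F) (by
        intro a b hab
        have h1 : a - b ∈ I := (Submodule.quotientRel_def I).1 hab
        have h2 := (hL _).2 h1
        rw [map_sub, sub_eq_zero] at h2
        exact h2)
      map_add' := by
        rintro ⟨a⟩ ⟨b⟩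
        exact map_add L a b
      map_smul' := by
        rintro c ⟨a⟩
        exact map_smul L c a }
  have hcomp : L = L' ∘ₗ (Ideal.Quotient.mkₐ K I).toLinearMap := by
    ext F; rfl
  have hinj : Function.Injective L' := by
    rw [← LinearMap.ker_eq_bot, LinearMap.ker_eq_bot']
    rintro ⟨a⟩ ha
    exact Ideal.Quotient.eq_zero_iff_mem.2 ((hL a).1 ha)
  rw [hcomp, Submodule.map_comp]
  exact (Submodule.equivMapOfInjective L' hinj _).finrank_eq

theorem finiteDimensional_of_map {n : ℕ} {K : Type*} [Field K]
    (I : Ideal (MvPolynomial (Fin n) K))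
    {V : Type*} [AddCommGroup V] [Module K V] [FiniteDimensional K V]
    (L : MvPolynomial (Fin n) K →ₗ[K] V)
    (hL : ∀ F, L F = 0 ↔ F ∈ I) : FiniteDimensional K (MvPolynomial (Fin n) K ⧸ I) := by
  let L' : (MvPolynomial (Fin n) K ⧸ I) →ₗ[K] V :=
    { toFun := Quotient.lift (fun F => L F) (by
        intro a b hab
        have h1 : a - b ∈ I := (Submodule.quotientRel_def I).1 hab
        have h2 := (hL _).2 h1
        rw [map_sub, sub_eq_zero] at h2
        exact h2)
      map_add' := by
        rintro ⟨a⟩ ⟨b⟩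
        exact map_add L a b
      map_smul' := by
        rintro c ⟨a⟩
        exact map_smul L c a }
  have hinj : Function.Injective L' := by
    rw [← LinearMap.ker_eq_bot, LinearMap.ker_eq_bot']
    rintro ⟨a⟩ ha
    exact Ideal.Quotient.eq_zero_iff_mem.2 ((hL a).1 ha)
  exact FiniteDimensional.of_injective L' hinj

theorem hilb_eq_zero_iff {n : ℕ} {K : Type*} [Field K] (I : Ideal (MvPolynomial (Fin n) K))
    [FiniteDimensional K (MvPolynomial (Fin n) K ⧸ I)] (i : ℕ) :
    hilb n K I i = 0 ↔ ∀ F, F.IsHomogeneous i → F ∈ I := by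
  unfold hilb
  rw [Submodule.finrank_eq_zero, ← le_bot_iff, Submodule.map_le_iff_le_comap]
  constructor
  · intro h F hF
    have := h ((mem_homogeneousSubmodule i F).2 hF)
    exact Ideal.Quotient.eq_zero_iff_mem.1 (LinearMap.mem_ker.1 this)
  · intro h F hF
    exact LinearMap.mem_ker.2 (Ideal.Quotient.eq_zero_iff_mem.2 (h F ((mem_homogeneousSubmodule i F).1 hF)))

theorem hilb_eq_one {n : ℕ} {K : Type*} [Field K] (I : Ideal (MvPolynomial (Fin n) K)) (i : ℕ)
    (u : MvPolynomial (Fin n) K) (hu : u.IsHomogeneous i) (huI : u ∉ I)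
    (hspan : ∀ a : MvPolynomial (Fin n) K, a.IsHomogeneous i → ∃ c : K, a - C c * u ∈ I) :
    hilb n K I i = 1 := by
  unfold hilb
  have : (homogeneousSubmodule (Fin n) K i).map (Ideal.Quotient.mkₐ K I).toLinearMap
      = Submodule.span K {Ideal.Quotient.mk I u} := by
    apply le_antisymm
    · rintro _ ⟨a, ha, rfl⟩
      obtain ⟨c, hc⟩ := hspan a ha
      rw [Submodule.mem_span_singleton]
      refine ⟨c, ?_⟩
      have := Ideal.Quotient.eq.2 hc
      rw [← smul_eq_C_mul] at this
      exact this.symm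
    · rw [Submodule.span_singleton_le_iff_mem]
      exact ⟨u, hu, rfl⟩
  rw [this]
  apply finrank_span_singleton
  rwa [Ne, Ideal.Quotient.eq_zero_iff_mem]

theorem mem_socleSub {n : ℕ} {K : Type*} [Field K] (I : Ideal (MvPolynomial (Fin n) K))
    (a : MvPolynomial (Fin n) K) :
    Ideal.Quotient.mk I a ∈ socleSub n K I ↔ ∀ k, X k * a ∈ I := by
  unfold socleSub
  simp only [Submodule.mem_iInf, LinearMap.mem_ker, LinearMap.mulLeft_apply, ← map_mul,
    Ideal.Quotient.eq_zero_iff_mem]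

theorem socle_finrank_one {n : ℕ} {K : Type*} [Field K] (I : Ideal (MvPolynomial (Fin n) K))
    (u : MvPolynomial (Fin n) K) (huI : u ∉ I) (hus : ∀ k, X k * u ∈ I)
    (hspan : ∀ a : MvPolynomial (Fin n) K, (∀ k, X k * a ∈ I) → ∃ c : K, a - C c * u ∈ I) :
    Module.finrank K (socleSub n K I) = 1 := by
  have : socleSub n K I = Submodule.span K {Ideal.Quotient.mk I u} := by
    apply le_antisymm
    · intro b hb
      obtain ⟨a, rfl⟩ := Ideal.Quotient.mk_surjective b
      obtain ⟨c, hc⟩ := hspan a ((mem_socleSub I a).1 hb)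
      rw [Submodule.mem_span_singleton]
      refine ⟨c, ?_⟩
      have := Ideal.Quotient.eq.2 hc
      rw [← smul_eq_C_mul] at this
      exact this.symm
    · rw [Submodule.span_singleton_le_iff_mem]
      exact (mem_socleSub I u).2 hus
  rw [this]
  apply finrank_span_singleton
  rwa [Ne, Ideal.Quotient.eq_zero_iff_mem]

/-- Structure of a graded AG quotient. -/
theorem IsAG.struct_facts {n : ℕ} {K : Type*} [Field K] {I : Ideal (MvPolynomial (Fin n) K)} {j : ℕ}
    (hI : IsAG n K I j) :
    (∀ i, j < i → ∀ F, F.IsHomogeneous i → F ∈ I) ∧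
    ∃ u : MvPolynomial (Fin n) K, u.IsHomogeneous j ∧ u ∉ I ∧ (∀ k, X k * u ∈ I) ∧
      ∀ a : MvPolynomial (Fin n) K, (∀ k, X k * a ∈ I) → ∃ c : K, a - C c * u ∈ I := by
  obtain ⟨hh, hfd, hs, hj, hz⟩ := hI
  have hdeg : ∀ i, j < i → ∀ F, F.IsHomogeneous i → F ∈ I :=
    fun i hi => (hilb_eq_zero_iff I i).1 (hz i hi)
  refine ⟨hdeg, ?_⟩
  have hne : ¬ ∀ F, F.IsHomogeneous j → F ∈ I := fun h => hj ((hilb_eq_zero_iff I j).2 h)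
  push Not at hne
  obtain ⟨u, hu, huI⟩ := hne
  have hus : ∀ k, X k * u ∈ I := fun k =>
    hdeg (1 + j) (by omega) _ ((isHomogeneous_X K k).mul hu)
  refine ⟨u, hu, huI, hus, fun a ha => ?_⟩
  have hu0 : (⟨Ideal.Quotient.mk I u, (mem_socleSub I u).2 hus⟩ : socleSub n K I) ≠ 0 := by
    intro h
    exact huI (Ideal.Quotient.eq_zero_iff_mem.1 (congrArg Subtype.val h))
  obtain ⟨c, hc⟩ := (finrank_eq_one_iff_of_nonzero' _ hu0).1 hs
    ⟨Ideal.Quotient.mk I a, (mem_socleSub I a).2 ha⟩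
  refine ⟨c, Ideal.Quotient.eq.1 ?_⟩
  rw [← smul_eq_C_mul]
  exact (congrArg Subtype.val hc).symm

theorem IsAG.hilb_top {n : ℕ} {K : Type*} [Field K] {I : Ideal (MvPolynomial (Fin n) K)} {j : ℕ}
    (hI : IsAG n K I j) : hilb n K I j = 1 := by
  obtain ⟨hdeg, u, hu, huI, -, hspan⟩ := hI.struct_facts
  exact hilb_eq_one I j u hu huI fun a ha => hspan a fun k =>
    hdeg (1 + j) (by omega) _ ((isHomogeneous_X K k).mul ha)

theorem hilb_zero {n : ℕ} {K : Type*} [Field K] {I : Ideal (MvPolynomial (Fin n) K)}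
    (hI : (1 : MvPolynomial (Fin n) K) ∉ I) : hilb n K I 0 = 1 := by
  refine hilb_eq_one I 0 1 (isHomogeneous_one _ _) hI fun a ha => ?_
  rw [← totalDegree_zero_iff_isHomogeneous, totalDegree_eq_zero_iff_eq_C] at ha
  exact ⟨coeff 0 a, by rw [mul_one, ← ha, sub_self]; exact I.zero_mem⟩

theorem IsAG.socle_degree {n : ℕ} {K : Type*} [Field K] {I : Ideal (MvPolynomial (Fin n) K)}
    {j : ℕ} (hI : IsAG n K I j) {i : ℕ} (hij : i ≠ j) (a : MvPolynomial (Fin n) K)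
    (ha : a.IsHomogeneous i) (hs : ∀ k, X k * a ∈ I) : a ∈ I := by
  obtain ⟨hdeg, u, hu, huI, -, hspan⟩ := hI.struct_facts
  obtain ⟨c, hc⟩ := hspan a hs
  have := hI.1 _ hc i
  rwa [map_sub, homogeneousComponent_C_mul, homogeneousComponent_eq_self ha,
    homogeneousComponent_of_mem ((mem_homogeneousSubmodule j u).2 hu), if_neg hij, mul_zero,
    sub_zero] at this

/-! ### From three to four variables -/

/-- The inclusion `K[x,y,z] → K[w,x,y,z]`. -/
abbrev ren (K : Type*) [Field K] : MvPolynomial (Fin 3) K →ₐ[K] MvPolynomial (Fin 4) K :=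
  rename Fin.succ

/-- The projection `w ↦ 0`. -/
abbrev prj (K : Type*) [Field K] : MvPolynomial (Fin 4) K →ₐ[K] MvPolynomial (Fin 3) K :=
  aeval (Fin.cons 0 X)

theorem prj_ren {K : Type*} [Field K] (g : MvPolynomial (Fin 3) K) : prj K (ren K g) = g := by
  unfold prj ren
  rw [aeval_rename]
  have : (Fin.cons 0 X : Fin 4 → MvPolynomial (Fin 3) K) ∘ Fin.succ = X := by
    ext1 k; simp
  rw [this]; simp

theorem prj_homog {K : Type*} [Field K] {F : MvPolynomial (Fin 4) K} {i : ℕ}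
    (hF : F.IsHomogeneous i) : (prj K F).IsHomogeneous i := by
  have := hF.aeval (Fin.cons 0 X : Fin 4 → MvPolynomial (Fin 3) K) (n := 1) (by
    intro k
    refine Fin.cases ?_ (fun k => ?_) k
    · exact isHomogeneous_zero _ _ _
    · exact isHomogeneous_X _ _)
  rwa [one_mul] at this

theorem decomp {K : Type*} [Field K] (P : Submodule K (MvPolynomial (Fin 4) K)) (i : ℕ)
    (hP : ∀ d : Fin 4 →₀ ℕ, d.degree = i → d 0 ≠ 0 → (∃ k : Fin 3, d k.succ ≠ 0) →
      monomial d (1 : K) ∈ P)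
    (F : MvPolynomial (Fin 4) K) (hF : F.IsHomogeneous i) :
    ∃ g : MvPolynomial (Fin 3) K, g.IsHomogeneous i ∧ ∃ c : K,
      F - ren K g - C c * X 0 ^ i ∈ P := by
  let Q : Submodule K (MvPolynomial (Fin 4) K) :=
    (homogeneousSubmodule (Fin 3) K i).map (ren K).toLinearMap ⊔
      (Submodule.span K {X 0 ^ i} ⊔ P)
  have hQ : F ∈ Q := by
    rw [F.as_sum]
    refine Submodule.sum_mem _ fun d hd => ?_
    have hdeg : d.degree = i := by
      by_contra h
      exact (mem_support_iff.1 hd) (hF.coeff_eq_zero h)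
    have : monomial d (coeff d F) = coeff d F • monomial d (1 : K) := by
      rw [smul_monomial, smul_eq_mul, mul_one]
    rw [this]
    refine Submodule.smul_mem _ _ ?_
    by_cases h0 : d 0 = 0
    · refine Submodule.mem_sup_left ⟨monomial (Finsupp.tail d) 1, ?_, ?_⟩
      · refine isHomogeneous_monomial _ ?_
        rw [← hdeg, Finsupp.degree_eq_sum, Finsupp.degree_eq_sum,
          Fin.sum_univ_succ (n := 3) (fun k => d k), h0, zero_add]
        rfl
      · change rename Fin.succ (monomial (Finsupp.tail d) 1) = _
        rw [rename_monomial]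
        refine congrArg (fun e => monomial e (1 : K)) ?_
        ext k
        refine Fin.cases ?_ (fun k => ?_) k
        · rw [h0, Finsupp.mapDomain_of_notMem_range]
          simp [Fin.succ_ne_zero]
        · rw [Finsupp.mapDomain_apply (Fin.succ_injective _)]
          rfl
    · by_cases hk : ∃ k : Fin 3, d k.succ ≠ 0
      · exact Submodule.mem_sup_right (Submodule.mem_sup_right (hP d hdeg h0 hk))
      · refine Submodule.mem_sup_right (Submodule.mem_sup_left ?_)
        push Not at hk
        rw [Submodule.mem_span_singleton]
        refine ⟨1, ?_⟩
        rw [one_smul, X_pow_eq_monomial]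
        refine congrArg (fun e => monomial e (1 : K)) ?_
        have h0i : d 0 = i := by
          rw [← hdeg, Finsupp.degree_eq_sum, Fin.sum_univ_succ]
          simp [hk]
        ext k
        refine Fin.cases ?_ (fun k => ?_) k
        · simp [h0i]
        · rw [hk k, Finsupp.single_apply, if_neg (Fin.succ_ne_zero k).symm]
  obtain ⟨a, ⟨g, hg, rfl⟩, b, hb, rfl⟩ := Submodule.mem_sup.1 hQ
  obtain ⟨b1, hb1, p, hp, rfl⟩ := Submodule.mem_sup.1 hb
  obtain ⟨c, rfl⟩ := Submodule.mem_span_singleton.1 hb1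
  refine ⟨g, hg, c, ?_⟩
  rw [← smul_eq_C_mul]
  convert hp using 1
  change ren K g + _ - ren K g - _ = _
  abel

theorem mixed_mem {K : Type*} [Field K] (I : Ideal (MvPolynomial (Fin 4) K))
    (hI : ∀ k : Fin 3, X 0 * X k.succ ∈ I) (d : Fin 4 →₀ ℕ) (h0 : d 0 ≠ 0)
    (hk : ∃ k : Fin 3, d k.succ ≠ 0) : monomial d (1 : K) ∈ I := by
  obtain ⟨k, hk⟩ := hk
  refine I.mem_of_dvd ?_ (hI k)
  have : (X 0 * X k.succ : MvPolynomial (Fin 4) K)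
      = monomial (Finsupp.single 0 1 + Finsupp.single k.succ 1) 1 := by
    rw [X, X, monomial_mul, one_mul]
  rw [this, monomial_dvd_monomial]
  refine ⟨Or.inr ?_, dvd_refl _⟩
  intro l
  rw [Finsupp.add_apply, Finsupp.single_apply, Finsupp.single_apply]
  have := Fin.succ_ne_zero k
  split_ifs with h1 h2 h2
  · exact absurd (h2.trans h1.symm) this
  · subst h1; omega
  · subst h2; omega
  · omega

theorem w_mul_ren {K : Type*} [Field K] (I : Ideal (MvPolynomial (Fin 4) K))
    (hI : ∀ k : Fin 3, X 0 * X k.succ ∈ I) (g : MvPolynomial (Fin 3) K)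
    (hg : constantCoeff g = 0) : X 0 * ren K g ∈ I := by
  have key : ∀ g : MvPolynomial (Fin 3) K, X 0 * ren K (g - C (constantCoeff g)) ∈ I := by
    intro g
    induction g using MvPolynomial.induction_on with
    | C a => simp
    | add p q hp hq =>
      have := I.add_mem hp hq
      rw [← mul_add, ← map_add] at this
      convert this using 3
      rw [map_add, map_add]; ring
    | mul_X p k _ =>
      have : X 0 * ren K (p * X k - C (constantCoeff (p * X k)))
          = ren K p * (X 0 * X k.succ) := by
        simp; ring
      rw [this]
      exact I.mul_mem_left _ (hI k)
  have := key g
  rwa [hg, C_0, sub_zero] at this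

theorem constantCoeff_of_homog {n : ℕ} {K : Type*} [Field K] {g : MvPolynomial (Fin n) K} {i : ℕ}
    (hg : g.IsHomogeneous i) (hi : i ≠ 0) : constantCoeff g = 0 := by
  rw [constantCoeff_eq]
  exact hg.coeff_eq_zero (by simpa using hi.symm)

theorem hilb_succ {K : Type*} [Field K] (I : Ideal (MvPolynomial (Fin 4) K))
    (I' : Ideal (MvPolynomial (Fin 3) K)) [FiniteDimensional K (MvPolynomial (Fin 4) K ⧸ I)]
    (hI : ∀ k : Fin 3, X 0 * X k.succ ∈ I) (hcomap : ∀ g, g ∈ I' ↔ ren K g ∈ I)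
    (i : ℕ)
    (hind : ∀ g : MvPolynomial (Fin 3) K, g.IsHomogeneous i →
      ∀ c : K, ren K g + C c * X 0 ^ i ∈ I → c = 0) :
    hilb 4 K I i = hilb 3 K I' i + 1 := by
  let M : MvPolynomial (Fin 4) K →ₗ[K] (MvPolynomial (Fin 4) K ⧸ I) :=
    (Ideal.Quotient.mkₐ K I).toLinearMap
  have hM : ∀ F, M F = 0 ↔ F ∈ I := fun F => Ideal.Quotient.eq_zero_iff_mem
  let L : MvPolynomial (Fin 3) K →ₗ[K] (MvPolynomial (Fin 4) K ⧸ I) :=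
    M ∘ₗ (ren K).toLinearMap
  rw [hilb_eq_finrank_map I' L (fun g => (hM _).trans (hcomap g).symm)]
  have hw : M (X 0 ^ i) ≠ 0 := by
    rw [Ne, hM]
    intro h
    have := hind 0 (isHomogeneous_zero _ _ _) 1 (by simpa using h)
    exact one_ne_zero this
  have hsup : (homogeneousSubmodule (Fin 4) K i).map M =
      (homogeneousSubmodule (Fin 3) K i).map L ⊔ Submodule.span K {M (X 0 ^ i)} := by
    apply le_antisymm
    · rintro _ ⟨F, hF, rfl⟩
      obtain ⟨g, hg, c, hc⟩ := decomp (I.restrictScalars K) i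
        (fun d _ h0 hk => mixed_mem I hI d h0 hk) F hF
      have h1 := (hM _).2 hc
      rw [← smul_eq_C_mul, map_sub, map_sub, map_smul, sub_sub, sub_eq_zero] at h1
      rw [h1]
      exact Submodule.add_mem_sup ⟨g, hg, rfl⟩
        (Submodule.smul_mem _ _ (Submodule.mem_span_singleton_self _))
    · refine sup_le ?_ ?_
      · rintro _ ⟨g, hg, rfl⟩
        exact ⟨ren K g, IsHomogeneous.rename_isHomogeneous hg, rfl⟩
      · rw [Submodule.span_singleton_le_iff_mem]
        exact ⟨_, isHomogeneous_X_pow _ _, rfl⟩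
  have hinf : (homogeneousSubmodule (Fin 3) K i).map L ⊓ Submodule.span K {M (X 0 ^ i)} = ⊥ := by
    rw [eq_bot_iff]
    rintro _ ⟨⟨g, hg, rfl⟩, hb⟩
    obtain ⟨c, hc⟩ := Submodule.mem_span_singleton.1 hb
    have : c = 0 := by
      have h2 := hind g hg (-c) (by
        rw [← hM, ← smul_eq_C_mul, map_add, map_smul, neg_smul, hc]
        exact add_neg_cancel _)
      simpa using h2
    rw [this, zero_smul] at hc
    exact hc.symm
  have h := Submodule.finrank_sup_add_finrank_inf_eq
    ((homogeneousSubmodule (Fin 3) K i).map L) (Submodule.span K {M (X 0 ^ i)})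
  rw [hinf, finrank_bot, add_zero, ← hsup, finrank_span_singleton hw] at h
  exact h

theorem finrank_deg_two {K : Type*} [Field K] :
    Module.finrank K (homogeneousSubmodule (Fin 3) K 2) ≤ 6 := by
  let v : Fin 6 → MvPolynomial (Fin 3) K :=
    ![X 0 * X 0, X 0 * X 1, X 0 * X 2, X 1 * X 1, X 1 * X 2, X 2 * X 2]
  have h : homogeneousSubmodule (Fin 3) K 2 ≤ Submodule.span K (Set.range v) := by
    rw [← homogeneousSubmodule_one_pow, homogeneousSubmodule_one_eq_span_X, pow_two,
      Submodule.span_mul_span, Submodule.span_le]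
    rintro _ ⟨_, ⟨a, rfl⟩, _, ⟨b, rfl⟩, rfl⟩
    apply Submodule.subset_span
    fin_cases a <;> fin_cases b
    · exact ⟨0, rfl⟩
    · exact ⟨1, rfl⟩
    · exact ⟨2, rfl⟩
    · exact ⟨1, mul_comm _ _⟩
    · exact ⟨3, rfl⟩
    · exact ⟨4, rfl⟩
    · exact ⟨2, mul_comm _ _⟩
    · exact ⟨4, mul_comm _ _⟩
    · exact ⟨5, rfl⟩
  have : FiniteDimensional K (Submodule.span K (Set.range v)) :=
    FiniteDimensional.span_of_finite K (Set.finite_range v)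
  exact (Submodule.finrank_mono h).trans (finrank_range_le_card v)

theorem deg_two_zero {K : Type*} [Field K] (I' : Ideal (MvPolynomial (Fin 3) K))
    (h6 : hilb 3 K I' 2 = 6) (g : MvPolynomial (Fin 3) K) (hg : g.IsHomogeneous 2)
    (hgI : g ∈ I') : g = 0 := by
  have : FiniteDimensional K (homogeneousSubmodule (Fin 3) K 2) :=
    Module.Finite.iff_fg.2 (homogeneousSubmodule_fg _ _ 2)
  let f := (Ideal.Quotient.mkₐ K I').toLinearMap.domRestrict (homogeneousSubmodule (Fin 3) K 2)
  have hr : Module.finrank K (LinearMap.range f) = 6 := by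
    rw [LinearMap.range_domRestrict]; exact h6
  have h1 := LinearMap.finrank_range_add_finrank_ker f
  have h2 := finrank_deg_two (K := K)
  have h3 : Module.finrank K (LinearMap.ker f) = 0 := by omega
  rw [Submodule.finrank_eq_zero, LinearMap.ker_eq_bot'] at h3
  have := h3 ⟨g, hg⟩ (Ideal.Quotient.eq_zero_iff_mem.2 hgI)
  exact congrArg Subtype.val this

/-! ### From four variables to three -/

theorem forward {K : Type*} [Field K] (j : ℕ) (hj : 4 ≤ j)
    (I : Ideal (MvPolynomial (Fin 4) K)) (hAG : IsAG 4 K I j)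
    (hI2 : Submodule.restrictScalars K I ⊓ homogeneousSubmodule (Fin 4) K 2 =
        Submodule.span K {X 0 * X 1, X 0 * X 2, X 0 * X 3}) :
    ∃ I' : Ideal (MvPolynomial (Fin 3) K), IsAG 3 K I' j ∧
      hilb 3 K I' 0 = 1 ∧ hilb 3 K I' j = 1 ∧
      ∀ i, 1 ≤ i → i ≤ j - 1 → hilb 4 K I i = hilb 3 K I' i + 1 := by
  have hfd : FiniteDimensional K (MvPolynomial (Fin 4) K ⧸ I) := hAG.2.1
  have hI : ∀ k : Fin 3, X 0 * X k.succ ∈ I := by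
    intro k
    have : (X 0 * X k.succ : MvPolynomial (Fin 4) K) ∈
        Submodule.restrictScalars K I ⊓ homogeneousSubmodule (Fin 4) K 2 := by
      rw [hI2]
      apply Submodule.subset_span
      fin_cases k <;> simp
    exact this.1
  -- squares of variables are not in `I`
  have hsq : ∀ k : Fin 4, (X k * X k : MvPolynomial (Fin 4) K) ∉ I := by
    intro k hk
    have h1 : (X k * X k : MvPolynomial (Fin 4) K) ∈
        Submodule.restrictScalars K I ⊓ homogeneousSubmodule (Fin 4) K 2 :=
      ⟨hk, (isHomogeneous_X K k).mul (isHomogeneous_X K k)⟩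
    rw [hI2] at h1
    have h2 : Submodule.span K {X 0 * X 1, X 0 * X 2, X 0 * X 3} ≤
        LinearMap.ker (aeval (R := K) (fun l : Fin 4 => if l = k then (1 : K) else 0)).toLinearMap := by
      rw [Submodule.span_le]
      rintro _ (rfl | rfl | rfl) <;> fin_cases k <;> simp
    have h3 := h2 h1
    simp at h3
  have hX : ∀ k : Fin 4, (X k : MvPolynomial (Fin 4) K) ∉ I := fun k hk =>
    hsq k (I.mul_mem_left _ hk)
  -- powers of `w`
  have hwp : ∀ i, i + 1 ≤ j → (X 0 ^ (i + 1) : MvPolynomial (Fin 4) K) ∉ I := by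
    intro i
    induction i with
    | zero => intro _; simpa using hX 0
    | succ i ih =>
      intro hi hmem
      refine ih (by omega) (hAG.socle_degree (i := i + 1) (by omega) _
        (isHomogeneous_X_pow _ _) fun k => ?_)
      refine Fin.cases ?_ (fun k => ?_) k
      · rwa [← pow_succ']
      · have : (X k.succ * X 0 ^ (i + 1) : MvPolynomial (Fin 4) K)
          = X 0 ^ i * (X 0 * X k.succ) := by ring
        rw [this]
        exact I.mul_mem_left _ (hI k)
  let I' : Ideal (MvPolynomial (Fin 3) K) := I.comap (ren K)
  have hcomap : ∀ g, g ∈ I' ↔ ren K g ∈ I := fun g => Ideal.mem_comap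
  have hX' : ∀ k : Fin 3, (X k : MvPolynomial (Fin 3) K) ∉ I' := by
    intro k hk
    rw [hcomap, rename_X] at hk
    exact hX _ hk
  have h1' : (1 : MvPolynomial (Fin 3) K) ∉ I' := by
    intro h
    exact hX' 0 (by simpa using I'.mul_mem_left (X 0) h)
  let L : MvPolynomial (Fin 3) K →ₗ[K] (MvPolynomial (Fin 4) K ⧸ I) :=
    (Ideal.Quotient.mkₐ K I).toLinearMap ∘ₗ (ren K).toLinearMap
  have hL : ∀ g, L g = 0 ↔ g ∈ I' := fun g =>
    Ideal.Quotient.eq_zero_iff_mem.trans (hcomap g).symm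
  have hfd' : FiniteDimensional K (MvPolynomial (Fin 3) K ⧸ I') := finiteDimensional_of_map I' L hL
  have hhom' : IdealHomog I' := by
    intro f hf d
    rw [hcomap] at hf ⊢
    have := hAG.1 _ hf d
    rwa [← rename_homogeneousComponent] at this
  obtain ⟨hdeg, u, hu, huI, hus, hspan⟩ := hAG.struct_facts
  have hdeg' : ∀ i, j < i → ∀ g : MvPolynomial (Fin 3) K, g.IsHomogeneous i → g ∈ I' := by
    intro i hi g hg
    exact (hcomap g).2 (hdeg i hi _ (IsHomogeneous.rename_isHomogeneous hg))
  -- lifting the socle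
  have hlift : ∀ g : MvPolynomial (Fin 3) K, constantCoeff g = 0 → (∀ k, X k * g ∈ I') →
      ∀ k, X k * ren K g ∈ I := by
    intro g hg0 hg k
    refine Fin.cases ?_ (fun k => ?_) k
    · exact w_mul_ren I hI g hg0
    · have := (hcomap _).1 (hg k)
      rwa [map_mul, rename_X] at this
  -- a nonzero element in degree `j`
  have hne : ¬ ∀ g : MvPolynomial (Fin 3) K, g.IsHomogeneous j → g ∈ I' := by
    intro hall
    have hdown : ∀ t, t + 1 ≤ j → ∀ g : MvPolynomial (Fin 3) K, g.IsHomogeneous (j - t) →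
        g ∈ I' := by
      intro t
      induction t with
      | zero => intro _ g hg; exact hall g hg
      | succ t ih =>
        intro ht g hg
        rw [hcomap]
        refine hAG.socle_degree (i := j - (t + 1)) (by omega) _
          (IsHomogeneous.rename_isHomogeneous hg)
          (hlift g (constantCoeff_of_homog hg (by omega)) fun k => ih (by omega) _ ?_)
        have := (isHomogeneous_X K k).mul hg
        convert this using 1
        omega
    refine hX' 0 (hdown (j - 1) (by omega) _ ?_)
    have : j - (j - 1) = 1 := by omega
    rw [this]
    exact isHomogeneous_X _ _
  have hAG' : IsAG 3 K I' j := by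
    refine ⟨hhom', hfd', ?_, ?_, ?_⟩
    · have hne' := hne
      push Not at hne'
      obtain ⟨v, hv, hvI⟩ := hne'
      have hvs : ∀ k, X k * v ∈ I' := fun k =>
        hdeg' (1 + j) (by omega) _ ((isHomogeneous_X K k).mul hv)
      obtain ⟨c, hc⟩ := hspan _ (hlift v (constantCoeff_of_homog hv (by omega)) hvs)
      have hc0 : c ≠ 0 := by
        rintro rfl
        rw [C_0, zero_mul, sub_zero] at hc
        exact hvI ((hcomap v).2 hc)
      refine socle_finrank_one I' v hvI hvs fun a ha => ?_
      have ha0 : constantCoeff a = 0 := by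
        have h1 := hhom' _ (ha 0) 1
        have h2 : homogeneousComponent 1 (X 0 * a) = C (constantCoeff a) * X 0 := by
          conv_lhs => rw [← sub_add_cancel a (C (constantCoeff a))]
          ext d
          rw [coeff_homogeneousComponent]
          split_ifs with hd
          · rw [mul_add, coeff_add, mul_comm (X 0) (C _), add_eq_right,
              coeff_X_mul']
            split_ifs with hd0
            · have : d - Finsupp.single 0 1 = 0 := by
                have hle : Finsupp.single (0 : Fin 3) 1 ≤ d := by
                  rw [Finsupp.single_le_iff]
                  rw [Finsupp.mem_support_iff] at hd0
                  omega
                have h3 := congrArg Finsupp.degree (tsub_add_cancel_of_le hle)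
                rw [map_add, Finsupp.degree_single, hd] at h3
                exact (Finsupp.degree_eq_zero_iff _).1 (by omega)
              rw [this, coeff_sub, coeff_zero_C, constantCoeff_eq, sub_self]
            · rfl
          · symm
            exact ((isHomogeneous_X K (0 : Fin 3)).C_mul _).coeff_eq_zero hd
        rw [h2] at h1
        by_contra hne0
        apply hX' 0
        have := I'.mul_mem_left (C (constantCoeff a)⁻¹) h1
        rwa [← mul_assoc, ← C_mul, inv_mul_cancel₀ hne0, C_1, one_mul] at this
      obtain ⟨b, hb⟩ := hspan _ (hlift a ha0 ha)
      refine ⟨b * c⁻¹, ?_⟩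
      rw [hcomap]
      have h4 := I.sub_mem hb (I.mul_mem_left (C (b * c⁻¹)) hc)
      have h5 : C b = C (b * c⁻¹) * (C c : MvPolynomial (Fin 4) K) := by
        rw [← C_mul, mul_assoc, inv_mul_cancel₀ hc0, mul_one]
      convert h4 using 1
      rw [h5, map_sub, map_mul, rename_C]
      ring
    · intro h
      exact hne ((hilb_eq_zero_iff I' j).1 h)
    · intro i hi
      exact (hilb_eq_zero_iff I' i).2 (hdeg' i hi)
  refine ⟨I', hAG', hilb_zero h1', hAG'.hilb_top, fun i hi1 hij => ?_⟩
  refine hilb_succ I I' hI hcomap i fun g hg c hc => ?_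
  by_contra hc0
  have h1 := I.mul_mem_left (X 0) hc
  rw [mul_add] at h1
  have h2 := (I.add_mem_iff_right
    (w_mul_ren I hI g (constantCoeff_of_homog hg (by omega)))).1 h1
  have h3 := I.mul_mem_left (C c⁻¹) h2
  have h4 : (C c⁻¹ * (X 0 * (C c * X 0 ^ i)) : MvPolynomial (Fin 4) K) = X 0 ^ (i + 1) := by
    have : (C c⁻¹ * (X 0 * (C c * X 0 ^ i)) : MvPolynomial (Fin 4) K)
      = C (c⁻¹ * c) * X 0 ^ (i + 1) := by rw [C_mul]; ring
    rw [this, inv_mul_cancel₀ hc0, C_1, one_mul]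
  rw [h4] at h3
  exact hwp i (by omega) h3

/-! ### The connected sum -/

theorem prj_homogeneousComponent {K : Type*} [Field K] (F : MvPolynomial (Fin 4) K) (d : ℕ) :
    homogeneousComponent d (prj K F) = prj K (homogeneousComponent d F) := by
  conv_lhs => rw [← sum_homogeneousComponent F, map_sum, map_sum]
  have : ∀ e, homogeneousComponent d (prj K (homogeneousComponent e F)) =
      if d = e then prj K (homogeneousComponent d F) else 0 := by
    intro e
    rw [homogeneousComponent_of_mem ((mem_homogeneousSubmodule e _).2
      (prj_homog (homogeneousComponent_isHomogeneous e F)))]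
    split_ifs with h
    · rw [h]
    · rfl
  simp_rw [this]
  rw [Finset.sum_ite_eq]
  split_ifs with h
  · rfl
  · rw [homogeneousComponent_eq_zero, map_zero]
    simpa using h

theorem coeff_w_mul {K : Type*} [Field K] (F G : MvPolynomial (Fin 4) K) (i : ℕ) :
    coeff (Finsupp.single 0 i) (F * G) = ∑ p ∈ Finset.HasAntidiagonal.antidiagonal i,
      coeff (Finsupp.single 0 p.1) F * coeff (Finsupp.single 0 p.2) G := by
  rw [coeff_mul, Finsupp.antidiagonal_single, Finset.sum_map]
  rfl

theorem constantCoeff_prj {K : Type*} [Field K] (F : MvPolynomial (Fin 4) K) :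
    constantCoeff (prj K F) = constantCoeff F := by
  have h := prj_homogeneousComponent F 0
  rw [homogeneousComponent_zero, homogeneousComponent_zero] at h
  have h' : prj K (C (coeff 0 F)) = C (coeff 0 F) := (prj K).commutes _
  rw [h'] at h
  exact C_injective _ _ h

theorem socle_mul {K : Type*} [Field K] (I' : Ideal (MvPolynomial (Fin 3) K))
    (u : MvPolynomial (Fin 3) K) (hus : ∀ k, X k * u ∈ I') (g : MvPolynomial (Fin 3) K) :
    u * (g - C (constantCoeff g)) ∈ I' := by
  induction g using MvPolynomial.induction_on with
  | C a => simp
  | add p q hp hq =>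
    have := I'.add_mem hp hq
    convert this using 1
    rw [map_add, map_add]; ring
  | mul_X p k _ =>
    have : u * (p * X k - C (constantCoeff (p * X k))) = p * (X k * u) := by
      simp; ring
    rw [this]
    exact I'.mul_mem_left _ (hus k)

/-- The connected sum ideal. -/
def connIdeal {K : Type*} [Field K] (I' : Ideal (MvPolynomial (Fin 3) K))
    (u : MvPolynomial (Fin 3) K) (hus : ∀ k, X k * u ∈ I') (j : ℕ) :
    Ideal (MvPolynomial (Fin 4) K) where
  carrier := {F | (∀ i < j, coeff (Finsupp.single 0 i) F = 0) ∧
    prj K F + C (coeff (Finsupp.single 0 j) F) * u ∈ I'}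
  zero_mem' := by simp
  add_mem' := by
    rintro F G ⟨hF1, hF2⟩ ⟨hG1, hG2⟩
    refine ⟨fun i hi => by rw [coeff_add, hF1 i hi, hG1 i hi, add_zero], ?_⟩
    have := I'.add_mem hF2 hG2
    convert this using 1
    rw [map_add, coeff_add, C_add]; ring
  smul_mem' := by
    rintro G F ⟨hF1, hF2⟩
    rw [smul_eq_mul, mul_comm]
    refine ⟨fun i hi => ?_, ?_⟩
    · rw [coeff_w_mul]
      refine Finset.sum_eq_zero fun p hp => ?_
      rw [Finset.HasAntidiagonal.mem_antidiagonal] at hp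
      rw [hF1 p.1 (by omega), zero_mul]
    · have hc : coeff (Finsupp.single 0 j) (F * G)
          = coeff (Finsupp.single 0 j) F * constantCoeff (prj K G) := by
        rw [coeff_w_mul, Finset.sum_eq_single (j, 0)]
        · rw [constantCoeff_prj, constantCoeff_eq, Finsupp.single_zero]
        · rintro ⟨p, q⟩ hp hne
          rw [Finset.HasAntidiagonal.mem_antidiagonal] at hp
          have hp' : p + q = j := hp
          have : p < j := by
            rcases Nat.lt_or_ge p j with h | h
            · exact h
            · exact absurd (Prod.ext (by simp; omega) (by simp; omega)) hne
          rw [hF1 p this, zero_mul]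
        · intro h
          exact absurd (Finset.HasAntidiagonal.mem_antidiagonal.2 (by simp)) h
      have h1 := I'.mul_mem_left (prj K G) hF2
      have h2 := I'.mul_mem_left (C (coeff (Finsupp.single 0 j) F)) (socle_mul I' u hus (prj K G))
      have := I'.sub_mem h1 h2
      convert this using 1
      rw [hc, map_mul, C_mul]; ring

theorem mem_connIdeal {K : Type*} [Field K] (I' : Ideal (MvPolynomial (Fin 3) K))
    (u : MvPolynomial (Fin 3) K) (hus : ∀ k, X k * u ∈ I') (j : ℕ) (F : MvPolynomial (Fin 4) K) :
    F ∈ connIdeal I' u hus j ↔ (∀ i < j, coeff (Finsupp.single 0 i) F = 0) ∧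
    prj K F + C (coeff (Finsupp.single 0 j) F) * u ∈ I' := Iff.rfl

theorem coeff_ren {K : Type*} [Field K] (g : MvPolynomial (Fin 3) K) (i : ℕ) (hi : i ≠ 0) :
    coeff (Finsupp.single 0 i) (ren K g) = 0 := by
  refine coeff_rename_eq_zero _ _ _ fun d hd => ?_
  exfalso
  have h1 := DFunLike.congr_fun hd 0
  rw [Finsupp.mapDomain_of_notMem_range, Finsupp.single_eq_same] at h1
  · exact hi h1.symm
  · simp [Fin.succ_ne_zero]

theorem coeff_X_succ_mul {K : Type*} [Field K] (k : Fin 3) (F : MvPolynomial (Fin 4) K) (i : ℕ) :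
    coeff (Finsupp.single 0 i) (X k.succ * F) = 0 := by
  rw [coeff_X_mul', if_neg]
  rw [Finsupp.mem_support_iff, not_not, Finsupp.single_apply,
    if_neg (Fin.succ_ne_zero k).symm]

theorem backward {K : Type*} [Field K] (j : ℕ) (hj : 4 ≤ j)
    (I' : Ideal (MvPolynomial (Fin 3) K)) (hAG : IsAG 3 K I' j) (h6 : hilb 3 K I' 2 = 6) :
    ∃ I : Ideal (MvPolynomial (Fin 4) K), IsAG 4 K I j ∧
      hilb 4 K I 0 = 1 ∧ (∀ i, 1 ≤ i → i < j → hilb 4 K I i = hilb 3 K I' i + 1) ∧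
      Submodule.restrictScalars K I ⊓ homogeneousSubmodule (Fin 4) K 2 =
        Submodule.span K {X 0 * X 1, X 0 * X 2, X 0 * X 3} := by
  obtain ⟨hdeg, u, hu, huI, hus, hspan⟩ := hAG.struct_facts
  have hfd' : FiniteDimensional K (MvPolynomial (Fin 3) K ⧸ I') := hAG.2.1
  let I := connIdeal I' u hus j
  have hmem : ∀ F, F ∈ I ↔ (∀ i < j, coeff (Finsupp.single 0 i) F = 0) ∧
    prj K F + C (coeff (Finsupp.single 0 j) F) * u ∈ I' := mem_connIdeal I' u hus j
  have hpw : prj K (X 0) = 0 := by simp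
  have h1I' : (1 : MvPolynomial (Fin 3) K) ∉ I' := fun h => huI (by
    simpa using I'.mul_mem_left u h)
  have hcomap : ∀ g, g ∈ I' ↔ ren K g ∈ I := by
    intro g
    rw [hmem, coeff_ren g j (by omega), C_0, zero_mul, add_zero, prj_ren]
    refine ⟨fun hg => ⟨fun i hi => ?_, hg⟩, fun h => h.2⟩
    by_cases hi0 : i = 0
    · subst hi0
      rw [Finsupp.single_zero]
      have h0 := hAG.1 g hg 0
      rw [homogeneousComponent_zero] at h0
      by_contra hne
      have hne' : coeff 0 g ≠ 0 := by
        intro h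
        apply hne
        rw [← constantCoeff_eq, ← constantCoeff_prj, prj_ren, constantCoeff_eq, h]
      apply h1I'
      have := I'.mul_mem_left (C (coeff 0 g)⁻¹) h0
      rwa [← C_mul, inv_mul_cancel₀ hne', C_1] at this
    · exact coeff_ren g i hi0
  have hwx : ∀ k : Fin 3, X 0 * X k.succ ∈ I := by
    intro k
    rw [hmem, mul_comm]
    refine ⟨fun i _ => coeff_X_succ_mul k _ i, ?_⟩
    rw [coeff_X_succ_mul, map_mul, hpw]
    simp
  have hhom : IdealHomog I := by
    intro F hF d
    rw [hmem] at hF ⊢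
    refine ⟨fun i hi => ?_, ?_⟩
    · rw [coeff_homogeneousComponent, hF.1 i hi, ite_self]
    · have := hAG.1 _ hF.2 d
      convert this using 1
      rw [map_add, homogeneousComponent_C_mul, prj_homogeneousComponent,
        coeff_homogeneousComponent, Finsupp.degree_single,
        homogeneousComponent_of_mem ((mem_homogeneousSubmodule j u).2 hu)]
      by_cases h : j = d
      · rw [if_pos h, if_pos h.symm]
      · rw [if_neg h, if_neg (Ne.symm h)]; simp
  let L : MvPolynomial (Fin 4) K →ₗ[K] (MvPolynomial (Fin 3) K ⧸ I') × (Fin j → K) :=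
    LinearMap.prod
      ((Ideal.Quotient.mkₐ K I').toLinearMap ∘ₗ ((prj K).toLinearMap +
        (LinearMap.toSpanSingleton K _ u) ∘ₗ (lcoeff K (Finsupp.single 0 j))))
      (LinearMap.pi fun i : Fin j => lcoeff K (Finsupp.single 0 (i : ℕ)))
  have hL : ∀ F, L F = 0 ↔ F ∈ I := by
    intro F
    rw [hmem, Prod.ext_iff, and_comm]
    refine and_congr ?_ ?_
    · rw [funext_iff]
      exact ⟨fun h i hi => h ⟨i, hi⟩, fun h i => h i i.2⟩
    · rw [← smul_eq_C_mul]
      exact Ideal.Quotient.eq_zero_iff_mem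
  have hfd : FiniteDimensional K (MvPolynomial (Fin 4) K ⧸ I) := finiteDimensional_of_map I L hL
  have hdegI : ∀ i, j < i → ∀ F : MvPolynomial (Fin 4) K, F.IsHomogeneous i → F ∈ I := by
    intro i hi F hF
    rw [hmem]
    have hz : ∀ t, t ≤ j → coeff (Finsupp.single 0 t) F = 0 := fun t ht =>
      hF.coeff_eq_zero (by rw [Finsupp.degree_single]; omega)
    refine ⟨fun t ht => hz t ht.le, ?_⟩
    rw [hz j le_rfl, C_0, zero_mul, add_zero]
    exact hdeg i hi _ (prj_homog hF)
  have huI4 : ren K u ∉ I := fun h => huI ((hcomap u).2 h)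
  have hu4 : (ren K u).IsHomogeneous j := IsHomogeneous.rename_isHomogeneous hu
  have hAG4 : IsAG 4 K I j := by
    refine ⟨hhom, hfd, ?_, ?_, ?_⟩
    · refine socle_finrank_one I (ren K u) huI4
        (fun k => hdegI (1 + j) (by omega) _ ((isHomogeneous_X K k).mul hu4)) fun a ha => ?_
      have hw := (hmem _).1 (ha 0)
      have hshift : ∀ t, coeff (Finsupp.single 0 (t + 1)) (X 0 * a)
          = coeff (Finsupp.single 0 t) a := by
        intro t
        rw [Finsupp.single_add, add_comm, coeff_X_mul]
      have hz : ∀ t < j, coeff (Finsupp.single 0 t) a = 0 := by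
        intro t ht
        by_cases htj : t + 1 < j
        · rw [← hshift]; exact hw.1 _ htj
        · have htj' : t + 1 = j := by omega
          have h2 := hw.2
          rw [map_mul, hpw, zero_mul, zero_add, ← htj', hshift] at h2
          by_contra hne
          apply huI
          have := I'.mul_mem_left (C (coeff (Finsupp.single 0 t) a)⁻¹) h2
          rwa [← mul_assoc, ← C_mul, inv_mul_cancel₀ hne, C_1, one_mul] at this
      obtain ⟨c, hc⟩ := hspan (prj K a) (by
        intro k
        have h2 := ((hmem _).1 (ha k.succ)).2
        rw [coeff_X_succ_mul, C_0, zero_mul, add_zero, map_mul] at h2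
        simpa using h2)
      refine ⟨c + coeff (Finsupp.single 0 j) a, ?_⟩
      rw [hmem]
      have hzu : ∀ t, t ≠ 0 → coeff (Finsupp.single 0 t)
          (C (c + coeff (Finsupp.single 0 j) a) * ren K u) = 0 := by
        intro t ht
        rw [coeff_C_mul, coeff_ren u t ht, mul_zero]
      refine ⟨fun t ht => ?_, ?_⟩
      · rw [coeff_sub, hz t ht, coeff_C_mul, hu4.coeff_eq_zero, mul_zero, sub_zero]
        rw [Finsupp.degree_single]; omega
      · rw [coeff_sub, hzu j (by omega), map_sub, map_mul, prj_ren]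
        have h' : ∀ c : K, prj K (C c) = C c := (prj K).commutes
        rw [h']
        convert hc using 1
        rw [C_add, sub_zero]; ring
    · intro h
      exact huI4 ((hilb_eq_zero_iff I j).1 h _ hu4)
    · intro i hi
      exact (hilb_eq_zero_iff I i).2 (hdegI i hi)
  refine ⟨I, hAG4, hilb_zero fun h => huI4 (by simpa using I.mul_mem_left (ren K u) h), ?_, ?_⟩
  · intro i hi1 hij
    refine hilb_succ I I' hwx hcomap i fun g hg c hc => ?_
    have := ((hmem _).1 hc).1 i hij
    rwa [coeff_add, coeff_ren g i (by omega), zero_add, coeff_C_mul, X_pow_eq_monomial,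
      coeff_monomial, if_pos rfl, mul_one] at this
  · apply le_antisymm
    · rintro F ⟨hFI, hF⟩
      have hF' : F.IsHomogeneous 2 := hF
      have hFI' : F ∈ I := hFI
      have hPle : Submodule.span K {X 0 * X 1, X 0 * X 2, X 0 * X 3} ≤
          I.restrictScalars K := by
        rw [Submodule.span_le]
        rintro _ (rfl | rfl | rfl)
        · exact hwx 0
        · exact hwx 1
        · exact hwx 2
      obtain ⟨g, hg, c, hc⟩ := decomp
        (Submodule.span K {X 0 * X 1, X 0 * X 2, X 0 * X 3}) 2 (by
          intro d hd h0 ⟨k, hk⟩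
          have hd' : d = Finsupp.single 0 1 + Finsupp.single k.succ 1 := by
            rw [Finsupp.degree_eq_sum, Fin.sum_univ_four] at hd
            ext l
            fin_cases k <;> fin_cases l <;> simp [Finsupp.single_apply] at * <;> omega
          have : (monomial d (1 : K)) = X 0 * X k.succ := by
            rw [hd', X, X, monomial_mul, one_mul]
          rw [this]
          apply Submodule.subset_span
          fin_cases k <;> simp) F hF'
      have h1 : ren K g + C c * X 0 ^ 2 ∈ I := by
        have := I.sub_mem hFI' (hPle hc)
        convert this using 1
        ring
      have hc0 : c = 0 := by
        have := ((hmem _).1 h1).1 2 (by omega)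
        rwa [coeff_add, coeff_ren g 2 (by omega), zero_add, coeff_C_mul, X_pow_eq_monomial,
          coeff_monomial, if_pos rfl, mul_one] at this
      subst hc0
      rw [C_0, zero_mul, add_zero] at h1
      have hg0 : g = 0 := deg_two_zero I' h6 g hg ((hcomap g).2 h1)
      subst hg0
      simpa using hc
    · rw [Submodule.span_le]
      rintro _ (rfl | rfl | rfl)
      · exact ⟨hwx 0, (isHomogeneous_X K _).mul (isHomogeneous_X K _)⟩
      · exact ⟨hwx 1, (isHomogeneous_X K _).mul (isHomogeneous_X K _)⟩
      · exact ⟨hwx 2, (isHomogeneous_X K _).mul (isHomogeneous_X K _)⟩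

theorem hilb_pos {n : ℕ} {K : Type*} [Field K] {I : Ideal (MvPolynomial (Fin n) K)} {j : ℕ}
    (hI : IsAG n K I j) (i : ℕ) (hij : i ≤ j) : hilb n K I i ≠ 0 := by
  have hfd := hI.2.1
  intro h
  rw [hilb_eq_zero_iff] at h
  refine hI.2.2.2.1 ((hilb_eq_zero_iff I j).2 fun F hF => ?_)
  have key : ∀ t, ∀ F : MvPolynomial (Fin n) K, F ∈ homogeneousSubmodule (Fin n) K (i + t) →
      F ∈ I := by
    intro t F hF
    rw [← homogeneousSubmodule_one_pow, pow_add, homogeneousSubmodule_one_pow] at hF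
    refine Submodule.mul_induction_on hF (fun a ha b _ => I.mul_mem_right _ (h a ha))
      fun a b ha hb => I.add_mem ha hb
  refine key (j - i) F ?_
  rw [Nat.add_sub_cancel' hij]
  exact hF

/-- Let `j ≥ 4` and let `H = (h_0,...,h_j)` with
`h_0 = h_j = 1`, `h_1 = 4`, `h_2 = 7`.  There is a graded Artinian Gorenstein
quotient `R/I` of `R = K[w,x,y,z]` with Hilbert function `H` and
`I_2 = ⟨wx, wy, wz⟩` iff the sequence `H' = (1, h_1 - 1, ..., h_{j-1} - 1, 1)`
is the Hilbert function of some graded Artinian Gorenstein quotient of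
`K[x,y,z]`. -/
theorem statement_11 {K : Type*} [Field K] [IsAlgClosed K] [CharZero K]
    (j : ℕ) (hj : 4 ≤ j) (h : ℕ → ℕ)
    (h0 : h 0 = 1) (hjv : h j = 1) (h1 : h 1 = 4) (h2 : h 2 = 7) :
    (∃ I : Ideal (MvPolynomial (Fin 4) K), IsAG 4 K I j ∧
      (∀ i ≤ j, hilb 4 K I i = h i) ∧
      Submodule.restrictScalars K I ⊓ homogeneousSubmodule (Fin 4) K 2 =
        Submodule.span K {X 0 * X 1, X 0 * X 2, X 0 * X 3}) ↔
    (∃ I' : Ideal (MvPolynomial (Fin 3) K), IsAG 3 K I' j ∧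
      hilb 3 K I' 0 = 1 ∧ hilb 3 K I' j = 1 ∧
      ∀ i, 1 ≤ i → i ≤ j - 1 → hilb 3 K I' i = h i - 1) := by
  constructor
  · rintro ⟨I, hAG, hH, hI2⟩
    obtain ⟨I', hAG', h0', hj', hs⟩ := forward j hj I hAG hI2
    refine ⟨I', hAG', h0', hj', fun i hi hij => ?_⟩
    rw [← hH i (by omega), hs i hi hij, Nat.add_sub_cancel]
  · rintro ⟨I', hAG', -, -, hH⟩
    have h6 : hilb 3 K I' 2 = 6 := by rw [hH 2 (by omega) (by omega), h2]
    obtain ⟨I, hAG, hz, hs, hI2⟩ := backward j hj I' hAG' h6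
    refine ⟨I, hAG, fun i hi => ?_, hI2⟩
    rcases Nat.eq_zero_or_pos i with rfl | hpos
    · rw [hz, h0]
    · rcases Nat.lt_or_ge i j with hlt | hge
      · have h3 := hH i hpos (by omega)
        have h4 := hilb_pos hAG' i hi
        rw [hs i hpos hlt]
        omega
      · have : i = j := by omega
        subst this
        rw [hAG.hilb_top, hjv]

end
end
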